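/- arXiv:2505.05733 — 7 statements merged into one kernel-verified Lean document; each statement's English description precedes it below -/
import Mathlib

section
/- Let q be an odd prime power. There exist primitive elements x, y, z of 𝔽_q satisfying x² + y² + z² = 1 if and only if q ∉ {3, 5, 9, 13, 25}. -/
namespace PrimitiveSphere

open Finset

section CharacterSums

variable {F : Type*} [Field F] [Fintype F]

theorem norm_gaussSum_le {ψ : AddChar F ℂ} (hψ : ψ ≠ 1) (χ : MulChar F ℂ) :
    ‖gaussSum χ ψ‖ ≤ √(Fintype.card F) := by
  by_cases hχ : χ = 1
  · rw [hχ, gaussSum_one_left hψ, norm_neg, norm_one, Real.one_le_sqrt]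
    exact_mod_cast Fintype.card_pos
  · have h := gaussSum_mul_gaussSum_eq_card hχ (AddChar.IsPrimitive.of_ne_one hψ)
    rw [← star_gaussSum_eq, RCLike.star_def, Complex.mul_conj] at h
    rw [← Real.sqrt_sq (norm_nonneg _), ← Complex.normSq_eq_norm_sq]
    exact (congrArg Real.sqrt (by exact_mod_cast h)).le

/-- Bounds `B √q` for the Gauss sums weighted by `f`, with a saving `c (√q - 1)` for the trivial
multiplicative character. -/
def WeightedGaussBound (ψ : AddChar F ℂ) (f : F → ℂ) (B c : ℝ) : Prop :=
  (∀ χ : MulChar F ℂ, ‖∑ a, f a * χ a * ψ a‖ ≤ B * √(Fintype.card F)) ∧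
    ‖∑ a, f a * (1 : MulChar F ℂ) a * ψ a‖ ≤
      B * √(Fintype.card F) - c * (√(Fintype.card F) - 1)

theorem ite_eq_one_of_pow_eq_one {p : ℕ} (hp : 0 < p) {z : ℂ} (hz : z ^ p = 1) :
    (if z = 1 then (0 : ℂ) else 1) =
      (1 - 1 / (p : ℂ)) - 1 / (p : ℂ) * ∑ j ∈ range (p - 1), z ^ (j + 1) := by
  have hp0 : (p : ℂ) ≠ 0 := by exact_mod_cast hp.ne'
  have hs : ∑ j ∈ range (p - 1), z ^ (j + 1) = ∑ j ∈ range p, z ^ j - 1 := by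
    obtain ⟨k, rfl⟩ : ∃ k, p = k + 1 := ⟨p - 1, by omega⟩
    rw [sum_range_succ' (fun j ↦ z ^ j) k]
    simp
  rw [hs]
  split_ifs with h
  · subst h
    simp
    field_simp
    ring
  · rw [geom_sum_eq h, hz]
    simp

theorem WeightedGaussBound.sieve {ψ : AddChar F ℂ} {f : F → ℂ} {B c : ℝ}
    (hf : WeightedGaussBound ψ f B c) {p : ℕ} (hp : 0 < p) (ξ : MulChar F ℂ)
    (hξ : ∀ a, f a ≠ 0 → ξ a ^ p = 1) :
    WeightedGaussBound ψ (fun a ↦ f a * if ξ a = 1 then 0 else 1)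
      (2 * (1 - 1 / p) * B) ((1 - 1 / p) * c) := by
  have hp0 : (0 : ℝ) < p := by exact_mod_cast hp
  have hp1 : (1 : ℝ) ≤ p := by exact_mod_cast hp
  have hi : (0 : ℝ) ≤ 1 - 1 / p := by
    rw [sub_nonneg, div_le_one hp0]
    exact hp1
  have key (χ : MulChar F ℂ) : ∑ a, (f a * if ξ a = 1 then 0 else 1) * χ a * ψ a =
      (1 - 1 / (p : ℂ)) * ∑ a, f a * χ a * ψ a -
        1 / (p : ℂ) * ∑ j ∈ range (p - 1), ∑ a, f a * (χ * ξ ^ (j + 1)) a * ψ a := by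
    rw [sum_comm, mul_sum, mul_sum, ← sum_sub_distrib]
    refine sum_congr rfl fun a _ ↦ ?_
    by_cases h : f a = 0
    · simp [h]
    rw [ite_eq_one_of_pow_eq_one hp (hξ a h)]
    simp only [MulChar.mul_apply, MulChar.pow_apply' _ (Nat.succ_ne_zero _), ← sum_mul,
      ← mul_sum]
    have : ∑ j ∈ range (p - 1), f a * (χ a * ξ a ^ (j + 1)) * ψ a =
        f a * χ a * ψ a * ∑ j ∈ range (p - 1), ξ a ^ (j + 1) := by
      rw [mul_sum]
      exact sum_congr rfl fun j _ ↦ by ring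
    rw [← sum_mul, ← mul_sum, ← mul_sum] at this
    rw [this]
    ring
  have bound (χ : MulChar F ℂ) : ‖∑ a, (f a * if ξ a = 1 then 0 else 1) * χ a * ψ a‖ ≤
      (1 - 1 / p) * ‖∑ a, f a * χ a * ψ a‖ + (1 - 1 / p) * (B * √(Fintype.card F)) := by
    rw [key]
    refine (norm_sub_le _ _).trans (add_le_add ?_ ?_)
    · rw [norm_mul]
      have : (1 - 1 / (p : ℂ)) = ((1 - 1 / p : ℝ) : ℂ) := by push_cast; rfl
      rw [this, Complex.norm_real, Real.norm_of_nonneg hi]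
    · rw [norm_mul]
      have h1 : ‖∑ j ∈ range (p - 1), ∑ a, f a * (χ * ξ ^ (j + 1)) a * ψ a‖ ≤
          ∑ j ∈ range (p - 1), B * √(Fintype.card F) := norm_sum_le_of_le _ fun j _ ↦ hf.1 _
      rw [sum_const, card_range, nsmul_eq_mul, Nat.cast_sub hp] at h1
      calc _ ≤ ‖1 / (p : ℂ)‖ * (((p : ℝ) - (1 : ℕ)) * (B * √(Fintype.card F))) := by gcongr
        _ = _ := by
          rw [norm_div, norm_one, Complex.norm_natCast]
          push_cast
          field_simp
  constructor
  · intro χ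
    refine (bound χ).trans ?_
    have := mul_le_mul_of_nonneg_left (hf.1 χ) hi
    linarith
  · refine (bound 1).trans ?_
    have := mul_le_mul_of_nonneg_left hf.2 hi
    linarith

theorem weightedGaussBound_sq {ψ : AddChar F ℂ} (hψ : ψ ≠ 1) {η : MulChar F ℂ} (hη : η ^ 2 = 1) :
    WeightedGaussBound ψ (fun a ↦ if η a = 1 then 1 else 0) 1 (1 / 2) := by
  have key (χ : MulChar F ℂ) : ∑ a, (if η a = 1 then 1 else 0) * χ a * ψ a =
      (1 / 2) * (gaussSum χ ψ + gaussSum (χ * η) ψ) := by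
    rw [gaussSum, gaussSum, ← sum_add_distrib, mul_sum]
    refine sum_congr rfl fun a _ ↦ ?_
    by_cases ha : a = 0
    · simp [ha, MulChar.map_zero]
    have h2 : η a ^ 2 = 1 := by
      rw [← MulChar.pow_apply' _ two_ne_zero, hη, MulChar.one_apply (isUnit_iff_ne_zero.2 ha)]
    rcases sq_eq_one_iff.1 h2 with h | h <;> simp [h, MulChar.mul_apply]
    · ring
    · norm_num
  have h2 : ‖(1 / 2 : ℂ)‖ = 1 / 2 := by norm_num
  constructor
  · intro χ
    rw [key, norm_mul, h2]
    have := norm_add_le_of_le (norm_gaussSum_le hψ χ) (norm_gaussSum_le hψ (χ * η))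
    linarith
  · rw [key, norm_mul, h2, gaussSum_one_left hψ]
    have := norm_add_le_of_le (norm_neg (1 : ℂ)).le (norm_gaussSum_le hψ (1 * η))
    rw [norm_one] at this
    linarith

theorem exists_mulChar_pow_eq_one_iff (F : Type*) [Field F] [Fintype F] :
    ∃ χ : MulChar F ℂ, ∀ a : F, a ≠ 0 → ∀ n : ℕ, χ a ^ n = 1 ↔ a ^ n = 1 := by
  classical
  obtain ⟨χ, hχ⟩ := MulChar.exists_mulChar_orderOf_eq_card_units F
    (Complex.isPrimitiveRoot_exp (Fintype.card Fˣ) Fintype.card_ne_zero)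
  obtain ⟨g, hg⟩ := IsCyclic.exists_generator (α := Fˣ)
  refine ⟨χ, fun a ha n ↦ ⟨fun h ↦ ?_, fun h ↦ by rw [← map_pow, h, map_one]⟩⟩
  obtain ⟨k, hk⟩ := mem_powers_iff_mem_zpowers.2 (hg (Units.mk0 a ha))
  have hk' : a = (g : F) ^ k := by
    rw [← Units.val_pow_eq_pow_val]
    exact (congrArg Units.val hk).symm
  have h1 : χ ^ (k * n) = 1 := by
    rw [MulChar.eq_iff hg, MulChar.pow_apply_coe, MulChar.one_apply_coe, pow_mul, ← map_pow, ← hk',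
      h]
  have h2 : g ^ (k * n) = 1 := by
    rw [← orderOf_dvd_iff_pow_eq_one, orderOf_eq_card_of_forall_mem_zpowers hg,
      Nat.card_eq_fintype_card, ← hχ]
    exact orderOf_dvd_of_pow_eq_one h1
  rw [hk', ← pow_mul, ← Units.val_pow_eq_pow_val, h2, Units.val_one]

theorem norm_sum_addChar_orderOf_le {h : ℕ} (hF : Fintype.card F = 2 * h + 1) (h0 : 0 < h)
    [DecidableEq F] {ψ : AddChar F ℂ} (hψ : ψ ≠ 1) :
    ‖∑ a with orderOf a = h, ψ a‖ ≤ (∏ p ∈ h.primeFactors, (1 - 1 / (p : ℝ))) *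
      (2 ^ #h.primeFactors * √(Fintype.card F) - 1 / 2 * (√(Fintype.card F) - 1)) := by
  obtain ⟨χ, hχ⟩ := exists_mulChar_pow_eq_one_iff F
  have hη : (χ ^ h) ^ 2 = 1 := by
    ext a
    rw [← pow_mul, MulChar.pow_apply_coe, MulChar.one_apply_coe, hχ _ a.ne_zero, mul_comm,
      ← Nat.add_sub_cancel (2 * h) 1, ← hF, FiniteField.pow_card_sub_one_eq_one _ a.ne_zero]
  have ind (S : Finset ℕ) (hS : S ⊆ h.primeFactors) : WeightedGaussBound ψ
      (fun a ↦ (if (χ ^ h) a = 1 then 1 else 0) *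
        ∏ p ∈ S, if (χ ^ (h / p)) a = 1 then 0 else 1)
      ((∏ p ∈ S, (1 - 1 / (p : ℝ))) * 2 ^ #S) ((∏ p ∈ S, (1 - 1 / (p : ℝ))) * (1 / 2)) := by
    induction S using Finset.induction_on with
    | empty => simpa using weightedGaussBound_sq hψ hη
    | insert p S hp ih =>
      have hpm := Nat.mem_primeFactors.1 (hS (mem_insert_self p S))
      have := (ih ((subset_insert p S).trans hS)).sieve hpm.1.pos (χ ^ (h / p)) ?_
      · convert this using 1
        · ext a
          rw [prod_insert hp]
          ring
        · rw [prod_insert hp, card_insert_of_notMem hp]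
          ring
        · rw [prod_insert hp]
          ring
      · intro a ha
        have ha1 : (χ ^ h) a = 1 := by
          by_contra hne
          simp [hne] at ha
        rw [← MulChar.pow_apply' _ hpm.1.ne_zero, ← pow_mul, Nat.div_mul_cancel hpm.2.1, ha1]
  have fin := (ind _ subset_rfl).2
  have e : ∑ a with orderOf a = h, ψ a = ∑ a, ((if (χ ^ h) a = 1 then 1 else 0) *
      ∏ p ∈ h.primeFactors, if (χ ^ (h / p)) a = 1 then 0 else 1) *
        (1 : MulChar F ℂ) a * ψ a := by
    rw [sum_filter]
    refine sum_congr rfl fun a _ ↦ ?_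
    by_cases ha : a = 0
    · subst ha
      simp [h0.ne, MulChar.map_zero]
    rw [MulChar.one_apply (isUnit_iff_ne_zero.2 ha), mul_one]
    have hpw (n : ℕ) (hn : n ≠ 0) : (χ ^ n) a = 1 ↔ a ^ n = 1 := by
      rw [MulChar.pow_apply' _ hn, hχ a ha]
    have hd (p : ℕ) (hp : p ∈ h.primeFactors) : h / p ≠ 0 :=
      (Nat.div_pos (Nat.le_of_mem_primeFactors hp) (Nat.pos_of_mem_primeFactors hp)).ne'
    split_ifs with h1 h2 h2
    · rw [prod_eq_one, mul_one, one_mul]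
      intro p hp
      rw [if_neg]
      rw [hpw _ (hd p hp)]
      refine pow_ne_one_of_lt_orderOf (hd p hp) ?_
      rw [h1]
      exact Nat.div_lt_self h0 (Nat.prime_of_mem_primeFactors hp).one_lt
    · exact absurd ((hpw h h0.ne').2 (h1 ▸ pow_orderOf_eq_one a)) h2
    · have : ∃ p ∈ h.primeFactors, a ^ (h / p) = 1 := by
        by_contra! hne
        refine h1 (orderOf_eq_of_pow_and_pow_div_prime h0 ((hpw h h0.ne').1 h2) fun p hp hph ↦ ?_)
        exact hne p (Nat.mem_primeFactors.2 ⟨hp, hph, h0.ne'⟩)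
      obtain ⟨p, hp, hpa⟩ := this
      have h0p : (∏ p ∈ h.primeFactors, if (χ ^ (h / p)) a = 1 then (0 : ℂ) else 1) = 0 :=
        prod_eq_zero hp (if_pos ((hpw _ (hd p hp)).2 hpa))
      rw [h0p, mul_zero, zero_mul]
    · simp
  rw [e]
  exact fin.trans_eq (by ring)

theorem card_filter_orderOf_eq [DecidableEq F] {d : ℕ} (h0 : 0 < d)
    (hd : d ∣ Fintype.card F - 1) : #{a : F | orderOf a = d} = d.totient := by
  rw [← IsCyclic.card_orderOf_eq_totient (α := Fˣ) (d := d)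
    (by rwa [Fintype.card_units])]
  symm
  refine card_bij (fun u _ ↦ (u : F)) (fun u hu ↦ ?_) (fun _ _ _ _ ↦ Units.ext) fun a ha ↦ ?_
  · simpa [orderOf_units] using hu
  · rw [mem_filter] at ha
    have ha0 : a ≠ 0 := by
      rintro rfl
      rw [orderOf_zero] at ha
      exact h0.ne ha.2
    exact ⟨Units.mk0 a ha0, by simp [← orderOf_units, ha.2], rfl⟩

theorem card_sq_le_of_forall_add_add_ne_one [DecidableEq F] {A : Finset F} (hA : A.Nonempty)
    {M : ℝ} (hM : ∀ ψ : AddChar F ℂ, ψ ≠ 1 → ‖∑ a ∈ A, ψ a‖ ≤ M)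
    (hsum : ∀ a ∈ A, ∀ b ∈ A, ∀ c ∈ A, a + b + c ≠ 1) :
    (#A : ℝ) ^ 2 ≤ M * (Fintype.card F - #A) := by
  have h3 : ∑ ψ : AddChar F ℂ, (∑ a ∈ A, ψ a) ^ 3 * ψ (-1) = 0 := by
    have (ψ : AddChar F ℂ) : (∑ a ∈ A, ψ a) ^ 3 * ψ (-1) =
        ∑ a ∈ A, ∑ b ∈ A, ∑ c ∈ A, ψ (a + b + c - 1) := by
      simp only [sub_eq_add_neg, AddChar.map_add_eq_mul, ← sum_mul, ← mul_sum]
      ring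
    simp only [this]
    rw [sum_comm]
    refine sum_eq_zero fun a ha ↦ ?_
    rw [sum_comm]
    refine sum_eq_zero fun b hb ↦ ?_
    rw [sum_comm]
    refine sum_eq_zero fun c hc ↦ ?_
    rw [AddChar.sum_apply_eq_ite, if_neg (sub_ne_zero.2 (hsum a ha b hb c hc))]
  have h2 : ∑ ψ : AddChar F ℂ, ‖∑ a ∈ A, ψ a‖ ^ 2 = Fintype.card F * #A := by
    have (ψ : AddChar F ℂ) : ((‖∑ a ∈ A, ψ a‖ ^ 2 : ℝ) : ℂ) =
        ∑ a ∈ A, ∑ b ∈ A, ψ (a - b) := by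
      simp only [sub_eq_add_neg, AddChar.map_add_eq_mul, AddChar.map_neg_eq_conj, ← sum_mul,
        ← mul_sum, ← map_sum]
      rw [Complex.mul_conj, Complex.normSq_eq_norm_sq]
    apply Complex.ofReal_injective
    rw [Complex.ofReal_sum]
    simp only [this]
    rw [sum_comm]
    have (a : F) (ha : a ∈ A) : ∑ ψ : AddChar F ℂ, ∑ b ∈ A, ψ (a - b) = Fintype.card F := by
      rw [sum_comm]
      simp only [AddChar.sum_apply_eq_ite, sub_eq_zero]
      rw [sum_ite_eq, if_pos ha]
    rw [sum_congr rfl this, sum_const, nsmul_eq_mul]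
    push_cast
    ring
  have hpos : (0 : ℝ) < #A := by exact_mod_cast hA.card_pos
  rw [← add_sum_erase _ _ (mem_univ (1 : AddChar F ℂ))] at h2 h3
  simp only [AddChar.one_apply, sum_const, nsmul_eq_mul, mul_one, Complex.norm_natCast] at h2 h3
  have h4 : (#A : ℝ) ^ 3 ≤ M * (Fintype.card F * #A - (#A : ℝ) ^ 2) := by
    rw [← h2, add_sub_cancel_left, mul_sum]
    have : ((#A : ℂ)) ^ 3 = -∑ ψ ∈ univ.erase (1 : AddChar F ℂ),
        (∑ a ∈ A, ψ a) ^ 3 * ψ (-1) := eq_neg_of_add_eq_zero_left h3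
    calc (#A : ℝ) ^ 3 = ‖((#A : ℂ)) ^ 3‖ := by simp
      _ ≤ _ := by
        rw [this, norm_neg]
        refine norm_sum_le_of_le _ fun ψ hψ ↦ ?_
        rw [norm_mul, AddChar.norm_apply, mul_one, norm_pow, pow_succ']
        exact mul_le_mul_of_nonneg_right (hM ψ (ne_of_mem_erase hψ)) (by positivity)
  refine le_of_mul_le_mul_right ?_ hpos
  calc _ = (#A : ℝ) ^ 3 := by ring
    _ ≤ _ := h4
    _ = _ := by ring

theorem exists_orderOf_eq_add_add_eq_one {h : ℕ} (hF : Fintype.card F = 2 * h + 1) (h0 : 0 < h)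
    (hlt : 2 * h + 1 < 2 * h.totient * h + h.totient)
    (hgood : (2 * 2 ^ #h.primeFactors - 1) ^ 2 * ((2 * h + 1) * (2 * h + 1 - h.totient) ^ 2) <
      (2 * h.totient * h + h.totient - (2 * h + 1)) ^ 2) :
    ∃ a b c : F, orderOf a = h ∧ orderOf b = h ∧ orderOf c = h ∧ a + b + c = 1 := by
  classical
  by_contra! hno
  have hφ : 0 < h.totient := Nat.totient_pos.2 h0
  have hφh : h.totient ≤ h := Nat.totient_le h
  have hcard : #{a : F | orderOf a = h} = h.totient :=
    card_filter_orderOf_eq h0 (by rw [hF]; exact ⟨2, by omega⟩)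
  have key := card_sq_le_of_forall_add_add_ne_one (A := {a : F | orderOf a = h})
    (card_pos.1 (hcard ▸ hφ)) (fun ψ hψ ↦ norm_sum_addChar_orderOf_le hF h0 hψ)
    (fun a ha b hb c hc ↦ hno a b c (mem_filter.1 ha).2 (mem_filter.1 hb).2 (mem_filter.1 hc).2)
  have hprod : (∏ p ∈ h.primeFactors, (1 - 1 / (p : ℝ))) * h = h.totient := by
    have := congrArg (fun x : ℚ ↦ (x : ℝ)) (Nat.totient_eq_mul_prod_factors h)
    push_cast at this
    rw [this, mul_comm]
    simp
  rw [hcard, hF] at key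
  set P := ∏ p ∈ h.primeFactors, (1 - 1 / (p : ℝ))
  set s := √((2 * h + 1 : ℕ) : ℝ) with hs
  have hs2 : s ^ 2 = 2 * h + 1 := by
    rw [hs, Real.sq_sqrt (by positivity)]
    push_cast
    ring
  have hs0 : 0 ≤ s := Real.sqrt_nonneg _
  set φ : ℝ := ((h.totient : ℕ) : ℝ)
  have hφ' : 0 < φ := Nat.cast_pos.2 hφ
  set W : ℝ := 2 ^ #h.primeFactors
  have hW1 : 1 ≤ W := one_le_pow₀ (by norm_num)
  have hle : 2 * φ * h + φ - (2 * h + 1) ≤ (2 * W - 1) * s * (2 * h + 1 - φ) := by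
    have h1 : φ ^ 2 * h ≤ φ * ((W * s - 1 / 2 * (s - 1)) * (2 * h + 1 - φ)) := by
      have := mul_le_mul_of_nonneg_right key (Nat.cast_nonneg h : (0 : ℝ) ≤ h)
      push_cast at this
      calc _ ≤ _ := this
        _ = (P * h) * ((W * s - 1 / 2 * (s - 1)) * (2 * h + 1 - φ)) := by ring
        _ = _ := by rw [hprod]
    have h2 : φ * h ≤ (W * s - 1 / 2 * (s - 1)) * (2 * h + 1 - φ) :=
      le_of_mul_le_mul_left (by linarith) hφ'
    linarith
  have hg : ((2 * W - 1) ^ 2 * ((2 * h + 1) * (2 * h + 1 - φ) ^ 2) : ℝ) <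
      (2 * φ * h + φ - (2 * h + 1)) ^ 2 := by
    have hg' := (Nat.cast_lt (α := ℝ)).2 hgood
    have h2 : 1 ≤ 2 * 2 ^ #h.primeFactors := by
      have := Nat.one_le_two_pow (n := #h.primeFactors)
      omega
    push_cast [Nat.cast_sub hlt.le, Nat.cast_sub h2,
      Nat.cast_sub (show h.totient ≤ 2 * h + 1 by omega)] at hg'
    exact hg'
  have hpos : 0 ≤ 2 * φ * h + φ - (2 * h + 1) := by
    have := (Nat.cast_lt (α := ℝ)).2 hlt
    push_cast at this
    linarith
  have := pow_le_pow_left₀ hpos hle 2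
  rw [mul_pow, mul_pow, hs2] at this
  linarith

end CharacterSums

/-- `forceNat n f` equals `f n`, but kernel reduction evaluates `n` before passing it on. -/
def forceNat {α : Type*} (n : ℕ) (f : ℕ → α) : α :=
  match n with
  | 0 => f 0
  | k + 1 => f (k + 1)

theorem forceNat_eq {α : Type*} (n : ℕ) (f : ℕ → α) : forceNat n f = f n := by
  cases n <;> rfl

/-- `forceList l f` equals `f l`, but kernel reduction evaluates `l` before passing it on. -/
def forceList {α : Type*} : List ℕ → (List ℕ → α) → α
  | [], f => f []
  | x :: l, f => forceNat x fun y ↦ forceList l fun t ↦ f (y :: t)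

theorem forceList_eq {α : Type*} (l : List ℕ) (f : List ℕ → α) : forceList l f = f l := by
  induction l generalizing f with
  | nil => rfl
  | cons x l ih => rw [forceList, forceNat_eq, ih]

/-- `a ^ e % q`, computed by repeatedly raising to the 256th power. -/
def powMod (q a : ℕ) : ℕ → ℕ → ℕ
  | 0, e => a ^ e % q
  | fuel + 1, e =>
    if e < 256 then a ^ e % q else powMod q a fuel (e / 256) ^ 256 % q * a ^ (e % 256) % q

/-- Tests whether `a` has multiplicative order `h` in any field with `q = 2 * h + 1` elements, where
`ps` lists the prime factors of `h`. -/
def orderTest (q h : ℕ) (ps : List ℕ) (a : ℕ) : Bool :=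
  powMod q a 3 h == 1 && ps.all fun p ↦ (powMod q a 3 (h / p) + (q - 1)).gcd q == 1

theorem natCast_mod_eq {R : Type*} [CommRing R] {p : ℕ} (hp : (p : R) = 0) (a : ℕ) :
    ((a % p : ℕ) : R) = a := by
  conv_rhs => rw [← Nat.div_add_mod a p]
  simp [hp]

section Nat

variable {F : Type*} [Field F] {q : ℕ}

theorem natCast_powMod (hq : (q : F) = 0) (a fuel e : ℕ) :
    (powMod q a fuel e : F) = (a : F) ^ e := by
  induction fuel generalizing e with
  | zero => rw [powMod, natCast_mod_eq hq, Nat.cast_pow]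
  | succ n ih =>
    rw [powMod]
    split_ifs
    · rw [natCast_mod_eq hq, Nat.cast_pow]
    · rw [natCast_mod_eq hq, Nat.cast_mul, natCast_mod_eq hq, Nat.cast_pow, Nat.cast_pow, ih,
        ← pow_mul, ← pow_add, Nat.div_add_mod']

theorem natCast_ne_zero_of_gcd (hq : (q : F) = 0) {a : ℕ} (h : a.gcd q = 1) : (a : F) ≠ 0 := by
  intro h0
  have := congrArg (fun z : ℤ ↦ (z : F)) (Nat.gcd_eq_gcd_ab a q)
  simp [h, h0, hq] at this

theorem orderOf_eq_of_orderTest (hq : (q : F) = 0) (hq0 : 0 < q) {h : ℕ} (h0 : 0 < h)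
    {ps : List ℕ} (hps : ∀ p : ℕ, p.Prime → p ∣ h → p ∈ ps) {a : ℕ}
    (ha : orderTest q h ps a = true) : orderOf (a : F) = h := by
  simp only [orderTest, Bool.and_eq_true, beq_iff_eq, List.all_eq_true] at ha
  refine orderOf_eq_of_pow_and_pow_div_prime h0 ?_ fun p hp hph hpow ↦ ?_
  · rw [← natCast_powMod hq a 3, ha.1, Nat.cast_one]
  · refine natCast_ne_zero_of_gcd hq (ha.2 p (hps p hp hph)) ?_
    rw [Nat.cast_add, natCast_powMod hq, hpow, Nat.cast_sub hq0, hq, Nat.cast_one]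
    ring

end Nat

/-- Addition of polynomials modulo `p`, given by their coefficients in increasing degree. -/
def polyAdd (p : ℕ) : List ℕ → List ℕ → List ℕ
  | [], b => b
  | x :: a, [] => x :: a
  | x :: a, y :: b => (x + y) % p :: polyAdd p a b

/-- Multiplication of polynomials modulo `p`. -/
def polyMul (p : ℕ) : List ℕ → List ℕ → List ℕ
  | [], _ => []
  | x :: a, b => polyAdd p (b.map fun y ↦ x * y % p) (0 :: polyMul p a b)

/-- Multiplication of polynomials modulo `p`, followed by a reduction with `X ^ d = f`. -/
def polyMulMod (p d : ℕ) (f a b : List ℕ) : List ℕ :=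
  forceList (polyMul p a b) fun c ↦ polyAdd p (c.take d) (polyMul p f (c.drop d))

/-- Powers of polynomials modulo `p` and `X ^ d = f`, by repeated squaring. -/
def polyPowMod (p d : ℕ) (f a : List ℕ) : ℕ → ℕ → List ℕ
  | 0, e => (polyMulMod p d f a)^[e] [1]
  | fuel + 1, e =>
    if e = 0 then [1] else
      forceList (polyPowMod p d f a fuel (e / 2)) fun b ↦
        forceList (polyMulMod p d f b b) fun c ↦
          if e % 2 = 1 then polyMulMod p d f c a else c

/-- Tests whether all coefficients vanish. -/
def polyIsZero (a : List ℕ) : Bool := a.all (· == 0)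

/-- The value at `x` of the polynomial with coefficients `a` in increasing degree. -/
def polyEval {R : Type*} [CommRing R] (x : R) : List ℕ → R
  | [] => 0
  | c :: a => c + x * polyEval x a

section Poly

variable {R : Type*} [CommRing R] {x : R} {p : ℕ}

theorem polyEval_add (hp : (p : R) = 0) (a b : List ℕ) :
    polyEval x (polyAdd p a b) = polyEval x a + polyEval x b := by
  induction a generalizing b with
  | nil => simp [polyAdd, polyEval]
  | cons c a ih =>
    cases b with
    | nil => simp [polyAdd, polyEval]
    | cons d b =>
      simp only [polyAdd, polyEval, ih, natCast_mod_eq hp, Nat.cast_add]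
      ring

theorem polyEval_map_mul (hp : (p : R) = 0) (c : ℕ) (a : List ℕ) :
    polyEval x (a.map fun y ↦ c * y % p) = c * polyEval x a := by
  induction a with
  | nil => simp [polyEval]
  | cons d a ih =>
    simp only [List.map_cons, polyEval, ih, natCast_mod_eq hp, Nat.cast_mul]
    ring

theorem polyEval_mul (hp : (p : R) = 0) (a b : List ℕ) :
    polyEval x (polyMul p a b) = polyEval x a * polyEval x b := by
  induction a with
  | nil => simp [polyMul, polyEval]
  | cons c a ih =>
    simp only [polyMul, polyEval, polyEval_add hp, polyEval_map_mul hp, ih, Nat.cast_zero]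
    ring

theorem polyEval_take_add_drop (d : ℕ) (a : List ℕ) :
    polyEval x (a.take d) + x ^ d * polyEval x (a.drop d) = polyEval x a := by
  induction d generalizing a with
  | zero => simp [polyEval]
  | succ d ih =>
    cases a with
    | nil => simp [polyEval]
    | cons c a =>
      simp only [List.take_succ_cons, List.drop_succ_cons, polyEval, ← ih a]
      ring

variable {d : ℕ} {f : List ℕ}

theorem polyEval_mulMod (hp : (p : R) = 0) (hf : x ^ d = polyEval x f) (a b : List ℕ) :
    polyEval x (polyMulMod p d f a b) = polyEval x a * polyEval x b := by
  rw [polyMulMod, forceList_eq, polyEval_add hp, polyEval_mul hp, ← hf, polyEval_take_add_drop,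
    polyEval_mul hp]

theorem polyEval_powMod (hp : (p : R) = 0) (hf : x ^ d = polyEval x f) (a : List ℕ)
    (fuel e : ℕ) : polyEval x (polyPowMod p d f a fuel e) = polyEval x a ^ e := by
  induction fuel generalizing e with
  | zero =>
    rw [polyPowMod]
    induction e with
    | zero => simp [polyEval]
    | succ e ih => rw [Function.iterate_succ_apply', polyEval_mulMod hp hf, ih, pow_succ']
  | succ fuel ih =>
    rw [polyPowMod]
    rcases eq_or_ne e 0 with rfl | h0
    · simp [polyEval]
    · rw [if_neg h0, forceList_eq, forceList_eq]
      conv_rhs => rw [← Nat.div_add_mod e 2]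
      rcases Nat.mod_two_eq_zero_or_one e with h1 | h1
      · rw [if_neg (by omega), polyEval_mulMod hp hf, ih, h1]
        ring
      · rw [if_pos h1, polyEval_mulMod hp hf, polyEval_mulMod hp hf, ih, h1]
        ring

theorem polyEval_eq_zero {a : List ℕ} (ha : polyIsZero a = true) : polyEval x a = 0 := by
  induction a with
  | nil => rfl
  | cons c a ih =>
    simp only [polyIsZero, List.all_cons, Bool.and_eq_true, beq_iff_eq] at ha ih
    rw [polyEval, ha.1, ih ha.2]
    simp

end Poly

/-- The coefficients of `a - 1` modulo `p`. -/
def polySubOne (p : ℕ) (a : List ℕ) : List ℕ := polyAdd p a [p - 1]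

/-- Tests whether the value of `a` has multiplicative order `h` in any field with `q = 2 * h + 1`
elements, where `ps` lists the prime factors of `h`. -/
def polyOrderTest (q p d : ℕ) (f : List ℕ) (h : ℕ) (ps : List ℕ) (a : List ℕ) : Bool :=
  polyIsZero (polySubOne p (polyPowMod p d f a 32 h)) &&
    forceList (ps.foldr (fun l b ↦ forceList (polySubOne p (polyPowMod p d f a 32 (h / l))) fun c ↦
      forceList b fun b' ↦ polyMulMod p d f c b') [1]) fun b ↦
        polyIsZero (polySubOne p (polyPowMod p d f b 32 (q - 1)))

/-- Tests whether `X ^ d - f` divides `X ^ q - X` modulo `p`. -/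
def splitTest (q p d : ℕ) (f : List ℕ) : Bool :=
  polyIsZero (polyAdd p (polyPowMod p d f [0, 1] 32 q) [0, p - 1])

theorem polyEval_subOne {R : Type*} [CommRing R] {x : R} {p : ℕ} (hp : (p : R) = 0) (hp0 : 0 < p)
    (a : List ℕ) : polyEval x (polySubOne p a) = polyEval x a - 1 := by
  rw [polySubOne, polyEval_add hp]
  simp [polyEval, Nat.cast_sub (Nat.one_le_iff_ne_zero.2 hp0.ne'), hp]
  ring

theorem orderOf_eq_of_polyOrderTest {F : Type*} [Field F] {x : F} {p d q h : ℕ} {f ps a : List ℕ}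
    (hp : (p : F) = 0) (hp0 : 0 < p) (hf : x ^ d = polyEval x f) (h0 : 0 < h) (hq : 1 < q)
    (hps : ∀ l : ℕ, l.Prime → l ∣ h → l ∈ ps) (ha : polyOrderTest q p d f h ps a = true) :
    orderOf (polyEval x a) = h := by
  simp only [polyOrderTest, Bool.and_eq_true, forceList_eq] at ha
  obtain ⟨ha1, ha2⟩ := ha
  have h1 := polyEval_eq_zero (x := x) ha1
  have h2 := polyEval_eq_zero (x := x) ha2
  rw [polyEval_subOne hp hp0, polyEval_powMod hp hf, sub_eq_zero] at h1 h2
  refine orderOf_eq_of_pow_and_pow_div_prime h0 h1 fun l hl hlh hpow ↦ ?_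
  have hz : ∀ ls : List ℕ, l ∈ ls → polyEval x (ls.foldr (fun l b ↦
      polyMulMod p d f (polySubOne p (polyPowMod p d f a 32 (h / l))) b) [1]) = 0 := by
    intro ls hls
    induction ls with
    | nil => simp at hls
    | cons c ls ih =>
      rw [List.foldr_cons, polyEval_mulMod hp hf, polyEval_subOne hp hp0, polyEval_powMod hp hf]
      rcases List.mem_cons.1 hls with rfl | hls
      · rw [hpow, sub_self, zero_mul]
      · rw [ih hls, mul_zero]
  rw [hz ps (hps l hl hlh), zero_pow (by omega)] at h2
  exact zero_ne_one h2

open Polynomial in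
theorem exists_root_of_splitTest {F : Type*} [Field F] [Fintype F] {p d : ℕ} {f : List ℕ}
    (hp : (p : F) = 0) (hp0 : 0 < p) (hd : 0 < d) (hfd : f.length ≤ d)
    (ht : splitTest (Fintype.card F) p d f = true) : ∃ x : F, x ^ d = polyEval x f := by
  set q := Fintype.card F
  set P : F[X] := X ^ d - polyEval X f with hP
  have heval (l : List ℕ) {R : Type _} [CommRing R] (φ : F[X] →+* R) :
      φ (polyEval X l) = polyEval (φ X) l := by
    induction l with
    | nil => simp [polyEval]
    | cons c l ih => simp [polyEval, ih]
  have hdeg (l : List ℕ) : (polyEval (X : F[X]) l).degree < l.length := by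
    induction l with
    | nil => simp [polyEval]
    | cons c l ih =>
      rw [polyEval]
      refine (degree_add_le _ _).trans_lt (max_lt ?_ ?_)
      · refine (degree_natCast_le _).trans_lt ?_
        exact_mod_cast Nat.succ_pos _
      · rw [List.length_cons, Nat.cast_succ, degree_mul, degree_X, add_comm]
        by_cases h0 : polyEval (X : F[X]) l = 0
        · rw [h0, degree_zero]
          exact WithBot.bot_lt_coe (l.length + 1)
        · rw [degree_eq_natDegree h0] at ih ⊢
          have := WithBot.coe_lt_coe.1 ih
          exact_mod_cast Nat.succ_lt_succ this
  have hPdeg : P.degree = d := by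
    rw [hP, degree_sub_eq_left_of_degree_lt, degree_X_pow]
    rw [degree_X_pow]
    exact (hdeg f).trans_le (by exact_mod_cast hfd)
  have hroot : (AdjoinRoot.root P) ^ d = polyEval (AdjoinRoot.root P) f := by
    have := AdjoinRoot.mk_self (f := P)
    rw [hP, map_sub, heval, map_pow, AdjoinRoot.mk_X, sub_eq_zero] at this
    exact this
  have hpR : (p : AdjoinRoot P) = 0 := by
    rw [← map_natCast (AdjoinRoot.of P), hp, map_zero]
  have hpow : (AdjoinRoot.root P) ^ q - AdjoinRoot.root P = 0 := by
    have := polyEval_eq_zero (x := AdjoinRoot.root P) ht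
    rw [polyEval_add hpR, polyEval_powMod hpR hroot] at this
    simpa [polyEval, Nat.cast_sub (Nat.one_le_iff_ne_zero.2 hp0.ne'), hpR, ← sub_eq_add_neg]
      using this
  have hdvd : P ∣ X ^ q - X := by
    rw [← AdjoinRoot.mk_eq_zero, map_sub, map_pow, AdjoinRoot.mk_X, hpow]
  have hsplit : P.Splits := by
    have hs : (X ^ q - X : F[X]).Splits := by
      rw [splits_iff_card_roots, FiniteField.roots_X_pow_card_sub_X,
        FiniteField.X_pow_card_sub_X_natDegree_eq F Fintype.one_lt_card]
      rfl
    exact hs.of_dvd (FiniteField.X_pow_card_sub_X_ne_zero F Fintype.one_lt_card) hdvd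
  obtain ⟨x, hx⟩ := hsplit.exists_eval_eq_zero (by
    rw [hPdeg]
    exact_mod_cast hd.ne')
  refine ⟨x, ?_⟩
  have := heval f (evalRingHom x)
  rw [hP, eval_sub, eval_pow, eval_X, sub_eq_zero] at hx
  rw [hx]
  simpa using this

/-- The primes below 1952. -/
def smallPrimes : List ℕ := [
  2, 3, 5, 7, 11, 13, 17, 19, 23, 29, 31, 37, 41, 43, 47, 53, 59, 61, 67, 71, 73, 79, 83, 89, 97,
  101, 103, 107, 109, 113, 127, 131, 137, 139, 149, 151, 157, 163, 167, 173, 179, 181, 191, 193,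
  197, 199, 211, 223, 227, 229, 233, 239, 241, 251, 257, 263, 269, 271, 277, 281, 283, 293, 307,
  311, 313, 317, 331, 337, 347, 349, 353, 359, 367, 373, 379, 383, 389, 397, 401, 409, 419, 421,
  431, 433, 439, 443, 449, 457, 461, 463, 467, 479, 487, 491, 499, 503, 509, 521, 523, 541, 547,
  557, 563, 569, 571, 577, 587, 593, 599, 601, 607, 613, 617, 619, 631, 641, 643, 647, 653, 659,
  661, 673, 677, 683, 691, 701, 709, 719, 727, 733, 739, 743, 751, 757, 761, 769, 773, 787, 797,
  809, 811, 821, 823, 827, 829, 839, 853, 857, 859, 863, 877, 881, 883, 887, 907, 911, 919, 929,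
  937, 941, 947, 953, 967, 971, 977, 983, 991, 997, 1009, 1013, 1019, 1021, 1031, 1033, 1039, 1049,
  1051, 1061, 1063, 1069, 1087, 1091, 1093, 1097, 1103, 1109, 1117, 1123, 1129, 1151, 1153, 1163,
  1171, 1181, 1187, 1193, 1201, 1213, 1217, 1223, 1229, 1231, 1237, 1249, 1259, 1277, 1279, 1283,
  1289, 1291, 1297, 1301, 1303, 1307, 1319, 1321, 1327, 1361, 1367, 1373, 1381, 1399, 1409, 1423,
  1427, 1429, 1433, 1439, 1447, 1451, 1453, 1459, 1471, 1481, 1483, 1487, 1489, 1493, 1499, 1511,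
  1523, 1531, 1543, 1549, 1553, 1559, 1567, 1571, 1579, 1583, 1597, 1601, 1607, 1609, 1613, 1619,
  1621, 1627, 1637, 1657, 1663, 1667, 1669, 1693, 1697, 1699, 1709, 1721, 1723, 1733, 1741, 1747,
  1753, 1759, 1777, 1783, 1787, 1789, 1801, 1811, 1823, 1831, 1847, 1861, 1867, 1871, 1873, 1877,
  1879, 1889, 1901, 1907, 1913, 1931, 1933, 1949, 1951]

/-- For the relevant primes `q`, in the order in which the search meets them, two elements `a`, `b`
of order `(q - 1) / 2` modulo `q` such that `1 - a - b` has the same order. -/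
def primeCerts : List (ℕ × ℕ) := [
  (2, 8), (18, 18), (6, 15), (14, 15), (6, 6), (14, 15), (7, 39), (10, 42), (2, 2), (3, 22),
  (11, 11), (13, 13), (7, 22), (5, 5), (2, 31), (22, 23), (10, 43), (17, 17), (24, 54), (6, 23),
  (20, 20), (26, 38), (2, 6), (19, 19), (6, 6), (18, 18), (20, 20), (20, 20), (15, 80), (2, 5),
  (13, 13), (24, 24), (6, 6), (6, 6), (21, 33), (18, 31), (2, 8), (2, 2), (7, 15), (5, 18),
  (14, 20), (19, 38), (2, 2), (5, 30), (17, 17), (10, 31), (7, 12), (39, 52), (12, 14), (2, 23),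
  (35, 35), (48, 50), (3, 10), (10, 10), (17, 73), (15, 15), (14, 57), (3, 44), (14, 29), (7, 12),
  (6, 34), (24, 26), (15, 23), (6, 24), (26, 26), (12, 37), (6, 49), (14, 37), (3, 10), (13, 41),
  (10, 26), (46, 46), (21, 22), (12, 12), (5, 31), (13, 13), (13, 13), (18, 18), (42, 42), (18, 18),
  (12, 20), (10, 10), (31, 68), (2, 2), (10, 14), (2, 7), (5, 5), (9, 15), (6, 6), (6, 12), (5, 24),
  (18, 33), (34, 57), (61, 61), (10, 40), (2, 5), (6, 24), (2, 12), (11, 28), (5, 10), (6, 6),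
  (11, 11), (11, 11), (18, 18), (3, 46), (7, 56), (19, 40), (3, 60), (6, 13), (10, 10), (2, 17),
  (3, 10), (18, 26), (12, 18), (6, 56), (46, 46), (15, 15), (25, 25), (2, 11), (2, 2), (3, 17),
  (25, 25), (3, 18), (20, 21), (30, 30), (6, 13), (6, 13), (7, 28), (5, 11), (13, 50), (74, 74),
  (3, 3), (30, 30), (12, 43), (5, 40), (60, 60), (3, 3), (18, 22), (12, 42), (2, 13), (55, 55),
  (3, 3), (21, 45), (2, 2), (3, 60), (34, 45), (20, 20), (23, 41), (3, 3), (5, 63), (7, 20),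
  (21, 21), (18, 18), (7, 24), (2, 18), (2, 14), (7, 28), (11, 11), (10, 10), (43, 57), (20, 21),
  (15, 15), (18, 18), (3, 24), (39, 103), (46, 46), (24, 24), (2, 2), (6, 6), (6, 43), (2, 2),
  (2, 2), (6, 6), (12, 12), (7, 18), (2, 2), (6, 19), (2, 5), (15, 30), (10, 10), (2, 5), (7, 12),
  (15, 43), (11, 11), (2, 2), (3, 12), (2, 2), (25, 82), (2, 24), (15, 15), (33, 34), (20, 21),
  (50, 50), (7, 73), (7, 53), (25, 48), (12, 14), (6, 7), (2, 10), (7, 24), (2, 17), (2, 2),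
  (51, 51), (33, 33), (6, 43), (3, 10), (7, 28), (17, 17), (13, 20), (6, 43), (2, 2), (2, 18),
  (2, 18), (2, 2), (12, 13), (13, 13), (6, 12), (2, 2), (6, 19), (6, 6), (50, 62), (2, 7), (2, 8),
  (22, 22), (9, 9), (2, 7), (5, 5), (22, 34), (2, 8), (5, 5), (13, 13), (18, 18), (12, 12),
  (22, 22), (17, 35), (34, 34), (29, 77), (31, 60), (12, 40), (10, 22), (3, 10), (7, 23), (10, 17),
  (2, 2), (19, 19), (2, 31), (10, 34), (22, 30), (2, 2), (2, 10), (20, 35), (39, 94), (12, 17),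
  (13, 65), (12, 18), (6, 48), (28, 58), (51, 52), (57, 57), (45, 45), (6, 6), (10, 10), (12, 12),
  (6, 28), (10, 31), (2, 2), (30, 44), (7, 7), (2, 6), (6, 12), (43, 43), (15, 38), (38, 38),
  (3, 3), (11, 48), (12, 12), (6, 21), (6, 15), (3, 15), (28, 33), (12, 30), (15, 26), (20, 29),
  (45, 54), (12, 49), (10, 40), (5, 11), (2, 2), (11, 11), (7, 7), (3, 3), (2, 24), (2, 24),
  (21, 21), (13, 28), (2, 21), (10, 10), (35, 35), (19, 19), (14, 26), (12, 24), (13, 13), (6, 18),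
  (3, 3), (6, 18), (17, 17), (3, 3), (20, 20), (22, 50), (12, 19), (7, 7), (6, 6), (24, 31),
  (2, 14), (18, 28), (2, 53), (10, 26), (58, 58), (42, 63), (29, 29), (12, 19), (5, 17), (6, 6),
  (2, 2), (37, 78), (5, 19), (6, 13), (39, 54), (6, 7), (3, 3), (10, 10), (3, 24), (2, 2), (33, 33),
  (7, 7), (20, 21), (3, 3), (5, 10), (18, 18), (5, 11), (2, 2), (2, 5), (12, 12), (2, 20), (17, 54),
  (18, 63), (12, 60), (2, 2), (7, 24), (18, 18), (44, 76), (31, 40), (18, 18), (3, 12), (7, 7),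
  (3, 26), (58, 58), (2, 2), (7, 7), (2, 2), (18, 73), (13, 34), (15, 15), (20, 26), (14, 65),
  (28, 43), (15, 15), (40, 40), (45, 67), (2, 2), (10, 10), (6, 7), (21, 21), (10, 37), (71, 131),
  (11, 48), (7, 20), (20, 20), (31, 31), (17, 42), (12, 13), (24, 31), (74, 93), (5, 15), (20, 21),
  (2, 20), (14, 29), (40, 40), (11, 14), (79, 113), (12, 84), (2, 2), (20, 31), (6, 6), (6, 15),
  (24, 30), (26, 26), (20, 33), (34, 34), (15, 20), (5, 51), (7, 22), (6, 19), (6, 6), (3, 18),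
  (2, 2), (43, 73), (6, 39), (2, 39), (2, 2), (5, 20), (46, 68), (6, 17), (15, 15), (39, 65),
  (3, 3), (10, 10), (3, 24), (12, 38), (6, 18), (26, 29), (10, 10), (6, 60), (61, 61), (13, 26),
  (6, 13), (3, 13), (2, 10), (74, 74), (3, 49), (12, 20), (24, 24), (17, 17), (31, 44), (50, 50),
  (34, 49), (10, 13), (2, 12), (18, 70), (2, 2), (18, 31), (3, 10), (2, 17), (59, 89), (3, 3),
  (12, 13), (18, 24), (2, 5), (3, 3), (10, 10), (21, 31), (49, 49), (11, 61), (37, 55), (18, 24),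
  (2, 28), (2, 11), (20, 20), (15, 23), (7, 42), (12, 19), (46, 46), (30, 31), (11, 12), (5, 15),
  (3, 12), (13, 38), (6, 6), (25, 83), (2, 2), (2, 22), (14, 21), (7, 12), (75, 76), (2, 2), (5, 7),
  (32, 32), (13, 13), (26, 54), (7, 25), (19, 19), (11, 11), (2, 2), (19, 19), (3, 12), (5, 31),
  (7, 14), (3, 12), (21, 21), (2, 11), (7, 7), (24, 25), (24, 25), (43, 43), (19, 19), (2, 2),
  (3, 3), (2, 17), (7, 14), (2, 2), (10, 11), (7, 22), (14, 21), (2, 24), (3, 13), (22, 25),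
  (38, 38), (14, 43), (14, 21), (6, 13), (2, 2), (12, 39), (2, 2), (70, 98), (2, 2), (6, 7),
  (6, 13), (6, 19), (15, 15), (2, 2), (3, 12), (10, 10), (6, 12), (2, 18), (18, 18), (23, 25),
  (2, 2), (12, 17), (2, 2), (30, 30), (6, 6), (2, 24), (6, 6), (14, 26), (12, 18), (7, 12),
  (12, 12), (2, 39), (7, 37), (25, 25), (7, 20), (10, 40), (2, 20), (2, 7), (18, 18), (5, 5),
  (8, 10), (9, 10), (7, 22), (14, 43), (5, 5), (9, 36), (2, 7), (11, 11), (5, 5), (2, 8), (5, 5),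
  (8, 10), (5, 5), (31, 31), (18, 19), (9, 11), (2, 8), (15, 15), (9, 9), (18, 18), (2, 7), (2, 8),
  (18, 18), (5, 5), (5, 5), (9, 9), (2, 7), (7, 7), (4, 4), (20, 29), (23, 23), (4, 13), (20, 36),
  (4, 4), (12, 12), (12, 73), (11, 45), (49, 49), (20, 75), (3, 3), (4, 4), (4, 25), (12, 12),
  (7, 17), (33, 46), (28, 36), (5, 5), (4, 13), (5, 5), (3, 35), (26, 28), (11, 36), (11, 45),
  (4, 55), (12, 49), (7, 19), (20, 26), (4, 4), (12, 20), (34, 45), (20, 20), (4, 4), (38, 38),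
  (23, 33), (13, 63), (11, 21), (10, 25), (7, 7), (11, 11), (4, 31), (19, 19), (37, 37), (3, 19),
  (4, 4), (4, 11), (5, 45), (3, 3), (3, 33), (12, 28), (3, 7), (31, 31), (52, 52), (4, 12), (7, 7),
  (17, 36), (12, 12), (21, 21), (5, 5), (3, 15), (28, 28), (44, 44), (4, 4), (28, 33), (36, 36),
  (29, 115), (28, 28), (3, 3), (4, 75), (68, 76), (5, 5), (28, 28), (67, 118), (22, 36), (4, 12),
  (86, 88), (12, 12), (4, 13), (13, 61), (20, 20), (33, 36), (3, 3), (7, 20), (28, 39), (7, 60),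
  (4, 12), (4, 4), (3, 3), (4, 13), (19, 68), (4, 46), (21, 38), (7, 20), (22, 28), (4, 12), (3, 7),
  (5, 5), (12, 12), (15, 45), (5, 5), (33, 48), (41, 41), (41, 41), (3, 7), (11, 11), (15, 67),
  (15, 56), (11, 21), (42, 80), (13, 13), (3, 36), (12, 33), (4, 13), (4, 13), (17, 33), (5, 5),
  (5, 5), (19, 28), (4, 22), (13, 21), (49, 49), (45, 45), (19, 19), (26, 26), (15, 20), (4, 12),
  (5, 5), (36, 46), (12, 23), (36, 36), (3, 14), (7, 7), (4, 4), (5, 5), (5, 5), (11, 15), (12, 14),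
  (15, 15), (3, 3), (31, 31), (4, 4), (36, 65), (4, 37), (4, 30), (55, 63), (19, 30), (25, 25),
  (12, 12), (12, 30), (12, 33), (5, 5), (4, 4), (5, 5), (3, 15), (3, 7), (23, 26), (3, 17), (5, 5),
  (4, 4), (10, 10), (22, 22), (7, 10), (25, 25), (23, 25), (25, 29), (4, 30), (4, 25), (5, 5),
  (4, 14), (5, 21), (3, 14), (4, 4), (11, 15), (20, 20), (17, 17), (4, 11), (13, 23), (4, 20),
  (4, 4), (5, 12), (4, 40), (26, 26), (3, 21), (17, 33), (4, 13), (7, 10), (36, 36), (22, 22),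
  (4, 7), (4, 13), (3, 14), (4, 31), (10, 25), (11, 25), (3, 10), (4, 19), (11, 11), (3, 3),
  (36, 51), (45, 55), (3, 7), (11, 29), (42, 44), (3, 21), (80, 105), (4, 89), (29, 35), (4, 20),
  (15, 15), (17, 39), (41, 41), (4, 13), (7, 20), (39, 48), (3, 7), (13, 93), (4, 13), (35, 35),
  (12, 14), (44, 44), (17, 26), (5, 5), (34, 34), (4, 4), (15, 44), (94, 94), (20, 36), (3, 3),
  (4, 11), (20, 20), (36, 53), (45, 45), (4, 31), (3, 3), (28, 28), (29, 34), (3, 3), (5, 5),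
  (43, 52), (23, 45), (49, 49), (5, 5), (55, 55), (7, 29), (15, 39), (12, 33), (3, 67), (3, 7),
  (15, 15), (5, 5), (5, 5), (4, 4), (3, 3), (21, 60), (3, 3), (4, 13), (33, 45), (4, 4), (46, 87),
  (11, 21), (36, 36), (4, 13), (17, 36), (4, 13), (4, 36), (33, 35), (20, 20), (84, 93), (5, 5),
  (7, 7), (4, 12), (3, 3), (4, 80), (15, 47), (29, 34), (4, 4), (3, 3), (3, 13), (7, 7), (28, 28),
  (21, 23), (41, 41), (5, 5), (15, 15), (45, 69), (51, 51), (3, 3), (41, 41), (5, 35), (12, 20),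
  (4, 4), (4, 4), (11, 21), (4, 4), (5, 12), (15, 21), (4, 4), (3, 7), (100, 100), (4, 20),
  (11, 45), (19, 19), (4, 13), (4, 4), (3, 3), (59, 59), (4, 17), (4, 4), (5, 5), (20, 34), (3, 3),
  (5, 5), (31, 45), (58, 58), (4, 13), (4, 4), (46, 46), (7, 7), (7, 7), (19, 33), (3, 3), (15, 21),
  (44, 44), (65, 65), (4, 12), (3, 3), (28, 57), (4, 13), (35, 105), (4, 4), (4, 4), (12, 12),
  (17, 35), (15, 46), (51, 51), (5, 11), (55, 80), (15, 35), (4, 4), (7, 7), (19, 19), (7, 7),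
  (4, 4), (36, 36), (5, 45), (13, 13), (5, 5), (36, 60), (12, 12), (20, 20), (21, 58), (3, 7),
  (3, 3), (4, 4), (7, 15), (4, 13), (13, 13), (5, 5), (3, 7), (4, 4), (35, 35), (15, 15), (5, 31),
  (43, 59), (3, 33), (4, 4), (3, 7), (21, 21), (36, 36), (7, 15), (5, 5), (15, 31), (37, 37),
  (3, 3), (77, 80), (4, 77), (26, 26), (11, 61), (11, 11), (5, 12), (5, 5), (4, 12), (36, 46),
  (5, 17), (41, 66), (3, 3), (12, 33), (38, 38), (5, 43), (20, 20), (26, 26), (15, 15), (5, 5),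
  (4, 23), (4, 4), (4, 4), (69, 79), (47, 47), (36, 39), (4, 4), (48, 74), (11, 111), (4, 4),
  (17, 26), (5, 5), (13, 49), (19, 19), (19, 19), (11, 23), (37, 45), (11, 36), (29, 29), (4, 4),
  (17, 29), (48, 56), (20, 20), (68, 89), (21, 21), (44, 83), (4, 23), (4, 11), (5, 5), (53, 69),
  (3, 3), (20, 20), (39, 57), (5, 12), (33, 33), (26, 36), (26, 49), (33, 33), (47, 47), (23, 57),
  (29, 29), (5, 11), (3, 3), (31, 31), (3, 7), (20, 29), (4, 4), (5, 5), (3, 7), (49, 49), (31, 48),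
  (4, 23), (3, 7), (5, 5), (38, 38), (44, 52), (3, 15), (29, 65), (15, 31), (41, 52), (41, 41),
  (17, 49), (15, 17), (20, 20), (11, 11), (66, 66), (4, 13), (23, 23), (4, 4), (12, 14), (3, 3),
  (12, 14), (47, 47), (5, 5), (3, 7), (36, 36), (23, 23), (19, 39), (4, 4), (12, 14), (3, 36),
  (29, 29), (20, 20), (29, 29), (39, 48), (23, 39), (5, 21), (3, 3), (4, 45), (17, 29), (7, 7),
  (15, 15), (20, 20), (5, 5), (4, 4), (23, 23), (12, 12), (5, 5), (3, 3), (11, 15), (12, 14),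
  (3, 3), (20, 20), (20, 20), (20, 20), (46, 74), (7, 19), (4, 4), (5, 5), (41, 41), (4, 4),
  (36, 36), (3, 3), (13, 13), (42, 77), (7, 41), (4, 12), (26, 26), (36, 59), (20, 51), (15, 19),
  (3, 29), (5, 5), (3, 3), (12, 37), (14, 49), (12, 34), (26, 26), (13, 21), (38, 38), (12, 31),
  (4, 20), (12, 12), (38, 38), (36, 47), (4, 57), (47, 55), (3, 3), (7, 20), (4, 45), (13, 13),
  (4, 11), (5, 13), (3, 45), (4, 12), (45, 45), (5, 5), (22, 22), (5, 5), (41, 41), (20, 26),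
  (3, 11), (5, 12), (3, 3), (4, 4), (4, 13), (14, 57), (17, 17), (4, 22), (5, 5), (3, 3), (17, 42),
  (4, 36), (21, 21), (23, 23), (22, 39), (12, 12), (3, 3), (5, 5), (33, 51), (22, 28), (4, 12),
  (4, 63), (23, 23), (42, 70), (3, 21), (5, 5), (37, 47), (31, 36), (5, 12), (44, 78), (3, 14),
  (15, 35), (5, 5), (41, 41), (4, 25), (10, 19), (4, 4), (5, 12), (10, 25), (4, 12), (12, 12),
  (23, 23), (28, 31), (4, 7), (3, 21), (5, 5), (4, 7), (13, 13), (25, 25), (13, 21), (21, 23),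
  (33, 36), (44, 68), (3, 3), (3, 29), (61, 61), (12, 12), (3, 3), (7, 7), (26, 33), (33, 71),
  (11, 11), (25, 25), (25, 25), (7, 22), (4, 13), (25, 51), (4, 4), (3, 10), (21, 21), (4, 4),
  (10, 39), (12, 70), (3, 7), (4, 13), (7, 10), (4, 4), (87, 87), (17, 19), (4, 4), (3, 3),
  (11, 28), (3, 7), (4, 4), (5, 5), (31, 31), (7, 10), (7, 22), (34, 34), (23, 52), (10, 10),
  (21, 21), (4, 13), (35, 47), (12, 23), (25, 25), (12, 12), (25, 25), (36, 38), (11, 71), (4, 23),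
  (3, 7), (21, 21), (3, 68), (4, 4), (4, 4), (37, 48), (4, 4), (3, 7), (4, 25), (3, 36), (28, 48),
  (4, 4), (10, 21), (7, 10), (12, 37), (13, 36), (3, 7), (4, 48), (5, 5), (19, 21), (4, 4),
  (12, 12), (3, 5), (7, 7), (3, 7), (4, 43), (4, 4), (25, 25), (3, 7), (19, 19), (4, 10), (4, 4),
  (12, 28), (19, 21), (10, 10), (4, 40), (3, 14), (14, 35), (4, 43), (3, 7), (44, 48), (12, 26),
  (15, 46), (12, 12), (3, 14), (11, 11), (41, 41), (4, 23), (19, 19), (25, 35), (12, 12), (11, 11),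
  (3, 3), (12, 12), (5, 11), (25, 25), (25, 29), (5, 5), (14, 49), (11, 23), (4, 4), (11, 11),
  (12, 33), (10, 10), (5, 12), (7, 7), (10, 10), (4, 4), (30, 30), (36, 36), (12, 19), (37, 39),
  (4, 22), (13, 36), (4, 13), (3, 7), (17, 33), (4, 19), (4, 38), (25, 25), (17, 17), (4, 4),
  (4, 11), (33, 36), (3, 3), (5, 5), (17, 17), (20, 48), (38, 38), (4, 13), (5, 5), (12, 12),
  (4, 4), (34, 34), (4, 13), (3, 10), (3, 3), (12, 12), (12, 12), (28, 47), (4, 13), (12, 23),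
  (3, 7), (20, 20), (5, 5), (5, 5), (38, 41), (3, 14), (4, 25), (4, 13), (4, 35), (4, 4), (14, 17),
  (30, 30), (4, 4), (22, 35), (3, 3), (4, 4), (4, 14), (5, 12), (5, 5), (3, 7), (4, 13), (4, 13),
  (23, 23), (4, 7), (28, 36), (4, 13), (31, 35), (14, 25), (12, 26), (3, 13), (3, 10), (4, 4),
  (19, 26), (14, 29), (14, 30), (4, 13), (4, 4), (4, 28), (4, 4), (5, 9), (7, 7), (6, 49), (6, 29),
  (7, 20), (7, 7), (13, 13), (4, 4), (9, 29), (4, 4), (6, 11), (6, 11), (6, 28), (6, 31), (6, 19),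
  (7, 17), (6, 20), (7, 17), (4, 13), (23, 30), (19, 19), (5, 26), (9, 45), (4, 52), (9, 9),
  (7, 19), (6, 6), (19, 19), (9, 9), (20, 24), (4, 4), (11, 20), (4, 4), (4, 38), (4, 21), (6, 9),
  (9, 17), (4, 4), (4, 23), (4, 22), (9, 14), (4, 4), (5, 21), (9, 9), (20, 20), (4, 17), (4, 13),
  (4, 4), (4, 4), (7, 10), (7, 7), (5, 9), (9, 9), (4, 4), (10, 10), (4, 4), (4, 4), (9, 17),
  (7, 10), (4, 4), (13, 24), (6, 6), (4, 4), (4, 4), (4, 7), (9, 9), (4, 4), (6, 9), (4, 10),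
  (9, 9), (4, 13), (6, 9), (9, 9), (6, 6), (4, 4), (2, 2), (5, 6), (11, 11), (10, 10), (11, 21),
  (5, 20), (22, 23), (4, 4), (17, 19), (6, 17), (11, 13), (2, 2), (7, 7), (5, 10), (5, 6), (39, 49),
  (2, 2), (4, 4), (5, 10), (2, 2), (9, 9), (5, 6), (13, 17), (26, 26), (4, 4), (2, 2), (29, 34),
  (2, 2), (4, 16), (6, 6), (23, 47), (2, 5), (6, 9), (9, 9), (9, 9), (6, 7), (2, 2), (4, 7),
  (9, 10), (2, 2), (9, 15), (37, 38), (4, 4), (2, 4), (4, 4), (4, 4), (16, 17), (4, 9), (2, 2),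
  (11, 13), (2, 4), (4, 9), (3, 4), (4, 4), (9, 9), (3, 4)]

/-- For the relevant proper prime powers `q`, the degree `d` over the prime field, an `f` for which
`X ^ d - f` defines the extension, and two elements `a`, `b` of order `(q - 1) / 2` such that
`1 - a - b` has the same order. -/
def extCerts : List (ℕ × List ℕ × List ℕ × List ℕ) := [
  (2, [7], [3, 1], [4, 1]), (2, [3], [3, 2], [6, 3]), (2, [3], [1, 1], [4, 4]),
  (4, [3, 1], [0, 1, 0, 0], [0, 0, 0, 2]), (2, [7], [8, 5], [8, 6]), (2, [7], [4, 1], [4, 3]),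
  (2, [3], [3, 2], [3, 5]), (2, [3], [1, 2], [4, 1]), (2, [5], [1, 3], [2, 3]),
  (2, [3], [1, 3], [3, 2]), (2, [3], [4, 2], [5, 2]), (2, [7], [4, 1], [4, 3]),
  (2, [3], [3, 3], [3, 6]), (2, [5], [1, 2], [1, 2]), (2, [3], [5, 1], [5, 1]),
  (2, [3], [4, 7], [6, 8]), (4, [2], [0, 1, 2, 0], [1, 1, 0, 2]), (2, [3], [3, 3], [3, 5]),
  (2, [3], [4, 1], [5, 1]), (2, [11], [5, 1], [6, 1]), (2, [7], [3, 1], [3, 1]),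
  (4, [6, 1], [1, 0, 1, 1], [1, 0, 1, 1]), (2, [5], [3, 1], [6, 2]), (2, [5], [1, 4], [1, 4]),
  (4, [2], [1, 1, 0, 0], [1, 1, 0, 0]), (2, [3], [2, 4], [3, 6]), (2, [3], [1, 1], [1, 1]),
  (4, [1, 1], [0, 0, 1, 0], [0, 0, 1, 1]), (2, [2], [1, 3], [1, 3]), (2, [2], [1, 2], [1, 5]),
  (2, [2], [3, 1], [3, 1]), (2, [2], [5, 2], [6, 4]), (2, [2], [3, 3], [6, 4]),
  (2, [2], [3, 4], [3, 4]), (2, [2], [3, 1], [8, 1]), (2, [2], [1, 4], [5, 3]),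
  (6, [3, 1], [0, 0, 0, 0, 1, 1], [0, 1, 0, 1, 0, 0]), (2, [2], [3, 3], [5, 4]),
  (2, [2], [1, 3], [5, 4]), (2, [2], [2, 6], [2, 6]), (2, [2], [1, 4], [5, 1]),
  (2, [2], [1, 3], [1, 5]), (2, [2], [1, 5], [2, 7]), (2, [2], [1, 2], [5, 6]),
  (2, [2], [3, 3], [5, 1]), (2, [2], [1, 3], [2, 5]), (2, [2], [6, 6], [9, 9]),
  (2, [2], [5, 2], [5, 4]), (2, [2], [5, 2], [5, 6]), (2, [2], [5, 3], [5, 3]),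
  (2, [2], [3, 5], [3, 5]), (2, [2], [2, 4], [2, 4]), (2, [2], [5, 3], [5, 3]),
  (2, [2], [7, 10], [7, 10]), (2, [2], [6, 4], [1, 7]), (2, [2], [3, 5], [8, 3]),
  (2, [2], [1, 3], [5, 4]), (2, [2], [2, 3], [8, 1]), (2, [2], [6, 5], [7, 6]),
  (2, [2], [5, 5], [4, 6]), (2, [2], [3, 3], [5, 1]), (2, [2], [2, 5], [2, 5]),
  (2, [2], [5, 3], [5, 3]), (2, [2], [2, 5], [3, 5]), (2, [2], [4, 4], [2, 6]),
  (2, [2], [1, 3], [1, 3]), (6, [1, 1], [0, 0, 0, 0, 1, 1], [0, 0, 0, 0, 1, 1]),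
  (3, [2], [2, 2, 1], [2, 3, 0]), (3, [2, 1], [0, 0, 1], [0, 0, 1])]

/-- A numerical condition on `m`, `φ = φ(m)` and `k = 2 ^ ω(m)` under which the character sum
estimate applies. -/
def good (m φ k : ℕ) : Bool :=
  Nat.blt (2 * m + 1) (2 * φ * m + φ) &&
    Nat.blt ((2 * k - 1) ^ 2 * ((2 * m + 1) * (2 * m + 1 - φ) ^ 2))
      ((2 * φ * m + φ - (2 * m + 1)) ^ 2)

/-- A divisor of `q` among the entries of an increasing list up to the square root of `q`, or `0`
if there is none. -/
def smallFactor (q : ℕ) : List ℕ → ℕ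
  | [] => 0
  | p :: ps => bif Nat.blt q (p * p) then 0 else bif q % p == 0 then p else smallFactor q ps

/-- The certificates that remain to be used. -/
abbrev Certs := List (ℕ × ℕ) × List (ℕ × List ℕ × List ℕ × List ℕ)

/-- Tests a certificate for a prime `q`. -/
def primeCertTest (q m : ℕ) (ps : List ℕ) (a b : ℕ) : Bool :=
  Nat.ble (a + b) (q + 1) && orderTest q m ps a && orderTest q m ps b &&
    orderTest q m ps ((q + 1 - a - b) % q)

/-- Tests a certificate for a power `q` of `p`. -/
def extCertTest (q m p : ℕ) (ps : List ℕ) (d : ℕ) (f a b : List ℕ) : Bool :=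
  Nat.blt 0 d && Nat.ble f.length d && splitTest q p d f && polyOrderTest q p d f m ps a &&
    polyOrderTest q p d f m ps b &&
      forceList (polyAdd p [1] (polyMul p [p - 1] (polyAdd p a b))) fun c ↦
        polyOrderTest q p d f m ps c

/-- Deals with a single `m`, where `ps` lists the prime factors of `m`, `φ = φ(m)` and
`k = 2 ^ ω(m)`; consumes a certificate if necessary. -/
def step (m φ k : ℕ) (ps : List ℕ) (s : Certs) : Option Certs :=
  bif good m φ k then some s else
  forceNat (2 * m + 1) fun q ↦
  bif [3, 5, 9, 13, 25].any (· == q) then some s else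
  forceNat (smallFactor q smallPrimes) fun r ↦
  bif r == 0 then
    match s with
    | ((a, b) :: t, u) => bif primeCertTest q m ps a b then some (t, u) else none
    | _ => none
  else bif Nat.blt 1 r && q % r == 0 && Nat.blt q (2 ^ 25) then
    bif r ^ 25 % q == 0 then
      match s with
      | (t, (d, f, a, b) :: u) => bif extCertTest q m r ps d f a b then some (t, u) else none
      | _ => none
    else some s
  else none

/-- A numerical condition on `m`, `φ = φ(m)` and `k = 2 ^ ω(m)` under which `good` holds for all
proper multiples of `m` obtained by multiplying with primes that are at least `p`. -/
def prune (m φ k p : ℕ) : Bool :=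
  bif Nat.blt p 7 then Nat.ble (270 * m * k * k) (φ * φ)
  else Nat.ble (36 * m * k * k * p) (φ * φ * (p - 1) ^ 2)

/-- Deals with all proper multiples of `m` obtained by multiplying with primes in the given list or
larger ones. -/
def search : ℕ → List ℕ → ℕ → ℕ → ℕ → List ℕ → Certs → Option Certs
  | 0, _, _, _, _, _, _ => none
  | _ + 1, [], _, _, _, _, _ => none
  | n + 1, p :: L, m, φ, k, ps, s =>
    bif prune m φ k p then some s else
    bif m % p == 0 then
      forceNat (m * p) fun m' ↦ forceNat (φ * p) fun φ' ↦
        ((step m' φ' k ps s).bind (search n (p :: L) m' φ' k ps)).bind (search n L m φ k ps)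
    else
      forceNat (m * p) fun m' ↦ forceNat (φ * (p - 1)) fun φ' ↦ forceNat (2 * k) fun k' ↦
        ((step m' φ' k' (p :: ps) s).bind (search n (p :: L) m' φ' k' (p :: ps))).bind
          (search n L m φ k ps)

section Search

variable {F : Type*} [Field F] [Fintype F]

theorem smallPrimes_eq_filter : smallPrimes = (List.range 1952).filter fun n ↦
    Nat.ble 2 n && (List.range' 2 43).all fun d ↦ n % d != 0 || n == d := by
  decide +kernel

theorem mem_smallPrimes {n : ℕ} : n ∈ smallPrimes ↔ n < 1952 ∧ n.Prime := by
  rw [smallPrimes_eq_filter, List.mem_filter, List.mem_range, and_congr_right_iff]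
  intro hn
  simp only [Bool.and_eq_true, Nat.ble_eq, List.all_eq_true, List.mem_range'_1, Bool.or_eq_true,
    bne_iff_ne, beq_iff_eq]
  refine ⟨fun ⟨h2, h⟩ ↦ ?_, fun h ↦ ⟨h.two_le, fun d hd ↦ ?_⟩⟩
  · by_contra hp
    have h1 := Nat.minFac_sq_le_self (by omega) hp
    have h3 := (Nat.minFac_prime (n := n) (by omega)).two_le
    rcases h n.minFac ⟨h3, by nlinarith⟩ with h4 | h4
    · exact h4 (Nat.mod_eq_zero_of_dvd n.minFac_dvd)
    · exact hp (h4 ▸ Nat.minFac_prime (by omega))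
  · by_contra! h'
    rcases (Nat.dvd_prime h).1 (Nat.dvd_of_mod_eq_zero h'.1) with h1 | h1
    · omega
    · exact h'.2 h1.symm

theorem smallPrimes_sorted : smallPrimes.Pairwise (· < ·) := by
  rw [smallPrimes_eq_filter]
  exact List.pairwise_lt_range.filter _

/-- The size of `φ(m) ^ 2 / (m * 4 ^ ω(m))` governs the strength of the character sum estimate. -/
def ratio (m : ℕ) : ℚ := m.totient ^ 2 / (m * 4 ^ #m.primeFactors)

theorem ratio_nonneg (m : ℕ) : 0 ≤ ratio m := by
  unfold ratio
  positivity

theorem card_primeFactors_mul_prime {m p : ℕ} (h0 : 0 < m) (hp : p.Prime) :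
    #(m * p).primeFactors = if p ∣ m then #m.primeFactors else #m.primeFactors + 1 := by
  rw [Nat.primeFactors_mul h0.ne' hp.ne_zero, hp.primeFactors, union_comm]
  change #(insert p m.primeFactors) = _
  split_ifs with h
  · rw [insert_eq_of_mem (Nat.mem_primeFactors.2 ⟨hp, h, h0.ne'⟩)]
  · rw [card_insert_of_notMem fun h' ↦ h (Nat.dvd_of_mem_primeFactors h')]

theorem totient_mul_prime {m p : ℕ} (hp : p.Prime) :
    (m * p).totient = if p ∣ m then m.totient * p else m.totient * (p - 1) := by
  split_ifs with h
  · rw [mul_comm, Nat.totient_mul_of_prime_of_dvd hp h, mul_comm]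
  · rw [mul_comm, Nat.totient_mul_of_prime_of_not_dvd hp h, mul_comm]

theorem ratio_mul_prime {m p : ℕ} (h0 : 0 < m) (hp : p.Prime) :
    ratio (m * p) = if p ∣ m then p * ratio m else ((p : ℚ) - 1) ^ 2 / (4 * p) * ratio m := by
  have hp0 : (p : ℚ) ≠ 0 := by exact_mod_cast hp.ne_zero
  have hm0 : (m : ℚ) ≠ 0 := by exact_mod_cast h0.ne'
  rw [ratio, ratio, card_primeFactors_mul_prime h0 hp, totient_mul_prime hp]
  split_ifs with h
  · push_cast
    field_simp
  · rw [Nat.cast_mul, Nat.cast_mul, Nat.cast_sub hp.one_le, pow_succ]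
    push_cast
    field_simp
    ring

theorem ratio_mul_prime_ge {m l : ℕ} (h0 : 0 < m) (hl : l.Prime) {p : ℕ} (hp : 7 ≤ p)
    (hpl : p ≤ l) : ((p : ℚ) - 1) ^ 2 / (4 * p) * ratio m ≤ ratio (m * l) := by
  rw [ratio_mul_prime h0 hl]
  have hp' : (7 : ℚ) ≤ p := by exact_mod_cast hp
  have hpl' : (p : ℚ) ≤ l := by exact_mod_cast hpl
  split_ifs
  · refine mul_le_mul_of_nonneg_right ?_ (ratio_nonneg m)
    rw [div_le_iff₀ (by positivity)]
    nlinarith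
  · refine mul_le_mul_of_nonneg_right ?_ (ratio_nonneg m)
    rw [div_le_div_iff₀ (by positivity) (by linarith)]
    nlinarith [mul_nonneg (sub_nonneg.2 hpl') (by nlinarith : (0 : ℚ) ≤ (p : ℚ) * l - 1)]

theorem ratio_le_mul {m n : ℕ} (h0 : 0 < m) (hn : 0 < n)
    (h : ∀ l : ℕ, l.Prime → l ∣ n → 7 ≤ l) : ratio m ≤ ratio (m * n) := by
  induction n using induction_on_primes with
  | zero => omega
  | one => simp
  | prime_mul l n hl ih =>
    have hn' := Nat.pos_of_mul_pos_left hn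
    have h1 := ih hn' fun l' h1 h2 ↦ h l' h1 (h2.mul_left l)
    have h2 := ratio_mul_prime_ge (Nat.mul_pos h0 hn') hl le_rfl (h l hl (dvd_mul_right l n))
    rw [mul_assoc, mul_comm n] at h2
    norm_num at h2
    linarith [ratio_nonneg (m * n)]

theorem ratio_mul_ge {m n p : ℕ} (h0 : 0 < m) (hn : 1 < n) (hp : 7 ≤ p)
    (h : ∀ l : ℕ, l.Prime → l ∣ n → p ≤ l) :
    ((p : ℚ) - 1) ^ 2 / (4 * p) * ratio m ≤ ratio (m * n) := by
  have hl := Nat.minFac_prime hn.ne'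
  obtain ⟨k, hk⟩ := n.minFac_dvd
  refine (ratio_mul_prime_ge h0 hl hp (h _ hl n.minFac_dvd)).trans ?_
  rw [hk, ← mul_assoc, ← hk]
  refine ratio_le_mul (Nat.mul_pos h0 hl.pos) (Nat.pos_of_ne_zero ?_) fun l hl' hlk ↦ ?_
  · rintro rfl
    omega
  · exact hp.trans (h l hl' (hk ▸ hlk.mul_left _))

/-- A correction for the small prime factors of `m`, which may decrease `ratio`. -/
def smallWeight (m : ℕ) : ℚ :=
  (if 2 ∣ m then 1 / 8 else 1) * (if 3 ∣ m then 1 / 3 else 1) * (if 5 ∣ m then 4 / 5 else 1)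

theorem smallWeight_mul_prime_ge {m l : ℕ} (h0 : 0 < m) (hl : l.Prime) :
    ratio m * smallWeight (m * l) ≤ ratio (m * l) * smallWeight m := by
  have hr := ratio_nonneg m
  have hw (n : ℕ) : 0 ≤ smallWeight n := by
    unfold smallWeight
    positivity
  have hdvd (d : ℕ) (hd : d.Prime) (hne : l ≠ d) : d ∣ m * l ↔ d ∣ m := by
    rw [hd.dvd_mul, or_iff_left]
    exact fun h ↦ hne ((Nat.prime_dvd_prime_iff_eq hd hl).1 h).symm
  by_cases hm : l ∣ m
  · have h1 : smallWeight (m * l) = smallWeight m := by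
      have (d : ℕ) (hd : d.Prime) : d ∣ m * l ↔ d ∣ m := by
        rw [hd.dvd_mul, or_iff_left_of_imp]
        exact fun h ↦ h.trans hm
      simp only [smallWeight, this 2 Nat.prime_two, this 3 Nat.prime_three, this 5 Nat.prime_five]
    rw [h1, ratio_mul_prime h0 hl, if_pos hm]
    refine mul_le_mul_of_nonneg_right ?_ (hw m)
    have : (1 : ℚ) ≤ l := by exact_mod_cast hl.one_le
    nlinarith
  · rcases lt_or_ge l 7 with h7 | h7
    · have : l = 2 ∨ l = 3 ∨ l = 5 := by
        have := hl.two_le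
        interval_cases l <;> revert hl <;> norm_num
      rw [ratio_mul_prime h0 hl, if_neg hm]
      rcases this with rfl | rfl | rfl
      · simp only [smallWeight, hdvd 3 Nat.prime_three (by norm_num),
          hdvd 5 Nat.prime_five (by norm_num), dvd_mul_left, if_pos, if_neg hm]
        apply le_of_eq
        push_cast
        ring
      · simp only [smallWeight, hdvd 2 Nat.prime_two (by norm_num),
          hdvd 5 Nat.prime_five (by norm_num), dvd_mul_left, if_pos, if_neg hm]
        apply le_of_eq
        push_cast
        ring
      · simp only [smallWeight, hdvd 2 Nat.prime_two (by norm_num),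
          hdvd 3 Nat.prime_three (by norm_num), dvd_mul_left, if_pos, if_neg hm]
        apply le_of_eq
        push_cast
        ring
    · have h1 : smallWeight (m * l) = smallWeight m := by
        simp only [smallWeight, hdvd 2 Nat.prime_two (by omega), hdvd 3 Nat.prime_three (by omega),
          hdvd 5 Nat.prime_five (by omega)]
      rw [h1]
      exact mul_le_mul_of_nonneg_right (ratio_le_mul h0 hl.pos fun l' h1 h2 ↦
        ((Nat.prime_dvd_prime_iff_eq h1 hl).1 h2).symm ▸ h7) (hw m)

theorem ratio_le_thirty_mul {m n : ℕ} (h0 : 0 < m) (hn : 0 < n) :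
    ratio m ≤ 30 * ratio (m * n) := by
  have hpos (k : ℕ) : 0 < smallWeight k := by
    unfold smallWeight
    positivity
  have key : ratio m * smallWeight (m * n) ≤ ratio (m * n) * smallWeight m := by
    induction n using induction_on_primes with
    | zero => omega
    | one => simp
    | prime_mul l n hl ih =>
      have hn' := Nat.pos_of_mul_pos_left hn
      have h1 := smallWeight_mul_prime_ge (Nat.mul_pos h0 hn') hl
      rw [mul_assoc, mul_comm n] at h1
      refine le_of_mul_le_mul_right ?_ (hpos (m * n))
      calc ratio m * smallWeight (m * (l * n)) * smallWeight (m * n)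
          = ratio m * smallWeight (m * n) * smallWeight (m * (l * n)) := by ring
        _ ≤ ratio (m * n) * smallWeight m * smallWeight (m * (l * n)) :=
          mul_le_mul_of_nonneg_right (ih hn') (hpos _).le
        _ = ratio (m * n) * smallWeight (m * (l * n)) * smallWeight m := by ring
        _ ≤ ratio (m * (l * n)) * smallWeight (m * n) * smallWeight m :=
          mul_le_mul_of_nonneg_right h1 (hpos _).le
        _ = ratio (m * (l * n)) * smallWeight m * smallWeight (m * n) := by ring
  have h1 : smallWeight m ≤ 1 := by
    unfold smallWeight
    split_ifs <;> norm_num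
  have h2 : 1 / 30 ≤ smallWeight (m * n) := by
    unfold smallWeight
    split_ifs <;> norm_num
  nlinarith [ratio_nonneg m, ratio_nonneg (m * n)]

/-- The statement to be proved for `F`, under the assumption that `F` has `2 * h + 1` elements. -/
def Solvable (F : Type*) [Field F] [Fintype F] (h : ℕ) : Prop :=
  2 * h + 1 ∈ [3, 5, 9, 13, 25] ∨ (Fintype.card F = 2 * h + 1 →
    ∃ a b c : F, orderOf a = h ∧ orderOf b = h ∧ orderOf c = h ∧ a + b + c = 1)

theorem solvable_of_good {m : ℕ} (h0 : 0 < m)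
    (hg : good m m.totient (2 ^ #m.primeFactors) = true) : Solvable F m := by
  simp only [good, Bool.and_eq_true, Nat.blt_eq] at hg
  exact Or.inr fun hF ↦ exists_orderOf_eq_add_add_eq_one hF h0 hg.1 hg.2

theorem good_of_le {m φ k : ℕ} (hk : 0 < k) (hφm : φ ≤ m) (hm : 0 < m)
    (h : 9 * m * k ^ 2 ≤ φ ^ 2) : good m φ k = true := by
  have hφ : 9 * k ^ 2 ≤ φ := by
    refine Nat.le_of_mul_le_mul_left (?_ : m * _ ≤ m * _) hm
    nlinarith
  have hk2 : 1 ≤ k ^ 2 := Nat.one_le_pow _ _ hk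
  simp only [good, Bool.and_eq_true, Nat.blt_eq]
  have h1 : 2 * m + 1 < 2 * φ * m + φ := by nlinarith
  refine ⟨h1, ?_⟩
  zify [h1.le, (by omega : φ ≤ 2 * m + 1), (by omega : 1 ≤ 2 * k)]
  zify at hk hφm hm h hφ hk2
  generalize (m : ℤ) = m at *
  generalize (φ : ℤ) = f at *
  generalize (k : ℤ) = k at *
  suffices (2 * k - 1) ^ 2 * (2 * m + 1 - f) ^ 2 < (2 * m + 1) * (f - 1) ^ 2 by
    have : (2 * f * m + f - (2 * m + 1)) ^ 2 = (2 * m + 1) * ((2 * m + 1) * (f - 1) ^ 2) := by ring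
    rw [this]
    nlinarith
  have h3 : (2 * m + 1 - f) ^ 2 ≤ (2 * m) ^ 2 := by
    apply pow_le_pow_left₀ <;> nlinarith
  rcases (by omega : k = 1 ∨ 2 ≤ k) with rfl | hk'
  · nlinarith
  · have hf36 : 36 ≤ f := by nlinarith
    have h4 : (2 * k - 1) ^ 2 * (2 * m + 1 - f) ^ 2 ≤ (2 * k) ^ 2 * (2 * m) ^ 2 := by
      refine mul_le_mul ?_ h3 (sq_nonneg _) (sq_nonneg _)
      apply pow_le_pow_left₀ <;> linarith
    have h5 : 17 * f ^ 2 ≤ 18 * (f - 1) ^ 2 := by nlinarith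
    have h6 : 17 * (9 * m * k ^ 2) ≤ 18 * (f - 1) ^ 2 := by linarith
    have h7 : 0 < m ^ 2 * k ^ 2 := by positivity
    nlinarith [mul_le_mul_of_nonneg_left h6 hm.le, sq_nonneg (f - 1)]

theorem solvable_of_ratio {m : ℕ} (h0 : 0 < m) (h : 9 ≤ ratio m) : Solvable F m := by
  refine solvable_of_good h0 (good_of_le (by positivity) (Nat.totient_le m) h0 ?_)
  rw [ratio, le_div_iff₀ (by positivity)] at h
  rw [← pow_mul, mul_comm _ 2, pow_mul, mul_assoc]
  exact_mod_cast h

theorem solvable_of_prune {m n p : ℕ} (h0 : 0 < m) (hn : 1 < n)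
    (h : ∀ l : ℕ, l.Prime → l ∣ n → p ≤ l)
    (hp : prune m m.totient (2 ^ #m.primeFactors) p = true) : Solvable F (m * n) := by
  refine solvable_of_ratio (Nat.mul_pos h0 (by omega)) ?_
  have hk : ((2 : ℚ) ^ #m.primeFactors) * 2 ^ #m.primeFactors = 4 ^ #m.primeFactors := by
    rw [← mul_pow]
    norm_num
  have hpos : 0 < (m : ℚ) * 4 ^ #m.primeFactors := by positivity
  have hr : ratio m * (m * 4 ^ #m.primeFactors) = m.totient ^ 2 :=
    div_mul_cancel₀ _ hpos.ne'
  unfold prune at hp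
  rcases lt_or_ge p 7 with h7 | h7
  · rw [Eq.mpr Nat.blt_eq h7, cond_true, Nat.ble_eq] at hp
    have hp' : 270 * (m * 4 ^ #m.primeFactors) ≤ (m.totient : ℚ) ^ 2 := by
      rw [← hk, sq]
      refine le_of_eq_of_le ?_ (Nat.cast_le (α := ℚ).2 hp |>.trans_eq (by push_cast; rfl))
      push_cast
      ring
    rw [← hr] at hp'
    linarith [le_of_mul_le_mul_right hp' hpos, ratio_le_thirty_mul h0 (n := n) (by omega)]
  · have : Nat.blt p 7 = false := by
      rw [← Bool.not_eq_true, Nat.blt_eq]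
      omega
    rw [this, cond_false, Nat.ble_eq] at hp
    have hp' : 36 * p * (m * 4 ^ #m.primeFactors) ≤ (m.totient : ℚ) ^ 2 * ((p : ℚ) - 1) ^ 2 := by
      have := Nat.cast_le (α := ℚ).2 hp
      rw [Nat.cast_mul _ ((p - 1) ^ 2), Nat.cast_pow (p - 1), Nat.cast_sub (by omega)] at this
      push_cast at this
      rw [← hk]
      nlinarith
    refine le_trans ?_ (ratio_mul_ge h0 hn h7 h)
    rw [← hr] at hp'
    have h1 : 36 * (p : ℚ) ≤ ratio m * ((p : ℚ) - 1) ^ 2 := by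
      refine le_of_mul_le_mul_right ?_ hpos
      linarith
    have hp0 : 0 < (p : ℚ) := by
      exact_mod_cast (by omega : 0 < p)
    rw [div_mul_eq_mul_div, le_div_iff₀ (by positivity)]
    linarith

theorem exists_of_primeCertTest {q m a b : ℕ} {ps : List ℕ} (hF : Fintype.card F = q) (h0 : 0 < m)
    (hps : ∀ l : ℕ, l.Prime → l ∣ m → l ∈ ps) (h : primeCertTest q m ps a b = true) :
    ∃ a b c : F, orderOf a = m ∧ orderOf b = m ∧ orderOf c = m ∧ a + b + c = 1 := by
  have hq : (q : F) = 0 := hF ▸ FiniteField.cast_card_eq_zero F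
  have hq0 : 0 < q := hF ▸ Fintype.card_pos
  simp only [primeCertTest, Bool.and_eq_true, Nat.ble_eq] at h
  obtain ⟨⟨⟨hab, ha⟩, hb⟩, hc⟩ := h
  refine ⟨_, _, _, orderOf_eq_of_orderTest hq hq0 h0 hps ha,
    orderOf_eq_of_orderTest hq hq0 h0 hps hb, orderOf_eq_of_orderTest hq hq0 h0 hps hc, ?_⟩
  rw [natCast_mod_eq hq, ← Nat.cast_add, ← Nat.cast_add, Nat.sub_sub, Nat.add_sub_cancel' hab,
    Nat.cast_add, hq, zero_add, Nat.cast_one]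

theorem exists_of_extCertTest {q m p d : ℕ} {ps f a b : List ℕ} (hF : Fintype.card F = q)
    (h0 : 0 < m) (hps : ∀ l : ℕ, l.Prime → l ∣ m → l ∈ ps) (hp : (p : F) = 0) (hp0 : 0 < p)
    (h : extCertTest q m p ps d f a b = true) :
    ∃ a b c : F, orderOf a = m ∧ orderOf b = m ∧ orderOf c = m ∧ a + b + c = 1 := by
  simp only [extCertTest, forceList_eq, Bool.and_eq_true, Nat.ble_eq, Nat.blt_eq] at h
  obtain ⟨⟨⟨⟨⟨hd, hfd⟩, hs⟩, ha⟩, hb⟩, hc⟩ := h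
  have hq1 : 1 < q := hF ▸ Fintype.one_lt_card
  obtain ⟨x, hx⟩ := exists_root_of_splitTest (F := F) hp hp0 hd hfd (hF.symm ▸ hs)
  refine ⟨_, _, _, orderOf_eq_of_polyOrderTest hp hp0 hx h0 hq1 hps ha,
    orderOf_eq_of_polyOrderTest hp hp0 hx h0 hq1 hps hb,
    orderOf_eq_of_polyOrderTest hp hp0 hx h0 hq1 hps hc, ?_⟩
  rw [polyEval_add hp, polyEval_mul hp, polyEval_add hp]
  simp only [polyEval, Nat.cast_sub hp0, hp]
  push_cast
  ring

/-- A number `r` with `1 < r` that divides the order `q < 2 ^ n` of a finite field satisfies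
`q ∣ r ^ n`. -/
theorem card_dvd_pow {q r n : ℕ} (hF : Fintype.card F = q) (hr : 1 < r) (hrq : r ∣ q)
    (hq : q < 2 ^ n) : q ∣ r ^ n := by
  obtain ⟨p, -, k, hp, hk⟩ := FiniteField.card' F
  rw [hF] at hk
  have hpr : p ∣ r := by
    obtain ⟨j, -, hj⟩ := (Nat.dvd_prime_pow hp).1 (hk ▸ hrq)
    rw [hj]
    refine dvd_pow_self p ?_
    rintro rfl
    simp [hj] at hr
  have hkn : (k : ℕ) ≤ n := by
    refine ((Nat.pow_lt_pow_iff_right (a := 2) (by norm_num)).1 ?_).le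
    exact (Nat.pow_le_pow_left hp.two_le _).trans_lt (hk ▸ hq)
  rw [hk]
  exact (pow_dvd_pow p hkn).trans (pow_dvd_pow_of_dvd hpr n)

theorem solvable_of_step {m φ k : ℕ} {ps : List ℕ} {s s' : Certs} (h0 : 0 < m)
    (hφ : φ = m.totient) (hk : k = 2 ^ #m.primeFactors)
    (hps : ∀ l : ℕ, l.Prime → l ∣ m → l ∈ ps) (h : step m φ k ps s = some s') :
    Solvable F m := by
  subst hφ hk
  unfold step at h
  cases hg : good m m.totient (2 ^ #m.primeFactors) with
  | true => exact solvable_of_good h0 hg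
  | false =>
  rw [hg, cond_false, forceNat_eq] at h
  cases he : [3, 5, 9, 13, 25].any (· == 2 * m + 1) with
  | true =>
    obtain ⟨y, hy, h1⟩ := List.any_eq_true.1 he
    exact Or.inl (beq_iff_eq.1 h1 ▸ hy)
  | false =>
  refine Or.inr fun hF ↦ ?_
  rw [he, cond_false, forceNat_eq] at h
  generalize smallFactor (2 * m + 1) smallPrimes = r at h
  cases hr : r == 0 with
  | true =>
    rw [hr, cond_true] at h
    rcases s with ⟨_ | ⟨⟨a, b⟩, t⟩, u⟩
    · simp at h
    · cases hc : primeCertTest (2 * m + 1) m ps a b with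
      | true => exact exists_of_primeCertTest hF h0 hps hc
      | false => simp [hc] at h
  | false =>
  rw [hr, cond_false] at h
  cases hb : Nat.blt 1 r && (2 * m + 1) % r == 0 && Nat.blt (2 * m + 1) (2 ^ 25) with
  | false =>
    rw [hb, cond_false] at h
    exact absurd h (by simp)
  | true =>
  rw [hb, cond_true] at h
  simp only [Bool.and_eq_true, Nat.blt_eq, beq_iff_eq] at hb
  have hdvd := card_dvd_pow hF hb.1.1 (Nat.dvd_of_mod_eq_zero hb.1.2) hb.2
  have hr0 : (r : F) = 0 := by
    obtain ⟨t, ht⟩ := hdvd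
    have := congrArg (Nat.cast : ℕ → F) ht
    rw [Nat.cast_mul, ← hF, FiniteField.cast_card_eq_zero, zero_mul, Nat.cast_pow] at this
    exact eq_zero_of_pow_eq_zero this
  rw [beq_iff_eq.2 (Nat.mod_eq_zero_of_dvd hdvd), cond_true] at h
  rcases s with ⟨t, _ | ⟨⟨d, f, a, b⟩, u⟩⟩
  · simp at h
  · cases hc : extCertTest (2 * m + 1) m r ps d f a b with
    | true => exact exists_of_extCertTest hF h0 hps hr0 (by omega) hc
    | false => simp [hc] at h

theorem solvable_of_search {n : ℕ} {L : List ℕ} {m φ k : ℕ} {ps : List ℕ} {s s' : Certs}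
    (hL : L.Pairwise (· < ·)) (hL' : ∀ p ∈ L, p.Prime ∧ p < 1952) (h0 : 0 < m)
    (hφ : φ = m.totient) (hk : k = 2 ^ #m.primeFactors)
    (hps : ∀ l : ℕ, l.Prime → l ∣ m → l ∈ ps) (h : search n L m φ k ps s = some s')
    {t : ℕ} (ht : 1 < t) (htL : ∀ l : ℕ, l.Prime → l ∣ t → l ∈ L ∨ 1952 ≤ l) :
    Solvable F (m * t) := by
  induction n generalizing L m φ k ps s s' t with
  | zero => simp [search] at h
  | succ n ih =>
  rcases L with _ | ⟨p, L⟩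
  · simp [search] at h
  obtain ⟨hp, hpB⟩ := hL' p List.mem_cons_self
  have hlow : ∀ l : ℕ, l.Prime → l ∣ t → p ≤ l := by
    intro l hl hlt
    rcases htL l hl hlt with h1 | h1
    · rcases List.mem_cons.1 h1 with rfl | h1
      · exact le_rfl
      · exact (List.rel_of_pairwise_cons hL h1).le
    · omega
  unfold search at h
  cases hpr : prune m φ k p with
  | true =>
    subst hφ hk
    exact solvable_of_prune h0 ht hlow hpr
  | false =>
  rw [hpr, cond_false] at h
  have hmp := Nat.mul_pos h0 hp.pos
  have key : ∀ φ' k' ps' (_ : φ' = (m * p).totient) (_ : k' = 2 ^ #(m * p).primeFactors)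
      (_ : ∀ l : ℕ, l.Prime → l ∣ m * p → l ∈ ps') (_ : ((step (m * p) φ' k' ps' s).bind
        (search n (p :: L) (m * p) φ' k' ps')).bind (search n L m φ k ps) = some s'),
      Solvable F (m * t) := by
    intro φ' k' ps' hφ' hk' hps' h
    obtain ⟨s₂, h₂, h₃⟩ := Option.bind_eq_some_iff.1 h
    obtain ⟨s₁, h₁, h₂⟩ := Option.bind_eq_some_iff.1 h₂
    by_cases hpt : p ∣ t
    · obtain ⟨t, rfl⟩ := hpt
      rw [← mul_assoc]
      rcases Nat.lt_trichotomy t 1 with ht1 | rfl | ht1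
      · simp [Nat.lt_one_iff.1 ht1] at ht
      · rw [mul_one]
        exact solvable_of_step hmp hφ' hk' hps' h₁
      · exact ih hL hL' hmp hφ' hk' hps' h₂ ht1 fun l hl hlt ↦ htL l hl (hlt.mul_left p)
    · refine ih (List.Pairwise.of_cons hL) (fun l hl ↦ hL' l (List.mem_cons_of_mem p hl)) h0 hφ hk
        hps h₃ ht fun l hl hlt ↦ (htL l hl hlt).imp_left fun h ↦ ?_
      rcases List.mem_cons.1 h with rfl | h
      · exact absurd hlt hpt
      · exact h
  cases hd : m % p == 0 with
  | true =>
    rw [hd, cond_true, forceNat_eq, forceNat_eq] at h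
    have hd' := Nat.dvd_of_mod_eq_zero (beq_iff_eq.1 hd)
    refine key _ _ _ ?_ ?_ (fun l hl hlm ↦ hps l hl ?_) h
    · rw [totient_mul_prime hp, if_pos hd', hφ]
    · rw [card_primeFactors_mul_prime h0 hp, if_pos hd', hk]
    · rcases hl.dvd_mul.1 hlm with h | h
      · exact h
      · exact h.trans hd'
  | false =>
    rw [hd, cond_false, forceNat_eq, forceNat_eq, forceNat_eq] at h
    have hd' : ¬ p ∣ m := fun h ↦ by simp [Nat.mod_eq_zero_of_dvd h] at hd
    refine key _ _ _ ?_ ?_ (fun l hl hlm ↦ ?_) h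
    · rw [totient_mul_prime hp, if_neg hd', hφ]
    · rw [card_primeFactors_mul_prime h0 hp, if_neg hd', hk, pow_succ']
    · rcases hl.dvd_mul.1 hlm with h | h
      · exact List.mem_cons_of_mem p (hps l hl h)
      · rw [(Nat.prime_dvd_prime_iff_eq hl hp).1 h]
        exact List.mem_cons_self

theorem search_isSome :
    (search 330 smallPrimes 1 1 1 [] (primeCerts, extCerts)).isSome = true := by
  decide +kernel

theorem solvable {h : ℕ} (hh : 1 < h) : Solvable F h := by
  obtain ⟨s, hs⟩ := Option.isSome_iff_exists.1 search_isSome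
  rw [← one_mul h]
  refine solvable_of_search smallPrimes_sorted (fun p hp ↦ (mem_smallPrimes.1 hp).symm)
    Nat.one_pos Nat.totient_one.symm (by simp) (fun l hl h1 ↦ ?_) hs hh fun l hl _ ↦ ?_
  · exact absurd (Nat.dvd_one.1 h1) hl.ne_one
  · rw [mem_smallPrimes]
    rcases lt_or_ge l 1952 with h | h
    · exact Or.inl ⟨h, hl⟩
    · exact Or.inr h

end Search

section Main

variable {F : Type*} [Field F] [Fintype F]

theorem exists_sq_eq_of_orderOf_eq {h : ℕ} (hF : Fintype.card F = 2 * h + 1) (h0 : 0 < h) {a : F}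
    (ha : orderOf a = h) : ∃ x : F, orderOf x = 2 * h ∧ x ^ 2 = a := by
  have hchar : ringChar F ≠ 2 := by
    intro hc
    have := FiniteField.even_card_of_char_two hc
    omega
  have ha0 : a ≠ 0 := by
    rintro rfl
    have := pow_orderOf_eq_one (0 : F)
    rw [ha, zero_pow h0.ne'] at this
    exact zero_ne_one this
  obtain ⟨x, hx⟩ := (FiniteField.isSquare_iff hchar ha0).2 (by
    rw [hF, show (2 * h + 1) / 2 = h by omega, ← ha, pow_orderOf_eq_one])
  rw [← sq] at hx
  have hxo : orderOf x / (orderOf x).gcd 2 = h := by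
    rw [← orderOf_pow' x two_ne_zero, ← hx, ha]
  rcases Nat.even_or_odd (orderOf x) with he | ho
  · refine ⟨x, ?_, hx.symm⟩
    rw [Nat.gcd_eq_right he.two_dvd] at hxo
    have := he.two_dvd
    omega
  · have hc : (orderOf x).Coprime 2 := Nat.coprime_two_right.2 ho
    rw [hc, Nat.div_one] at hxo
    have h2 : orderOf (-1 : F) = 2 := by rw [orderOf_neg_one, if_neg hchar]
    refine ⟨-1 * x, ?_, by rw [hx]; ring⟩
    rw [(Commute.all _ _).orderOf_mul_eq_mul_orderOf_of_coprime (by rw [h2]; exact hc.symm), h2,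
      hxo]

theorem exists_of_solvable {h : ℕ} (hF : Fintype.card F = 2 * h + 1) (h0 : 0 < h)
    (hs : Solvable F h) (hq : 2 * h + 1 ∉ [3, 5, 9, 13, 25]) :
    ∃ x y z : F, orderOf x = 2 * h ∧ orderOf y = 2 * h ∧ orderOf z = 2 * h ∧
      x ^ 2 + y ^ 2 + z ^ 2 = 1 := by
  obtain ⟨a, b, c, ha, hb, hc, h1⟩ := hs.resolve_left hq hF
  obtain ⟨x, hx, rfl⟩ := exists_sq_eq_of_orderOf_eq hF h0 ha
  obtain ⟨y, hy, rfl⟩ := exists_sq_eq_of_orderOf_eq hF h0 hb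
  obtain ⟨z, hz, rfl⟩ := exists_sq_eq_of_orderOf_eq hF h0 hc
  exact ⟨x, y, z, hx, hy, hz, h1⟩

theorem pow_eq_neg_one_of_orderOf_eq {R : Type*} [CommRing R] [IsDomain R] {x : R} {n : ℕ}
    (h0 : 0 < n) (hx : orderOf x = 2 * n) : x ^ n = -1 := by
  have h1 : (x ^ n) ^ 2 = 1 := by rw [← pow_mul, mul_comm, ← hx, pow_orderOf_eq_one]
  refine (sq_eq_sq_iff_eq_or_eq_neg.1 (h1.trans (one_pow 2).symm)).resolve_left fun h ↦ ?_
  have := Nat.le_of_dvd h0 (orderOf_dvd_of_pow_eq_one h)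
  omega

theorem sq_sub_self_add_one_of_orderOf_eq {R : Type*} [CommRing R] [IsDomain R] {x : R} {n : ℕ}
    (h0 : 0 < n) (hx : orderOf x = 6 * n) : (x ^ n) ^ 2 - x ^ n + 1 = 0 := by
  have h1 : x ^ (3 * n) = -1 := pow_eq_neg_one_of_orderOf_eq (by omega) (by rw [hx]; ring)
  have h2 : x ^ n + 1 ≠ 0 := by
    intro h
    have h3 : x ^ (2 * n) = 1 := by
      rw [mul_comm, pow_mul]
      linear_combination (x ^ n - 1) * h
    have := Nat.le_of_dvd (by omega) (orderOf_dvd_of_pow_eq_one h3)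
    omega
  refine (mul_eq_zero.1 (?_ : (x ^ n + 1) * _ = 0)).resolve_left h2
  rw [mul_comm, pow_mul] at h1
  linear_combination h1

theorem sum_sq_ne_one_of_card_eq_three (hF : Fintype.card F = 3) {x y z : F}
    (hx : orderOf x = 2) (hy : orderOf y = 2) (hz : orderOf z = 2) :
    x ^ 2 + y ^ 2 + z ^ 2 ≠ 1 := by
  intro h
  have hp : ((3 : ℕ) : F) = 0 := hF ▸ FiniteField.cast_card_eq_zero F
  have h1 := pow_orderOf_eq_one x
  have h2 := pow_orderOf_eq_one y
  have h3 := pow_orderOf_eq_one z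
  rw [hx] at h1
  rw [hy] at h2
  rw [hz] at h3
  refine natCast_ne_zero_of_gcd hp (a := 2) rfl ?_
  push_cast
  linear_combination h - h1 - h2 - h3

theorem sum_sq_ne_one_of_card_eq_five (hF : Fintype.card F = 5) {x y z : F}
    (hx : orderOf x = 4) (hy : orderOf y = 4) (hz : orderOf z = 4) :
    x ^ 2 + y ^ 2 + z ^ 2 ≠ 1 := by
  intro h
  have hp : ((5 : ℕ) : F) = 0 := hF ▸ FiniteField.cast_card_eq_zero F
  have h1 := pow_eq_neg_one_of_orderOf_eq (n := 2) (by norm_num) hx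
  have h2 := pow_eq_neg_one_of_orderOf_eq (n := 2) (by norm_num) hy
  have h3 := pow_eq_neg_one_of_orderOf_eq (n := 2) (by norm_num) hz
  refine natCast_ne_zero_of_gcd hp (a := 4) rfl ?_
  push_cast
  linear_combination -h + h1 + h2 + h3

theorem sum_sq_ne_one_of_card_eq_thirteen (hF : Fintype.card F = 13) {x y z : F}
    (hx : orderOf x = 12) (hy : orderOf y = 12) (hz : orderOf z = 12) :
    x ^ 2 + y ^ 2 + z ^ 2 ≠ 1 := by
  intro h
  have hp : ((13 : ℕ) : F) = 0 := hF ▸ FiniteField.cast_card_eq_zero F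
  have key (w : F) (hw : orderOf w = 12) : w ^ 2 = 4 ∨ w ^ 2 = -3 := by
    have := sq_sub_self_add_one_of_orderOf_eq (n := 2) (by norm_num) hw
    have h1 : (w ^ 2 - 4) * (w ^ 2 + 3) = 0 := by
      push_cast at hp
      linear_combination this - hp
    rcases mul_eq_zero.1 h1 with h1 | h1
    · exact Or.inl (by linear_combination h1)
    · exact Or.inr (by linear_combination h1)
  have h11 := natCast_ne_zero_of_gcd hp (a := 11) rfl
  have h4 := natCast_ne_zero_of_gcd hp (a := 4) rfl
  have h3 := natCast_ne_zero_of_gcd hp (a := 3) rfl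
  have h10 := natCast_ne_zero_of_gcd hp (a := 10) rfl
  push_cast at h11 h4 h3 h10
  rcases key x hx with h1 | h1 <;> rcases key y hy with h2 | h2 <;>
    rcases key z hz with h3' | h3' <;> rw [h1, h2, h3'] at h
  · exact h11 (by linear_combination h)
  · exact h4 (by linear_combination h)
  · exact h4 (by linear_combination h)
  · exact h3 (by linear_combination -h)
  · exact h4 (by linear_combination h)
  · exact h3 (by linear_combination -h)
  · exact h3 (by linear_combination -h)
  · exact h10 (by linear_combination -h)

theorem sum_sq_ne_one_of_card_eq_nine (hF : Fintype.card F = 9) {x y z : F}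
    (hx : orderOf x = 8) (hy : orderOf y = 8) (hz : orderOf z = 8) :
    x ^ 2 + y ^ 2 + z ^ 2 ≠ 1 := by
  intro h
  have hp : ((3 : ℕ) : F) = 0 := by
    have : ((9 : ℕ) : F) = 0 := hF ▸ FiniteField.cast_card_eq_zero F
    refine eq_zero_of_pow_eq_zero (n := 2) ?_
    rw [← Nat.cast_pow]
    exact this
  have h2 := natCast_ne_zero_of_gcd hp (a := 2) rfl
  push_cast at hp h2
  have key (w : F) (hw : orderOf w = 8) : (w ^ 2) ^ 2 = -1 := by
    rw [← pow_mul]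
    exact pow_eq_neg_one_of_orderOf_eq (by norm_num) hw
  have hx' := key x hx
  have hy' := sq_eq_sq_iff_eq_or_eq_neg.1 ((key y hy).trans hx'.symm)
  have hz' := sq_eq_sq_iff_eq_or_eq_neg.1 ((key z hz).trans hx'.symm)
  rcases hy' with hy' | hy' <;> rcases hz' with hz' | hz' <;> rw [hy', hz'] at h
  · exact one_ne_zero (α := F) (by linear_combination x ^ 2 * hp - h)
  · exact h2 (by linear_combination hx' - (x ^ 2 + 1) * h)
  · exact h2 (by linear_combination hx' - (x ^ 2 + 1) * h)
  · exact h2 (by linear_combination hx' + (x ^ 2 - 1) * h)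

theorem sum_sq_ne_one_of_card_eq_twenty_five (hF : Fintype.card F = 25) {x y z : F}
    (hx : orderOf x = 24) (hy : orderOf y = 24) (hz : orderOf z = 24) :
    x ^ 2 + y ^ 2 + z ^ 2 ≠ 1 := by
  intro h
  have hp : ((5 : ℕ) : F) = 0 := by
    have : ((25 : ℕ) : F) = 0 := hF ▸ FiniteField.cast_card_eq_zero F
    refine eq_zero_of_pow_eq_zero (n := 2) ?_
    rw [← Nat.cast_pow]
    exact this
  have h2 := natCast_ne_zero_of_gcd hp (a := 2) rfl
  have h14 := natCast_ne_zero_of_gcd hp (a := 14) rfl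
  have h18 := natCast_ne_zero_of_gcd hp (a := 18) rfl
  push_cast at hp h2 h14 h18
  have key (w : F) (hw : orderOf w = 24) :
      ∃ e s : F, w ^ 2 = e + s ∧ (e = 1 ∨ e = -1) ∧ s ^ 2 = 2 := by
    have h1 := sq_sub_self_add_one_of_orderOf_eq (n := 4) (by norm_num) hw
    have h2 : ((w ^ 2 - 1) ^ 2 - 2) * ((w ^ 2 + 1) ^ 2 - 2) = 0 := by
      linear_combination h1 - w ^ 4 * hp
    rcases mul_eq_zero.1 h2 with h2 | h2
    · exact ⟨1, w ^ 2 - 1, by ring, Or.inl rfl, by linear_combination h2⟩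
    · exact ⟨-1, w ^ 2 + 1, by ring, Or.inr rfl, by linear_combination h2⟩
  obtain ⟨e₁, s₁, h₁, he₁, hs₁⟩ := key x hx
  obtain ⟨e₂, s₂, h₂, he₂, hs₂⟩ := key y hy
  obtain ⟨e₃, s₃, h₃, he₃, hs₃⟩ := key z hz
  have hs : (s₁ + s₂ + s₃) ^ 2 = 2 ∨ (s₁ + s₂ + s₃) ^ 2 = 18 := by
    rcases sq_eq_sq_iff_eq_or_eq_neg.1 (hs₂.trans hs₁.symm) with rfl | rfl <;>
      rcases sq_eq_sq_iff_eq_or_eq_neg.1 (hs₃.trans hs₁.symm) with rfl | rfl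
    · exact Or.inr (by linear_combination 9 * hs₁)
    all_goals exact Or.inl (by linear_combination hs₁)
  have he : (1 - (e₁ + e₂ + e₃)) ^ 2 = 0 ∨ (1 - (e₁ + e₂ + e₃)) ^ 2 = 4 ∨
      (1 - (e₁ + e₂ + e₃)) ^ 2 = 16 := by
    rcases he₁ with rfl | rfl <;> rcases he₂ with rfl | rfl <;> rcases he₃ with rfl | rfl <;>
      norm_num
  rw [show 1 - (e₁ + e₂ + e₃) = s₁ + s₂ + s₃ by linear_combination h₁ + h₂ + h₃ - h] at he
  rcases hs with hs | hs <;> rcases he with he | he | he <;> rw [hs] at he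
  · exact h2 he
  · exact h2 (by linear_combination -he)
  · exact h14 (by linear_combination -he)
  · exact h18 he
  · exact h14 (by linear_combination he)
  · exact h2 (by linear_combination he)

end Main

end PrimitiveSphere

theorem stmt_1 (q : ℕ) (hodd : Odd q) (F : Type*) [Field F] [Fintype F]
    (hq : Fintype.card F = q) :
    (∃ x y z : F, orderOf x = q - 1 ∧ orderOf y = q - 1 ∧ orderOf z = q - 1 ∧
      x ^ 2 + y ^ 2 + z ^ 2 = 1) ↔ q ∉ ({3, 5, 9, 13, 25} : Set ℕ) := by
  constructor
  · rintro ⟨x, y, z, hx, hy, hz, h⟩ (rfl | rfl | rfl | rfl | rfl)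
    · exact PrimitiveSphere.sum_sq_ne_one_of_card_eq_three hq hx hy hz h
    · exact PrimitiveSphere.sum_sq_ne_one_of_card_eq_five hq hx hy hz h
    · exact PrimitiveSphere.sum_sq_ne_one_of_card_eq_nine hq hx hy hz h
    · exact PrimitiveSphere.sum_sq_ne_one_of_card_eq_thirteen hq hx hy hz h
    · exact PrimitiveSphere.sum_sq_ne_one_of_card_eq_twenty_five hq hx hy hz h
  · intro hex
    obtain ⟨h, rfl⟩ := hodd
    have h1 := Fintype.one_lt_card (α := F)
    have h2 : h ≠ 1 := by
      rintro rfl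
      simp at hex
    rw [Nat.add_sub_cancel]
    refine PrimitiveSphere.exists_of_solvable hq (by omega) (PrimitiveSphere.solvable (by omega)) fun hm ↦ hex ?_
    simpa using hm
end

section
/- Let q > 3 be a Fermat prime, let a_1, …, a_s ∈ 𝔽_q^*, and let b ∈ 𝔽_q. Let P denote the number of s-tuples (x_1, …, x_s) ∈ 𝔽_q^s with a_1x_1 + ⋯ + a_sx_s = b such that every coordinate x_i is a primitive element of 𝔽_q. Then, as real numbers, P = φ(q−1)^s/q + (1/q) · [(−1)^s·τ_0·∏_{i=1}^{s}(√q·χ_2(a_i) + 1) + τ_1·∏_{i=1}^{s}(√q·χ_2(a_i) − 1)] / 2^{s+1}, where τ_0 = ν(b) + √q·χ_2(b) and τ_1 = ν(b) − √q·χ_2(b). -/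
open Finset
open scoped Classical

/-- The quadratic character of a finite field, with complex values. -/
noncomputable def complexQuadraticChar (F : Type*) [Field F] [Fintype F] : MulChar F ℂ :=
  (quadraticChar F).ringHomComp (Int.castRingHom ℂ)

section GaussSums

variable {F : Type*} [Field F] [Fintype F]

lemma complexQuadraticChar_apply (x : F) :
    complexQuadraticChar F x = if x = 0 then 0 else if IsSquare x then 1 else -1 := by
  have h : complexQuadraticChar F x = ((quadraticChar F x : ℤ) : ℂ) := rfl
  rw [h]
  split_ifs with h0 hs
  · simp [h0]
  · simp [(quadraticChar_one_iff_isSquare h0).2 hs]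
  · simp [quadraticChar_neg_one_iff_not_isSquare.2 hs]

lemma complexQuadraticChar_isQuadratic : (complexQuadraticChar F).IsQuadratic := by
  intro x
  rw [complexQuadraticChar_apply]
  split_ifs <;> simp

lemma complexQuadraticChar_neg_one (h : Fintype.card F % 4 = 1) :
    complexQuadraticChar F (-1) = 1 := by
  rw [complexQuadraticChar_apply, if_neg (by simp), if_pos]
  rw [FiniteField.isSquare_neg_one_iff]
  omega

lemma ringChar_ne_two_of_card_mod_four (h : Fintype.card F % 4 = 1) : ringChar F ≠ 2 := by
  intro h2
  have := FiniteField.even_card_of_char_two h2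
  omega

lemma gaussSum_complexQuadraticChar_sq (h : Fintype.card F % 4 = 1) {ψ : AddChar F ℂ}
    (hψ : ψ.IsPrimitive) :
    gaussSum (complexQuadraticChar F) ψ ^ 2 = Fintype.card F := by
  have hne : complexQuadraticChar F ≠ 1 := by
    intro h1
    obtain ⟨x, hx⟩ := quadraticChar_exists_neg_one' (ringChar_ne_two_of_card_mod_four h)
    have h2 : complexQuadraticChar F (x : F) = ((quadraticChar F x : ℤ) : ℂ) := rfl
    rw [hx, h1, MulChar.one_apply_coe] at h2
    norm_num at h2
  rw [gaussSum_sq hne complexQuadraticChar_isQuadratic hψ, complexQuadraticChar_neg_one h, one_mul]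

lemma sum_complexQuadraticChar_mul (h : Fintype.card F % 4 = 1) (ψ : AddChar F ℂ) (c : F) :
    ∑ x, complexQuadraticChar F x * ψ (x * c) =
      complexQuadraticChar F c * gaussSum (complexQuadraticChar F) ψ := by
  by_cases hc : c = 0
  · subst hc
    have h0 := quadraticChar_sum_zero (ringChar_ne_two_of_card_mod_four h)
    have h1 : ∑ x, complexQuadraticChar F x = ((∑ x : F, quadraticChar F x : ℤ) : ℂ) := by
      push_cast
      rfl
    simp_rw [mul_zero, AddChar.map_zero_eq_one, mul_one]
    rw [h1, h0, complexQuadraticChar_apply, if_pos rfl, Int.cast_zero, zero_mul]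
  · have h1 := gaussSum_mulShift_eq (complexQuadraticChar F) ψ (Units.mk0 c hc)
    rw [complexQuadraticChar_isQuadratic.inv] at h1
    simpa [gaussSum, mul_comm] using h1

/-- The Fourier transform of a function depending only on the quadratic character. -/
lemma sum_ite_complexQuadraticChar (h : Fintype.card F % 4 = 1) {ψ : AddChar F ℂ}
    (hψ : ψ.IsPrimitive) (c : F) (A B C : ℂ) :
    ∑ x : F, (if x = 0 then A else if IsSquare x then B else C) * ψ (x * c) =
      A + ((B + C) * ((if c = 0 then (Fintype.card F : ℂ) else 0) - 1) +
        (B - C) * (complexQuadraticChar F c * gaussSum (complexQuadraticChar F) ψ)) / 2 := by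
  have key : ∀ x : F, (if x = 0 then A else if IsSquare x then B else C) * ψ (x * c) =
      (if x = 0 then A - (B + C) / 2 else 0) + (B + C) / 2 * ψ (x * c) +
        (B - C) / 2 * (complexQuadraticChar F x * ψ (x * c)) := by
    intro x
    rw [complexQuadraticChar_apply]
    split_ifs with h0
    · simp [h0]
    · ring
    · ring
  simp_rw [key, sum_add_distrib, ← mul_sum]
  rw [sum_complexQuadraticChar_mul h, AddChar.sum_mulShift c hψ]
  simp only [sum_ite_eq', mem_univ, if_true]
  push_cast
  ring

lemma sum_nonsquare_addChar (h : Fintype.card F % 4 = 1) {ψ : AddChar F ℂ}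
    (hψ : ψ.IsPrimitive) (c : F) :
    ∑ x : F with ¬ IsSquare x, ψ (x * c) =
      ((if c = 0 then (Fintype.card F : ℂ) else 0) - 1 -
        complexQuadraticChar F c * gaussSum (complexQuadraticChar F) ψ) / 2 := by
  have h1 := sum_ite_complexQuadraticChar h hψ c 0 0 1
  have h2 : ∑ x : F with ¬ IsSquare x, ψ (x * c) =
      ∑ x : F, (if x = 0 then (0 : ℂ) else if IsSquare x then 0 else 1) * ψ (x * c) := by
    rw [sum_filter]
    refine sum_congr rfl fun x _ => ?_
    by_cases h0 : x = 0
    · simp [h0]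
    · by_cases hs : IsSquare x <;> simp [h0, hs]
  rw [h2, h1]
  ring

/-- The number of representations of `b` by a linear form with variables in a finset. -/
lemma card_mul_card_linear_eq {ι : Type*} [Fintype ι] [DecidableEq ι] {ψ : AddChar F ℂ} (hψ : ψ.IsPrimitive)
    (S : Finset F) (a : ι → F) (b : F) :
    (Fintype.card F : ℂ) *
        (#{x ∈ Fintype.piFinset fun _ : ι => S | ∑ i, a i * x i = b} : ℂ) =
      ∑ c : F, (∏ i, ∑ x ∈ S, ψ (x * (c * a i))) * ψ (c * -b) := by
  have h1 : ∀ x : ι → F, ∑ c : F, ψ (c * (∑ i, a i * x i - b)) =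
      if ∑ i, a i * x i = b then (Fintype.card F : ℂ) else 0 := by
    intro x
    rw [AddChar.sum_mulShift _ hψ]
    simp [sub_eq_zero]
  have h2 : ∀ (x : ι → F) (c : F), ψ (c * (∑ i, a i * x i - b)) =
      (∏ i, ψ (x i * (c * a i))) * ψ (c * -b) := by
    intro x c
    have h3 : ∏ i, ψ (x i * (c * a i)) = ψ (∑ i, x i * (c * a i)) :=
      (map_prod ψ.toMonoidHom (fun i => Multiplicative.ofAdd (x i * (c * a i))) univ).symm
    rw [h3, ← AddChar.map_add_eq_mul]
    congr 1
    rw [mul_sub, mul_sum, mul_neg, sub_eq_add_neg]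
    congr 1
    exact sum_congr rfl fun i _ => by ring
  simp_rw [← sum_prod_piFinset S (fun i x => ψ (x * (_ * a i))), sum_mul, ← h2]
  rw [sum_comm]
  simp_rw [h1]
  rw [← sum_filter, sum_const, nsmul_eq_mul, mul_comm]

/-- The number of representations of `b` by a linear form evaluated at nonsquares. -/
lemma card_mul_card_linear_nonsquare {ι : Type*} [Fintype ι] [DecidableEq ι] (h : Fintype.card F % 4 = 1)
    {ψ : AddChar F ℂ} (hψ : ψ.IsPrimitive) (a : ι → F) (ha : ∀ i, a i ≠ 0) (b : F) {G : ℂ}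
    (hG : gaussSum (complexQuadraticChar F) ψ = G) :
    (Fintype.card F : ℂ) * (#{x ∈ Fintype.piFinset fun _ : ι => ({x | ¬ IsSquare x} : Finset F) |
        ∑ i, a i * x i = b} : ℂ) =
      (((Fintype.card F : ℂ) - 1) / 2) ^ Fintype.card ι +
      ((∏ i, (-(G * complexQuadraticChar F (a i) + 1) / 2)) *
        (((if b = 0 then (Fintype.card F : ℂ) else 0) - 1) + G * complexQuadraticChar F b) +
      (∏ i, ((G * complexQuadraticChar F (a i) - 1) / 2)) *
        (((if b = 0 then (Fintype.card F : ℂ) else 0) - 1) -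
          G * complexQuadraticChar F b)) / 2 := by
  rw [card_mul_card_linear_eq hψ]
  have key : ∀ c : F, (∏ i, ∑ x : F with ¬ IsSquare x, ψ (x * (c * a i))) =
      if c = 0 then (((Fintype.card F : ℂ) - 1) / 2) ^ Fintype.card ι else
      if IsSquare c then ∏ i, (-(G * complexQuadraticChar F (a i) + 1) / 2) else
        ∏ i, ((G * complexQuadraticChar F (a i) - 1) / 2) := by
    intro c
    simp_rw [sum_nonsquare_addChar h hψ, hG, map_mul, complexQuadraticChar_apply c]
    split_ifs with h0 hs
    · simp [h0, div_pow]
    · refine prod_congr rfl fun i _ => ?_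
      rw [if_neg (mul_ne_zero h0 (ha i))]
      ring
    · refine prod_congr rfl fun i _ => ?_
      rw [if_neg (mul_ne_zero h0 (ha i))]
      ring
  simp_rw [key]
  rw [sum_ite_complexQuadraticChar h hψ, hG, neg_eq_neg_one_mul, map_mul,
    complexQuadraticChar_neg_one h]
  simp only [neg_mul, one_mul, neg_eq_zero]
  ring

/-- If `#F - 1` is a power of two, primitive elements are the nonsquares. -/
lemma orderOf_eq_card_sub_one_iff_not_isSquare {n : ℕ} (hn : Fintype.card F = 2 ^ (n + 1) + 1)
    (x : F) : orderOf x = Fintype.card F - 1 ↔ ¬ IsSquare x := by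
  have hF : ringChar F ≠ 2 := by
    intro h2
    have := FiniteField.even_card_of_char_two h2
    rw [pow_succ] at hn
    omega
  by_cases h0 : x = 0
  · subst h0
    rw [orderOf_zero, hn, Nat.add_sub_cancel]
    simp [(pow_ne_zero (n + 1) (two_ne_zero (α := ℕ))).symm]
  · have hd : Fintype.card F / 2 = 2 ^ n := by
      rw [hn, pow_succ]
      omega
    rw [FiniteField.isSquare_iff hF h0, hd, hn, Nat.add_sub_cancel]
    constructor
    · intro ho hx
      have h1 := Nat.le_of_dvd (by positivity) (orderOf_dvd_of_pow_eq_one hx)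
      rw [ho, pow_succ] at h1
      have : 0 < 2 ^ n := by positivity
      omega
    · intro hx
      refine orderOf_eq_prime_pow hx ?_
      have := FiniteField.pow_card_sub_one_eq_one x h0
      rwa [hn, Nat.add_sub_cancel] at this

end GaussSums

theorem stmt_2 (q : ℕ) (hprime : Nat.Prime q) (hfermat : ∃ l : ℕ, q = 2 ^ (2 ^ l) + 1)
    (hq3 : 3 < q) (s : ℕ) (hs : 0 < s) (F : Type*) [Field F] [Fintype F]
    (hcard : Fintype.card F = q)
    (a : Fin s → F) (ha : ∀ i, a i ≠ 0) (b : F)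
    (χ₂ : F → ℝ) (hχ₂ : ∀ x, χ₂ x = if x = 0 then 0 else if IsSquare x then 1 else -1)
    (ν : F → ℝ) (hν : ∀ x, ν x = if x = 0 then (q : ℝ) - 1 else -1)
    (τ₀ τ₁ : ℝ) (hτ₀ : τ₀ = ν b + Real.sqrt q * χ₂ b)
    (hτ₁ : τ₁ = ν b - Real.sqrt q * χ₂ b)
    (P : ℕ) (hP : P = Nat.card {x : Fin s → F //
      (∑ i, a i * x i) = b ∧ ∀ i, orderOf (x i) = q - 1}) :
    (P : ℝ) = (Nat.totient (q - 1) : ℝ) ^ s / q +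
      (1 / q) * (((-1) ^ s * τ₀ * ∏ i, (Real.sqrt q * χ₂ (a i) + 1) +
        τ₁ * ∏ i, (Real.sqrt q * χ₂ (a i) - 1)) / 2 ^ (s + 1)) := by
  obtain ⟨l, hl⟩ := hfermat
  obtain ⟨n, hn⟩ : ∃ n, 2 ^ l = n + 2 := by
    rcases l with _ | l
    · simp at hl
      omega
    · have : 0 < 2 ^ l := by positivity
      exact ⟨2 * 2 ^ l - 2, by rw [pow_succ]; omega⟩
  rw [hn] at hl
  have hmod : Fintype.card F % 4 = 1 := by
    rw [hcard, hl, pow_add]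
    omega
  have hφ : (Nat.totient (q - 1) : ℝ) = ((q : ℝ) - 1) / 2 := by
    rw [hl, Nat.add_sub_cancel, Nat.totient_prime_pow Nat.prime_two (by omega)]
    rw [show n + 2 - 1 = n + 1 from rfl]
    push_cast
    ring
  have hPcard : P = #{x ∈ Fintype.piFinset fun _ : Fin s => ({x | ¬ IsSquare x} : Finset F) |
      ∑ i, a i * x i = b} := by
    rw [hP, Nat.card_eq_fintype_card, Fintype.card_subtype]
    congr 1
    ext x
    simp only [mem_filter, mem_univ, true_and, Fintype.mem_piFinset, ← hcard,
      orderOf_eq_card_sub_one_iff_not_isSquare (n := n + 1) (hcard.trans hl)]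
    tauto
  have hψ := AddChar.FiniteField.primitiveChar_to_Complex_isPrimitive F
  have hcount := card_mul_card_linear_nonsquare hmod hψ a ha b rfl
  have hsq := gaussSum_complexQuadraticChar_sq hmod hψ
  rw [← hPcard, hcard, Fintype.card_fin] at hcount
  rw [hcard] at hsq
  have hχ : ∀ x, complexQuadraticChar F x = ((χ₂ x : ℝ) : ℂ) := by
    intro x
    rw [complexQuadraticChar_apply, hχ₂]
    split_ifs <;> simp
  have hνb : (if b = 0 then (q : ℂ) else 0) - 1 = ((ν b : ℝ) : ℂ) := by
    rw [hν]
    split_ifs <;> simp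
  have hr : ((Real.sqrt q : ℝ) : ℂ) ^ 2 = q := by
    rw [← Complex.ofReal_pow, Real.sq_sqrt (Nat.cast_nonneg q), Complex.ofReal_natCast]
  rw [← hr, sq_eq_sq_iff_eq_or_eq_neg] at hsq
  simp_rw [hχ, hνb] at hcount
  have hq0 : (q : ℝ) ≠ 0 := by positivity
  have hneg : ∀ f : Fin s → ℝ, ∏ i, (-f i / 2) = (-1) ^ s * (∏ i, f i) / 2 ^ s := by
    intro f
    simp [prod_div_distrib, prod_neg]
  have hpos : ∀ f : Fin s → ℝ, ∏ i, (f i / 2) = (∏ i, f i) / 2 ^ s := by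
    intro f
    simp [prod_div_distrib]
  have hreal : (q : ℝ) * P = (((q : ℝ) - 1) / 2) ^ s +
      ((∏ i, (-(Real.sqrt q * χ₂ (a i) + 1) / 2)) * τ₀ +
        (∏ i, ((Real.sqrt q * χ₂ (a i) - 1) / 2)) * τ₁) / 2 := by
    rw [hτ₀, hτ₁]
    rcases hsq with hG | hG <;> rw [hG] at hcount
    · exact_mod_cast hcount
    · have h1 : ∀ x : ℝ, -(-Real.sqrt q * x + 1) / 2 = (Real.sqrt q * x - 1) / 2 := by
        intro x
        ring
      have h2 : ∀ x : ℝ, (-Real.sqrt q * x - 1) / 2 = -(Real.sqrt q * x + 1) / 2 := by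
        intro x
        ring
      have h3 : (q : ℝ) * P = (((q : ℝ) - 1) / 2) ^ s +
          ((∏ i, (-(-Real.sqrt q * χ₂ (a i) + 1) / 2)) * (ν b + -Real.sqrt q * χ₂ b) +
            (∏ i, ((-Real.sqrt q * χ₂ (a i) - 1) / 2)) * (ν b - -Real.sqrt q * χ₂ b)) / 2 := by
        exact_mod_cast hcount
      simp_rw [h1, h2] at h3
      rw [h3]
      ring
  rw [hneg, hpos] at hreal
  rw [hφ]
  field_simp
  rw [mul_comm (P : ℝ), hreal]
  field_simp
  ring
end

section
/- Let q > 3 be a Fermat prime and s a positive integer. Let P denote the number of s-tuples (x_1, …, x_s) ∈ 𝔽_q^s with x_1 + x_2 + ⋯ + x_s = 0 such that every coordinate x_i is a primitive element of 𝔽_q. Then, as real numbers, P = φ(q−1)^s/q + ((q−1)/q) · [(√q − 1)^s + (−1)^s·(√q + 1)^s] / 2^{s+1}. -/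
open Finset

theorem addChar_sum_eq_prod {ι A R : Type*} [AddCommMonoid A] [CommMonoid R] (ψ : AddChar A R)
    (t : Finset ι) (f : ι → A) : ψ (∑ i ∈ t, f i) = ∏ i ∈ t, ψ (f i) :=
  map_prod ψ.toMonoidHom (fun i ↦ Multiplicative.ofAdd (f i)) t

open scoped Classical in
/-- Orthogonality of additive characters counts the zero-sum tuples with entries in `A`. -/
theorem card_zero_sum_tuples_mul_card {F : Type*} [Field F] [Fintype F] {ψ : AddChar F ℂ}
    (hψ : ψ.IsPrimitive) (A : Finset F) (s : ℕ) :
    (Nat.card {x : Fin s → F // (∑ i, x i) = 0 ∧ ∀ i, x i ∈ A} : ℂ) * Fintype.card F =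
      ∑ a : F, (∑ x ∈ A, ψ (a * x)) ^ s := by
  have expand (a : F) : (∑ x ∈ A, ψ (a * x)) ^ s =
      ∑ x : Fin s → F, if ∀ i, x i ∈ A then ψ (a * ∑ i, x i) else 0 := by
    rw [← Fintype.sum_ite_mem, Fintype.sum_pow]
    refine Finset.sum_congr rfl fun x _ ↦ ?_
    rw [Finset.prod_ite_zero, Finset.mul_sum, addChar_sum_eq_prod]
    simp
  simp_rw [expand]
  rw [Finset.sum_comm, Nat.card_eq_fintype_card, Fintype.card_subtype, Finset.card_filter]
  push_cast
  rw [Finset.sum_mul]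
  refine Finset.sum_congr rfl fun x _ ↦ ?_
  by_cases hA : ∀ i, x i ∈ A
  · simp only [hA, implies_true, and_true, if_true]
    rw [AddChar.sum_mulShift _ hψ]
    split_ifs <;> simp
  · simp [hA]

section QuadraticChar

variable {F : Type*} [Field F] [Fintype F] [DecidableEq F]

theorem sum_comp_quadraticChar (hF : ringChar F ≠ 2) (h : ℤ → ℂ) :
    ∑ a : F, h (quadraticChar F a) =
      h 0 + ((Fintype.card F : ℂ) - 1) / 2 * (h 1 + h (-1)) := by
  have key (a : F) : h (quadraticChar F a) =
      (if a = 0 then h 0 - (h 1 + h (-1)) / 2 else 0) + (h 1 + h (-1)) / 2 +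
        (quadraticChar F a : ℂ) * ((h 1 - h (-1)) / 2) := by
    by_cases ha : a = 0
    · simp [ha]
    · rcases quadraticChar_dichotomy ha with h' | h' <;> simp [ha, h'] <;> ring
  have hsum : ∑ a : F, (quadraticChar F a : ℂ) = 0 := by
    exact_mod_cast quadraticChar_sum_zero hF
  simp_rw [key]
  rw [Finset.sum_add_distrib, Finset.sum_add_distrib, ← Finset.sum_mul, hsum]
  simp
  ring

theorem sum_addChar_nonsquares {ψ : AddChar F ℂ} (hψ : ψ.IsPrimitive) {a : F} (ha : a ≠ 0) :
    ∑ x : F with quadraticChar F x = -1, ψ (a * x) =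
      (-1 - quadraticChar F a *
        gaussSum ((quadraticChar F).ringHomComp (Int.castRingHom ℂ)) ψ) / 2 := by
  set χ := (quadraticChar F).ringHomComp (Int.castRingHom ℂ) with hχ
  have hshift : ∑ x : F, (quadraticChar F x : ℂ) * ψ (a * x) =
      quadraticChar F a * gaussSum χ ψ := by
    have := gaussSum_mulShift_eq χ ψ (Units.mk0 a ha)
    rw [(MulChar.IsQuadratic.comp (quadraticChar_isQuadratic F) _ : χ.IsQuadratic).inv] at this
    simpa [gaussSum, hχ, AddChar.mulShift_apply] using this
  have hsum : ∑ x : F, ψ (a * x) = 0 := by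
    simpa [ha, mul_comm] using AddChar.sum_mulShift a hψ
  have key (x : F) : (if quadraticChar F x = -1 then ψ (a * x) else 0) =
      (ψ (a * x) - (if x = 0 then 1 else 0) - (quadraticChar F x : ℂ) * ψ (a * x)) / 2 := by
    by_cases hx : x = 0
    · simp [hx]
    · rcases quadraticChar_dichotomy hx with h' | h' <;> simp [hx, h']
  rw [Finset.sum_filter]
  simp_rw [key]
  rw [← Finset.sum_div, Finset.sum_sub_distrib, Finset.sum_sub_distrib, hsum, hshift]
  simp

theorem card_nonsquares (hF : ringChar F ≠ 2) :
    (#{x : F | quadraticChar F x = -1} : ℂ) = ((Fintype.card F : ℂ) - 1) / 2 := by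
  have := sum_comp_quadraticChar hF fun n ↦ if n = -1 then 1 else 0
  rw [Finset.card_filter]
  push_cast
  simpa using this

theorem orderOf_eq_card_sub_one_iff_quadraticChar {k : ℕ} (hk : Fintype.card F = 2 ^ (k + 1) + 1)
    (hF : ringChar F ≠ 2) (x : F) :
    orderOf x = Fintype.card F - 1 ↔ quadraticChar F x = -1 := by
  have hhalf : Fintype.card F / 2 = 2 ^ k := by rw [hk, pow_succ]; omega
  by_cases hx : x = 0
  · subst hx
    rw [hk, orderOf_zero, quadraticChar_zero]
    exact iff_of_false (by positivity : 0 < 2 ^ (k + 1)).ne (by decide)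
  rw [quadraticChar_neg_one_iff_not_isSquare, FiniteField.isSquare_iff hF hx, hhalf]
  constructor
  · intro h h1
    have := Nat.le_of_dvd (by positivity) (orderOf_dvd_of_pow_eq_one h1)
    rw [h, hk, pow_succ] at this
    have : 0 < 2 ^ k := by positivity
    omega
  · intro h
    have h1 := FiniteField.pow_card_sub_one_eq_one x hx
    rw [hk, Nat.add_sub_cancel] at h1 ⊢
    exact orderOf_eq_prime_pow h h1

end QuadraticChar

theorem eq_or_eq_neg_sqrt_of_sq_eq {g : ℂ} {q : ℕ} (h : g ^ 2 = q) :
    g = (Real.sqrt q : ℂ) ∨ g = -(Real.sqrt q : ℂ) := by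
  apply sq_eq_sq_iff_eq_or_eq_neg.mp
  rw [h]
  exact_mod_cast (Real.sq_sqrt (Nat.cast_nonneg q)).symm

theorem stmt_3 (q : ℕ) (hprime : Nat.Prime q) (hfermat : ∃ l : ℕ, q = 2 ^ (2 ^ l) + 1)
    (hq3 : 3 < q) (s : ℕ) (hs : 0 < s) (F : Type*) [Field F] [Fintype F]
    (hcard : Fintype.card F = q)
    (P : ℕ) (hP : P = Nat.card {x : Fin s → F //
      (∑ i, x i) = 0 ∧ ∀ i, orderOf (x i) = q - 1}) :
    (P : ℝ) = (Nat.totient (q - 1) : ℝ) ^ s / q +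
      ((q : ℝ) - 1) / q *
        ((Real.sqrt q - 1) ^ s + (-1) ^ s * (Real.sqrt q + 1) ^ s) / 2 ^ (s + 1) := by
  classical
  obtain ⟨k, hk⟩ : ∃ k, q = 2 ^ (k + 2) + 1 := by
    obtain ⟨l, rfl⟩ := hfermat
    rcases l with _ | l
    · norm_num at hq3
    · have : 2 ≤ 2 ^ (l + 1) := Nat.le_self_pow (by omega) 2
      exact ⟨2 ^ (l + 1) - 2, by rw [Nat.sub_add_cancel this]⟩
  have hmod : q % 4 = 1 := by rw [hk, pow_add]; omega
  have hF : ringChar F ≠ 2 := by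
    intro h
    have := FiniteField.even_card_iff_char_two.mp h
    omega
  have hq0 : (q : ℂ) ≠ 0 := by exact_mod_cast hprime.ne_zero
  have htot : (Nat.totient (q - 1) : ℂ) = ((q : ℂ) - 1) / 2 := by
    rw [hk, Nat.add_sub_cancel, Nat.totient_prime_pow_succ Nat.prime_two]
    push_cast
    ring
  set ψ := AddChar.FiniteField.primitiveChar_to_Complex F
  have hψ : ψ.IsPrimitive := AddChar.FiniteField.primitiveChar_to_Complex_isPrimitive F
  set g := gaussSum ((quadraticChar F).ringHomComp (Int.castRingHom ℂ)) ψ with hg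
  have hg2 : g ^ 2 = q := by
    have hneg : quadraticChar F (-1) = 1 := by
      rw [quadraticChar_one_iff_isSquare (by simp), FiniteField.isSquare_neg_one_iff]
      omega
    rw [hg, gaussSum_sq ((MulChar.ringHomComp_ne_one_iff Int.cast_injective).mpr
      (quadraticChar_ne_one hF)) (MulChar.IsQuadratic.comp (quadraticChar_isQuadratic F) _) hψ]
    simp [hneg, hcard]
  have hcount := card_zero_sum_tuples_mul_card hψ ({x : F | quadraticChar F x = -1} : Finset F) s
  have hPcard : P = Nat.card {x : Fin s → F // (∑ i, x i) = 0 ∧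
      ∀ i, x i ∈ ({x : F | quadraticChar F x = -1} : Finset F)} := by
    simp only [hP, Finset.mem_filter, Finset.mem_univ, true_and, ← hcard,
      orderOf_eq_card_sub_one_iff_quadraticChar (hcard.trans hk) hF]
  have hterm (a : F) : (∑ x : F with quadraticChar F x = -1, ψ (a * x)) ^ s =
      (fun n : ℤ ↦ if n = 0 then (((q : ℂ) - 1) / 2) ^ s else ((-1 - n * g) / 2) ^ s)
        (quadraticChar F a) := by
    by_cases ha : a = 0
    · simp only [ha, zero_mul, AddChar.map_zero_eq_one, Finset.sum_const, nsmul_one,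
        card_nonsquares hF, hcard, quadraticChar_zero, if_true]
    · simp only [sum_addChar_nonsquares hψ ha, quadraticChar_eq_zero_iff, ha, if_false, ← hg]
  replace hcount := hcount.trans
    ((Finset.sum_congr rfl fun a _ ↦ hterm a).trans (sum_comp_quadraticChar hF fun n ↦
      if n = 0 then (((q : ℂ) - 1) / 2) ^ s else ((-1 - n * g) / 2) ^ s))
  rw [← hPcard, hcard] at hcount
  have hsym : ((-1 - g) / 2) ^ s + ((-1 + g) / 2) ^ s =
      (((Real.sqrt q : ℂ) - 1) ^ s + (-1) ^ s * ((Real.sqrt q : ℂ) + 1) ^ s) / 2 ^ s := by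
    rw [← mul_pow, div_pow, div_pow, ← add_div]
    rcases eq_or_eq_neg_sqrt_of_sq_eq hg2 with h | h <;> rw [h] <;> ring
  suffices h : (P : ℂ) = (Nat.totient (q - 1) : ℂ) ^ s / q +
      ((q : ℂ) - 1) / q * (((Real.sqrt q : ℂ) - 1) ^ s +
        (-1) ^ s * ((Real.sqrt q : ℂ) + 1) ^ s) / 2 ^ (s + 1) by
    apply Complex.ofReal_injective
    push_cast
    exact h
  rw [htot, eq_comm, ← mul_left_inj' hq0, hcount]
  norm_num [← sub_eq_add_neg] at hsym ⊢
  rw [hsym]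
  generalize (((q : ℂ) - 1) / 2) ^ s = t
  rw [pow_succ]
  field_simp
end

section
/- Let q be a prime power, s a positive integer, and f ∈ 𝔽_q[x_1, …, x_s]. Let P denote the number of s-tuples (x_1, …, x_s) ∈ 𝔽_q^s with f(x_1, …, x_s) = 0 such that every coordinate x_i is a primitive element of 𝔽_q. Then, as rational numbers, P = Σ_{r_1 ∣ q−1} ⋯ Σ_{r_s ∣ q−1} (μ(r_1)⋯μ(r_s))/(r_1⋯r_s) · N*(f(x_1^{r_1}, …, x_s^{r_s})), where each r_i ranges over the positive divisors of q−1 and f(x_1^{r_1}, …, x_s^{r_s}) denotes the polynomial obtained from f by substituting x_i^{r_i} for x_i. -/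
open Finset

/-- In a finite cyclic group, the `r`-th powers, for `r` dividing the order `n` of the group, are
the elements `x` such that `r ∣ n / orderOf x`. -/
lemma IsCyclic.exists_pow_eq_iff_dvd_card_div_orderOf {G : Type*} [CommGroup G] [IsCyclic G]
    [Finite G] {r : ℕ} (hr : r ∣ Nat.card G) (x : G) :
    (∃ y : G, y ^ r = x) ↔ r ∣ Nat.card G / orderOf x := by
  obtain ⟨g, hgen⟩ := IsCyclic.exists_monoid_generator (α := G)
  have hg : orderOf g = Nat.card G :=
    orderOf_eq_card_of_forall_mem_zpowers fun y => mem_powers_iff_mem_zpowers.1 (hgen y)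
  obtain ⟨k, rfl⟩ := hgen x
  rw [orderOf_pow, hg, Nat.div_div_self (Nat.gcd_dvd_left _ _) Nat.card_pos.ne', Nat.dvd_gcd_iff]
  refine ⟨?_, ?_⟩
  · rintro ⟨y, hy⟩
    obtain ⟨j, rfl⟩ := hgen y
    rw [← pow_mul, pow_eq_pow_iff_modEq, hg] at hy
    exact ⟨hr, ((hy.of_dvd hr).dvd_iff dvd_rfl).1 (Dvd.intro_left _ rfl)⟩
  · rintro ⟨-, j, rfl⟩
    exact ⟨g ^ j, by rw [← pow_mul, mul_comm]⟩

/-- For `r` dividing the order of a finite cyclic group, an element has either `r` or no `r`-th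
roots. -/
lemma IsCyclic.card_filter_pow_eq {G : Type*} [CommGroup G] [IsCyclic G]
    [Fintype G] [DecidableEq G] {r : ℕ} (hr : r ∣ Nat.card G) (x : G) :
    #{y : G | y ^ r = x} = if r ∣ Nat.card G / orderOf x then r else 0 := by
  split_ifs with h
  · have hx := (IsCyclic.exists_pow_eq_iff_dvd_card_div_orderOf hr x).2 h
    have key := MonoidHom.card_fiber_eq_of_mem_range (powMonoidHom r : G →* G) (x := x) (y := 1)
      hx ⟨1, by simp⟩
    simp only [powMonoidHom_apply] at key
    rw [key]
    have hker := IsCyclic.card_powMonoidHom_ker (G := G) r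
    rw [Nat.gcd_eq_right hr] at hker
    rw [← Fintype.card_subtype, ← Nat.card_eq_fintype_card]
    exact hker
  · rw [card_eq_zero, filter_eq_empty_iff]
    exact fun y _ hy => h ((IsCyclic.exists_pow_eq_iff_dvd_card_div_orderOf hr x).1 ⟨y, hy⟩)

lemma ArithmeticFunction.sum_divisors_moebius (m : ℕ) :
    ∑ r ∈ m.divisors, (moebius r : ℚ) = if m = 1 then 1 else 0 := by
  rw [← one_apply, ← coe_moebius_mul_coe_zeta, coe_mul_zeta_apply]
  rfl

/-- Möbius inversion expresses the indicator of the generators of a finite cyclic group through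
the numbers of roots of an element. -/
lemma IsCyclic.sum_moebius_div_mul_card_filter_pow_eq {G : Type*} [CommGroup G] [IsCyclic G]
    [Fintype G] [DecidableEq G] (x : G) :
    ∑ r ∈ (Nat.card G).divisors,
        (ArithmeticFunction.moebius r : ℚ) / r * (#{y : G | y ^ r = x} : ℚ) =
      if orderOf x = Nat.card G then 1 else 0 := by
  have hn : Nat.card G ≠ 0 := Nat.card_pos.ne'
  have hdvd := orderOf_dvd_natCard x
  have hiff : Nat.card G / orderOf x = 1 ↔ orderOf x = Nat.card G := by
    rw [Nat.div_eq_iff_eq_mul_left (orderOf_pos x) hdvd, one_mul, eq_comm]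
  simp_rw [← hiff]
  rw [← ArithmeticFunction.sum_divisors_moebius,
    ← Nat.divisors_filter_dvd_of_dvd hn (Nat.div_dvd_of_dvd hdvd), sum_filter]
  refine sum_congr rfl fun r hr => ?_
  have hr0 : (r : ℚ) ≠ 0 := by exact_mod_cast (Nat.pos_of_mem_divisors hr).ne'
  rw [IsCyclic.card_filter_pow_eq (Nat.dvd_of_mem_divisors hr)]
  split_ifs
  · field_simp
  · simp

lemma FiniteField.sum_moebius_div_mul_card_filter_pow_eq {F : Type*} [Field F] [Fintype F]
    [DecidableEq F] (a : F) :
    ∑ r ∈ (Fintype.card F - 1).divisors,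
        (ArithmeticFunction.moebius r : ℚ) / r * (#{y : F | y ≠ 0 ∧ y ^ r = a} : ℚ) =
      if orderOf a = Fintype.card F - 1 then 1 else 0 := by
  rcases eq_or_ne a 0 with rfl | ha
  · have h1 := Fintype.one_lt_card (α := F)
    rw [if_neg (by rw [orderOf_zero]; lia)]
    refine sum_eq_zero fun r _ => ?_
    rw [filter_eq_empty_iff.2 fun y _ hy => pow_ne_zero r hy.1 hy.2]
    simp
  · lift a to Fˣ using ha.isUnit
    have hc : Nat.card Fˣ = Fintype.card F - 1 := by
      rw [Nat.card_eq_fintype_card, Fintype.card_units]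
    rw [orderOf_units, ← hc, ← IsCyclic.sum_moebius_div_mul_card_filter_pow_eq]
    refine sum_congr rfl fun r _ => ?_
    congr 2
    symm
    refine card_bij (fun y _ => (y : F)) ?_ (fun _ _ _ _ h => Units.ext h) ?_
    · intro y hy
      simp only [mem_filter_univ] at hy ⊢
      exact ⟨y.ne_zero, by rw [← hy, Units.val_pow_eq_pow_val]⟩
    · intro y hy
      simp only [mem_filter_univ] at hy
      exact ⟨Units.mk0 y hy.1, by simpa [Units.ext_iff] using hy.2, rfl⟩

/-- The nonzero points `x` with `f (x_1 ^ r_1, …, x_s ^ r_s) = 0`, counted according to the zero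
of `f` they give. -/
lemma MvPolynomial.card_eval_pow_eq_zero {ι F : Type*} [Fintype ι] [DecidableEq ι] [Field F]
    [Fintype F] [DecidableEq F] (f : MvPolynomial ι F) (r : ι → ℕ) :
    Nat.card {x : ι → F // eval (fun i => x i ^ r i) f = 0 ∧ ∀ i, x i ≠ 0} =
      ∑ z : ι → F with eval z f = 0, ∏ i, #{y : F | y ≠ 0 ∧ y ^ r i = z i} := by
  rw [Nat.card_eq_fintype_card, Fintype.card_subtype,
    card_eq_sum_card_fiberwise (f := fun (x : ι → F) i => x i ^ r i)
      (t := {z : ι → F | eval z f = 0}) (fun x hx => by simp_all)]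
  refine sum_congr rfl fun z hz => ?_
  rw [← Fintype.card_piFinset]
  congr 1
  ext x
  simp only [mem_filter_univ] at hz
  simp only [mem_filter, mem_univ, true_and, Fintype.mem_piFinset, forall_and]
  refine ⟨fun h => ⟨h.1.2, congrFun h.2⟩, fun h => ⟨⟨?_, h.1⟩, _root_.funext h.2⟩⟩
  rw [_root_.funext h.2, hz]

theorem stmt_6 (q s : ℕ) (hs : 0 < s) (F : Type*) [Field F] [Fintype F]
    (hcard : Fintype.card F = q) (f : MvPolynomial (Fin s) F) :
    (Nat.card {x : Fin s → F //
        MvPolynomial.eval x f = 0 ∧ ∀ i, orderOf (x i) = q - 1} : ℚ) =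
      ∑ r ∈ Fintype.piFinset (fun _ : Fin s => (q - 1).divisors),
        (∏ i, (ArithmeticFunction.moebius (r i) : ℚ) / (r i)) *
          (Nat.card {x : Fin s → F //
            MvPolynomial.eval (fun i => x i ^ r i) f = 0 ∧ ∀ i, x i ≠ 0} : ℚ) := by
  classical
  subst hcard
  simp_rw [MvPolynomial.card_eval_pow_eq_zero, Nat.cast_sum, Nat.cast_prod, mul_sum]
  rw [sum_comm]
  simp_rw [← prod_mul_distrib]
  rw [Nat.card_eq_fintype_card, Fintype.card_subtype, ← filter_filter, natCast_card_filter]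
  refine sum_congr rfl fun z _ => ?_
  rw [← prod_univ_sum (fun _ => (Fintype.card F - 1).divisors)
    fun i r => (ArithmeticFunction.moebius r : ℚ) / r * (#{y : F | y ≠ 0 ∧ y ^ r = z i} : ℚ)]
  simp_rw [FiniteField.sum_moebius_div_mul_card_filter_pow_eq, prod_ite_zero, prod_const_one]
  simp
end

section
/- Let q be a prime power, let d be a positive divisor of q−1, and let t be the largest divisor of d that is coprime to (q−1)/d. Then the number of integers i with 1 ≤ i ≤ d such that gcd(((q−1)/d)·i + 1, q−1) = 1 equals (d/t)·φ(t). -/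
open Finset

theorem Nat.card_filter_Ico_add_mul_of_periodic {p : ℕ → Prop} [DecidablePred p] {t : ℕ}
    (hp : Function.Periodic p t) (a k : ℕ) :
    ((Ico a (a + k * t)).filter p).card = k * t.count p := by
  induction k with
  | zero => simp
  | succ k ih =>
    have h := Nat.filter_Ico_card_eq_of_periodic (a + k * t) t p hp
    rw [← Finset.Ico_union_Ico_eq_Ico (Nat.le_add_right a (k * t))
        (show a + k * t ≤ a + (k + 1) * t by gcongr; omega), filter_union,
      card_union_of_disjoint
        (disjoint_filter_filter (Ico_disjoint_Ico_consecutive _ _ _)), ih,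
      show a + (k + 1) * t = a + k * t + t by ring, h]
    ring

theorem Nat.count_coprime_mul_add_eq_totient {t n : ℕ} (h : Nat.Coprime t n) (c : ℕ) :
    t.count (fun i => t.Coprime (n * i + c)) = Nat.totient t := by
  rcases Nat.eq_zero_or_pos t with rfl | ht
  · simp
  have hinj : Set.InjOn (fun i => (n * i + c) % t) (range t : Set ℕ) := by
    intro i hi j hj hij
    have h1 : n * i ≡ n * j [MOD t] := Nat.ModEq.add_right_cancel' c hij
    have h2 : i ≡ j [MOD t] := Nat.ModEq.cancel_left_of_coprime h h1
    exact h2.eq_of_lt_of_lt (by simpa using hi) (by simpa using hj)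
  have himg : (range t).image (fun i => (n * i + c) % t) = range t := by
    refine eq_of_subset_of_card_le ?_ (Finset.card_image_of_injOn hinj).ge
    exact image_subset_iff.2 fun i _ => mem_range.2 (Nat.mod_lt _ ht)
  rw [Nat.totient_eq_card_coprime, Nat.count_eq_card_filter_range]
  conv_rhs => rw [← himg, filter_image, Finset.card_image_of_injOn (hinj.mono (mod_cast filter_subset _ _))]
  congr 1
  refine filter_congr fun i _ => ?_
  rw [Nat.coprime_iff_gcd_eq_one, Nat.coprime_iff_gcd_eq_one, Nat.gcd_comm t (_ % t),
    ← Nat.gcd_rec]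

theorem Nat.coprime_mul_add_one_iff_of_maximal {d n t : ℕ} (hd : 0 < d) (htd : t ∣ d)
    (htc : Nat.Coprime t n) (htmax : ∀ t', t' ∣ d → Nat.Coprime t' n → t' ≤ t) (i : ℕ) :
    Nat.Coprime (n * i + 1) (d * n) ↔ t.Coprime (n * i + 1) := by
  refine ⟨fun h => (h.coprime_dvd_right (htd.mul_right n)).symm, fun h => ?_⟩
  have hn : Nat.Coprime (n * i + 1) n := by simp
  refine Nat.Coprime.mul_right (Nat.coprime_of_dvd fun p hp hpi hpd => ?_) hn
  have hpn : Nat.Coprime p n := hn.coprime_dvd_left hpi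
  have hpt : Nat.Coprime t p := h.coprime_dvd_right hpi
  have hle := htmax (t * p) (hpt.mul_dvd_of_dvd_of_dvd htd hpd) (htc.mul_left hpn)
  nlinarith [hp.two_le, Nat.pos_of_dvd_of_pos htd hd]

theorem stmt_9 (q : ℕ) (hq : IsPrimePow q) (d : ℕ) (hd : 0 < d) (hdvd : d ∣ q - 1)
    (t : ℕ) (htd : t ∣ d) (htc : Nat.Coprime t ((q - 1) / d))
    (htmax : ∀ t', t' ∣ d → Nat.Coprime t' ((q - 1) / d) → t' ≤ t) :
    ((Finset.Icc 1 d).filter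
        (fun i => Nat.gcd ((q - 1) / d * i + 1) (q - 1) = 1)).card =
      d / t * Nat.totient t := by
  obtain ⟨n, hn⟩ := hdvd
  have hdiv : (q - 1) / d = n := by rw [hn, Nat.mul_div_cancel_left n hd]
  rw [hdiv] at htc ⊢
  simp only [hdiv] at htmax
  rw [hn]
  have hper : Function.Periodic (fun i => t.Coprime (n * i + 1)) t := fun i => by
    simp only [show n * (i + t) + 1 = n * i + 1 + n * t by ring,
      Nat.coprime_add_mul_right_right]
  have hIcc : Icc 1 d = Ico 1 (1 + d / t * t) := by
    rw [Nat.div_mul_cancel htd]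
    ext i
    simp only [mem_Icc, mem_Ico]
    omega
  have hiff := Nat.coprime_mul_add_one_iff_of_maximal hd htd htc htmax
  simp only [hiff, hIcc]
  rw [Nat.card_filter_Ico_add_mul_of_periodic hper, Nat.count_coprime_mul_add_eq_totient htc]
end

section
/- Let q be a prime power, s ≥ 2, let d_1, …, d_s be positive divisors of q−1, let a_1, …, a_s, b ∈ 𝔽_q^*, and for each i let R_i be a positive divisor of (q−1)/d_i. Then, as real numbers, N(R_1, …, R_s) ≥ (φ(R_1)/(R_1·d_1))⋯(φ(R_s)/(R_s·d_s)) · [ (q−1)^s/q − (1/√q)·∏_{i=1}^{s}(1 + (d_i·W(R_i) − 1)·√q) ]. -/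
open Finset

/-- `W n` is the number of squarefree divisors of `n`. -/
def W (n : ℕ) : ℕ := (n.divisors.filter Squarefree).card

/-- `h` is `(R, d)`-free in `F`: `h` lies in the group `C_d` of `d`-th powers of
nonzero elements, and whenever `h = g ^ e` with `g ∈ C_d` and `e` a positive
divisor of `R`, then `e = 1`. -/
def IsRdFree (F : Type*) [Field F] (R d : ℕ) (h : F) : Prop :=
  (∃ z : F, z ≠ 0 ∧ h = z ^ d) ∧
    ∀ (g : F) (e : ℕ), (∃ z : F, z ≠ 0 ∧ g = z ^ d) → 0 < e → e ∣ R → h = g ^ e → e = 1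

/-- `NFree F s a b d R` is the number of tuples `(y_1, …, y_s)` with
`a_1 y_1 + ⋯ + a_s y_s = b` such that each `y_i` is `(R_i, d_i)`-free. -/
noncomputable def NFree (F : Type*) [Field F] (s : ℕ) (a : Fin s → F) (b : F)
    (d R : Fin s → ℕ) : ℕ :=
  Nat.card {y : Fin s → F //
    (∑ i, a i * y i) = b ∧ ∀ i, IsRdFree F (R i) (d i) (y i)}

section CharacterExpansion

variable {F : Type*} [Field F]

/-- `f` is a linear combination of multiplicative characters whose coefficients have absolute
values summing to at most `B`. -/
def HasCharExpansion [Fintype (MulChar F ℂ)] (f : F → ℂ) (B : ℝ) : Prop :=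
  ∃ c : MulChar F ℂ → ℂ, (∀ y, f y = ∑ χ, c χ * χ y) ∧ ∑ χ, ‖c χ‖ ≤ B

namespace HasCharExpansion

variable [Fintype (MulChar F ℂ)] {f g : F → ℂ} {A B : ℝ}

theorem mulChar (χ : MulChar F ℂ) : HasCharExpansion χ 1 := by
  classical
  refine ⟨fun χ' => if χ' = χ then 1 else 0, fun y => by simp, ?_⟩
  simp [apply_ite norm]

theorem zero : HasCharExpansion (0 : F → ℂ) 0 :=
  ⟨0, fun y => by simp, by simp⟩

theorem const_mul (a : ℂ) (hf : HasCharExpansion f A) :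
    HasCharExpansion (fun y => a * f y) (‖a‖ * A) := by
  obtain ⟨c, hc, hA⟩ := hf
  refine ⟨fun χ => a * c χ, fun y => ?_, ?_⟩
  · simp only [hc, Finset.mul_sum, mul_assoc]
  · simp only [norm_mul, ← Finset.mul_sum]
    gcongr

theorem add (hf : HasCharExpansion f A) (hg : HasCharExpansion g B) :
    HasCharExpansion (fun y => f y + g y) (A + B) := by
  obtain ⟨c, hc, hA⟩ := hf
  obtain ⟨c', hc', hB⟩ := hg
  refine ⟨fun χ => c χ + c' χ, fun y => ?_, ?_⟩
  · simp only [hc, hc', add_mul, Finset.sum_add_distrib]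
  · calc _ ≤ ∑ χ, (‖c χ‖ + ‖c' χ‖) := Finset.sum_le_sum fun χ _ => norm_add_le _ _
      _ ≤ A + B := by rw [Finset.sum_add_distrib]; gcongr

theorem sum {ι : Type*} (s : Finset ι) {f : ι → F → ℂ} {A : ι → ℝ}
    (h : ∀ i ∈ s, HasCharExpansion (f i) (A i)) :
    HasCharExpansion (fun y => ∑ i ∈ s, f i y) (∑ i ∈ s, A i) := by
  classical
  induction s using Finset.induction_on with
  | empty => simpa using! (zero : HasCharExpansion (0 : F → ℂ) 0)
  | insert i s hi ih =>
    simp only [Finset.sum_insert hi]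
    exact (h i (by simp)).add (ih fun j hj => h j (by simp [hj]))

theorem mul (hf : HasCharExpansion f A) (hg : HasCharExpansion g B) :
    HasCharExpansion (fun y => f y * g y) (A * B) := by
  obtain ⟨c, hc, hA⟩ := hf
  obtain ⟨c', hc', hB⟩ := hg
  have hsum (h : MulChar F ℂ → ℂ) (χ : MulChar F ℂ) : ∑ χ', h (χ⁻¹ * χ') = ∑ χ', h χ' :=
    Equiv.sum_comp (Equiv.mulLeft χ⁻¹) h
  refine ⟨fun χ => ∑ χ', c χ' * c' (χ'⁻¹ * χ), fun y => ?_, ?_⟩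
  · simp only [hc, hc', Finset.sum_mul]
    rw [Finset.sum_comm]
    refine Finset.sum_congr rfl fun χ _ => ?_
    rw [← hsum _ χ, Finset.mul_sum]
    refine Finset.sum_congr rfl fun χ' _ => ?_
    have : χ' y = χ y * (χ⁻¹ * χ') y := by rw [← MulChar.mul_apply, mul_inv_cancel_left]
    rw [this]
    ring
  · calc _ ≤ ∑ χ, ∑ χ', ‖c χ'‖ * ‖c' (χ'⁻¹ * χ)‖ := by
          gcongr with χ
          exact (norm_sum_le _ _).trans_eq (by simp)
      _ = (∑ χ, ‖c χ‖) * ∑ χ, ‖c' χ‖ := by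
          rw [Finset.sum_comm, Finset.sum_mul]
          refine Finset.sum_congr rfl fun χ _ => ?_
          rw [← Finset.mul_sum]
          congr 1
          exact Equiv.sum_comp (Equiv.mulLeft χ⁻¹) fun χ' => ‖c' χ'‖
      _ ≤ A * B := by
          have : 0 ≤ A := le_trans (by positivity) hA
          gcongr

end HasCharExpansion

end CharacterExpansion

section Freeness

variable {F : Type*} [Field F]

/-- `y` is the `m`-th power of a nonzero element. -/
def IsNonzeroPow (m : ℕ) (y : F) : Prop := ∃ z : F, z ≠ 0 ∧ y = z ^ m

theorem IsNonzeroPow.ne_zero {m : ℕ} {y : F} (h : IsNonzeroPow m y) : y ≠ 0 := by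
  obtain ⟨z, hz, rfl⟩ := h
  exact pow_ne_zero _ hz

theorem isNonzeroPow_of_dvd {m n : ℕ} {y : F} (hmn : m ∣ n) (h : IsNonzeroPow n y) :
    IsNonzeroPow m y := by
  obtain ⟨z, hz, rfl⟩ := h
  obtain ⟨k, rfl⟩ := hmn
  exact ⟨z ^ k, pow_ne_zero _ hz, by rw [← pow_mul, mul_comm]⟩

theorem isRdFree_iff {R d : ℕ} (hR : R ≠ 0) (y : F) :
    IsRdFree F R d y ↔
      IsNonzeroPow d y ∧ ∀ p ∈ R.primeFactors, ¬ IsNonzeroPow (d * p) y := by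
  refine and_congr_right fun _ => ⟨fun h p hp ⟨z, hz, hy⟩ => ?_, fun h y' e hy' he heR hye => ?_⟩
  · have hp' := Nat.prime_of_mem_primeFactors hp
    exact hp'.one_lt.ne' (h (z ^ d) p ⟨z, hz, rfl⟩ hp'.pos (Nat.dvd_of_mem_primeFactors hp)
      (by rw [hy, pow_mul]))
  · by_contra he1
    obtain ⟨p, hp, hpe⟩ := Nat.exists_prime_and_dvd he1
    obtain ⟨z, hz, rfl⟩ := hy'
    refine h p (Nat.mem_primeFactors.2 ⟨hp, hpe.trans heR, hR⟩)
      (isNonzeroPow_of_dvd (mul_dvd_mul_left d hpe) ⟨z, hz, ?_⟩)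
    rw [hye, pow_mul]

variable [Fintype F]

theorem exists_generator_units :
    ∃ g : Fˣ, orderOf g = Fintype.card F - 1 ∧ (∀ x, x ∈ Subgroup.zpowers g) ∧
      ∀ y : F, y ≠ 0 → ∃ k : ℕ, y = (g : F) ^ k := by
  classical
  obtain ⟨g, hg⟩ := IsCyclic.exists_generator (α := Fˣ)
  refine ⟨g, ?_, hg, fun y hy => ?_⟩
  · rw [orderOf_eq_card_of_forall_mem_zpowers hg, Nat.card_eq_fintype_card, Fintype.card_units]
  · obtain ⟨k, hk⟩ := (mem_zpowers_iff_mem_range_orderOf.1 (hg (Units.mk0 y hy))) |> Finset.mem_image.1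
    exact ⟨k, by rw [← Units.val_pow_eq_pow_val, hk.2, Units.val_mk0]⟩

theorem isNonzeroPow_generator_pow {g : Fˣ} (hord : orderOf g = Fintype.card F - 1)
    (hg : ∀ y : F, y ≠ 0 → ∃ k : ℕ, y = (g : F) ^ k) {m : ℕ} (hm : m ∣ Fintype.card F - 1)
    (k : ℕ) : IsNonzeroPow m ((g : F) ^ k) ↔ m ∣ k := by
  constructor
  · rintro ⟨z, hz, h⟩
    obtain ⟨j, rfl⟩ := hg z hz
    rw [← pow_mul] at h
    have h' : g ^ k = g ^ (j * m) := Units.ext (by push_cast; exact h)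
    rw [pow_eq_pow_iff_modEq, hord] at h'
    exact (h'.of_dvd hm).dvd_iff dvd_rfl |>.2 (dvd_mul_left _ _)
  · rintro ⟨j, rfl⟩
    exact ⟨(g : F) ^ j, by simp, by rw [← pow_mul, mul_comm]⟩

theorem exists_mulChar_eq_one_iff_isNonzeroPow {m : ℕ} (hm : m ∣ Fintype.card F - 1) :
    ∃ χ : MulChar F ℂ, ∀ y : F, y ≠ 0 → (χ y = 1 ↔ IsNonzeroPow m y) ∧ χ y ^ m = 1 := by
  have hm0 : m ≠ 0 := by
    rintro rfl
    have := Fintype.one_lt_card (α := F)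
    rw [zero_dvd_iff] at hm
    omega
  obtain ⟨χ, hχ⟩ := MulChar.exists_mulChar_orderOf F hm (Complex.isPrimitiveRoot_exp m hm0)
  obtain ⟨g, hord, hgen, hg⟩ := exists_generator_units (F := F)
  have hpow (y : F) (hy : y ≠ 0) : χ y ^ m = 1 := by
    rw [← MulChar.pow_apply' χ hm0, ← hχ, pow_orderOf_eq_one,
      MulChar.one_apply (isUnit_iff_ne_zero.2 hy)]
  refine ⟨χ, fun y hy => ⟨⟨fun h => ?_, ?_⟩, hpow y hy⟩⟩
  · obtain ⟨k, rfl⟩ := hg y hy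
    rw [isNonzeroPow_generator_pow hord hg hm, ← hχ]
    apply orderOf_dvd_of_pow_eq_one
    rw [MulChar.eq_iff hgen, MulChar.pow_apply_coe, MulChar.one_apply_coe, ← map_pow, h]
  · rintro ⟨z, hz, rfl⟩
    rw [map_pow, hpow z hz]

theorem geom_sum_of_pow_eq_one {z : ℂ} {m : ℕ} (hz : z ^ m = 1) :
    ∑ j ∈ range m, z ^ j = if z = 1 then (m : ℂ) else 0 := by
  split_ifs with h
  · simp [h]
  · rw [geom_sum_eq h, hz]; simp

open Classical in
theorem hasCharExpansion_isNonzeroPow [Fintype (MulChar F ℂ)] {d : ℕ}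
    (hd : d ∣ Fintype.card F - 1) (hd0 : d ≠ 0) :
    HasCharExpansion (fun y : F => if IsNonzeroPow d y then (1 : ℂ) else 0) 1 := by
  obtain ⟨χ, hχ⟩ := exists_mulChar_eq_one_iff_isNonzeroPow hd
  have h := (HasCharExpansion.sum (range d) fun j _ =>
    HasCharExpansion.mulChar (χ ^ j)).const_mul (d : ℂ)⁻¹
  have hd' : (d : ℂ) ≠ 0 := by exact_mod_cast hd0
  convert h using 1
  · ext y
    by_cases hy : y = 0
    · subst hy
      have : ¬ IsNonzeroPow d (0 : F) := fun h => h.ne_zero rfl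
      simp [this, Finset.sum_eq_zero fun j _ => MulChar.map_zero (χ ^ j)]
    · lift y to Fˣ using isUnit_iff_ne_zero.2 hy
      simp only [MulChar.pow_apply_coe]
      rw [geom_sum_of_pow_eq_one (hχ y hy).2, ← (hχ y hy).1]
      split_ifs <;> simp [hd']
  · simp [hd0]

open Classical in
theorem hasCharExpansion_free [Fintype (MulChar F ℂ)] {d : ℕ} (hd : d ∣ Fintype.card F - 1)
    (hd0 : d ≠ 0) (P : Finset ℕ)
    (hP : ∀ p ∈ P, p ≠ 0 ∧ d * p ∣ Fintype.card F - 1) :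
    HasCharExpansion (fun y : F =>
      if IsNonzeroPow d y ∧ ∀ p ∈ P, ¬ IsNonzeroPow (d * p) y then (1 : ℂ) else 0)
      (∏ p ∈ P, (2 * (1 - (p : ℝ)⁻¹))) := by
  induction P using Finset.induction_on with
  | empty => simpa using hasCharExpansion_isNonzeroPow hd hd0
  | insert p P hpP ih =>
    specialize ih fun p hp => hP p (by simp [hp])
    obtain ⟨hp0, hdp⟩ := hP p (by simp)
    obtain ⟨χ, hχ⟩ := exists_mulChar_eq_one_iff_isNonzeroPow hdp
    have hp1 : (1 : ℝ) ≤ p := by exact_mod_cast Nat.one_le_iff_ne_zero.2 hp0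
    have hpc : (p : ℂ) ≠ 0 := by exact_mod_cast hp0
    have h := ((HasCharExpansion.mulChar (1 : MulChar F ℂ)).const_mul
      ((1 - (p : ℝ)⁻¹ : ℝ) : ℂ)).add
      ((HasCharExpansion.sum ((range p).erase 0) fun j _ =>
        HasCharExpansion.mulChar (χ ^ j)).const_mul (-(p : ℂ)⁻¹))
    have h' := h.mul ih
    rw [Finset.prod_insert hpP]
    convert h' using 1
    · ext y
      by_cases hy : y = 0
      · subst hy
        have : ¬ IsNonzeroPow d (0 : F) := fun h => h.ne_zero rfl
        simp [this]
      · lift y to Fˣ using isUnit_iff_ne_zero.2 hy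
        by_cases hyd : IsNonzeroPow d (y : F)
        · have hroot : χ y ^ p = 1 := by
            obtain ⟨z, hz, hyz⟩ := hyd
            rw [hyz, map_pow, ← pow_mul, (hχ z hz).2]
          have hmem : 0 ∈ range p := by simp; omega
          have hsum := geom_sum_of_pow_eq_one hroot
          rw [← Finset.add_sum_erase _ _ hmem, pow_zero] at hsum
          simp only [MulChar.pow_apply_coe, MulChar.one_apply_coe]
          rw [eq_sub_of_add_eq' hsum]
          have hval : ((1 - (p : ℝ)⁻¹ : ℝ) : ℂ) * 1
              + -(p : ℂ)⁻¹ * ((if χ y = 1 then (p : ℂ) else 0) - 1)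
              = if IsNonzeroPow (d * p) (y : F) then 0 else 1 := by
            rw [← (hχ y hy).1]
            push_cast
            split_ifs
            · field_simp; ring
            · ring
          rw [hval]
          by_cases h1 : IsNonzeroPow (d * p) (y : F) <;> simp [h1, hyd]
        · simp [hyd]
    · have : ‖((1 - (p : ℝ)⁻¹ : ℝ) : ℂ)‖ = 1 - (p : ℝ)⁻¹ := by
        rw [Complex.norm_real, Real.norm_of_nonneg]
        exact sub_nonneg.2 (inv_le_one_of_one_le₀ hp1)
      rw [this]
      have hmem : 0 ∈ range p := by simp; omega
      have hcard : (((range p).erase 0).card : ℝ) = p - 1 := by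
        rw [Finset.card_erase_of_mem hmem, card_range, Nat.cast_sub (by omega)]; simp
      simp only [norm_neg, norm_inv, Complex.norm_natCast, Finset.sum_const, nsmul_eq_mul, hcard]
      congr 1
      field_simp
      ring

theorem card_filter_coprime_range_mul (R t : ℕ) :
    ((range (R * t)).filter R.Coprime).card = t * R.totient := by
  induction t with
  | zero => simp
  | succ t ih =>
    rw [mul_add, mul_one, ← Nat.Ico_zero_eq_range,
      ← Finset.Ico_union_Ico_eq_Ico (Nat.zero_le (R * t)) (Nat.le_add_right _ R),
      Finset.filter_union, Finset.card_union_of_disjoint, Nat.filter_coprime_Ico_eq_totient,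
      Nat.Ico_zero_eq_range, ih]
    · ring
    · exact Finset.disjoint_filter_filter (Finset.Ico_disjoint_Ico_consecutive _ _ _)

open Classical in
theorem card_isRdFree {R d t : ℕ} (hR : R ≠ 0) (hRd : d * (R * t) = Fintype.card F - 1) :
    (univ.filter fun y : F => IsRdFree F R d y).card = t * R.totient := by
  rw [← card_filter_coprime_range_mul]
  obtain ⟨g, hord, -, hg⟩ := exists_generator_units (F := F)
  have hpos : 0 < Fintype.card F - 1 := by
    have := Fintype.one_lt_card (α := F)
    omega
  have hd0 : 0 < d := Nat.pos_of_ne_zero fun h => by simp [h] at hRd; omega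
  have hn0 : 0 < R * t := Nat.pos_of_ne_zero fun h => by simp [h] at hRd; omega
  have hfree (k : ℕ) : IsRdFree F R d ((g : F) ^ (d * k)) ↔ R.Coprime k := by
    rw [isRdFree_iff hR, isNonzeroPow_generator_pow hord hg ⟨_, hRd.symm⟩]
    have : ∀ p ∈ R.primeFactors,
        (¬ IsNonzeroPow (d * p) ((g : F) ^ (d * k)) ↔ ¬ p ∣ k) := fun p hp => by
      rw [isNonzeroPow_generator_pow hord hg, Nat.mul_dvd_mul_iff_left hd0]
      rw [← hRd]
      exact mul_dvd_mul_left d ((Nat.dvd_of_mem_primeFactors hp).mul_right t)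
    rw [forall₂_congr this]
    simp only [dvd_mul_right, true_and]
    constructor
    · intro h
      exact Nat.Coprime.symm <| Nat.coprime_of_dvd fun p hp hpk hpR =>
        h p (Nat.mem_primeFactors.2 ⟨hp, hpR, hR⟩) hpk
    · intro h p hp hpk
      exact (Nat.prime_of_mem_primeFactors hp).one_lt.ne'
        (Nat.eq_one_of_dvd_coprimes h (Nat.dvd_of_mem_primeFactors hp) hpk)
  symm
  refine Finset.card_bij (fun k _ => (g : F) ^ (d * k)) (fun k hk => ?_) (fun k hk l hl h => ?_)
    fun y hy => ?_
  · simp only [mem_filter, mem_univ, true_and] at hk ⊢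
    exact (hfree k).2 hk.2
  · have h' : g ^ (d * k) = g ^ (d * l) := Units.ext (by push_cast; exact h)
    rw [pow_eq_pow_iff_modEq, hord, ← hRd] at h'
    have h2 := Nat.ModEq.mul_left_cancel' hd0.ne' h'
    simp only [mem_filter, mem_range] at hk hl
    exact h2.eq_of_lt_of_lt hk.1 hl.1
  · simp only [mem_filter, mem_univ, true_and] at hy
    obtain ⟨z, hz, hyz⟩ := hy.1
    obtain ⟨j, rfl⟩ := hg z hz
    have hy' : y = (g : F) ^ (d * (j % (R * t))) := by
      rw [hyz, ← pow_mul, mul_comm j]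
      have : g ^ (d * j) = g ^ (d * (j % (R * t))) := by
        rw [pow_eq_pow_iff_modEq, hord, ← hRd]
        exact (Nat.mod_modEq j (R * t)).symm.mul_left' d
      exact_mod_cast congrArg Units.val this
    refine ⟨j % (R * t), ?_, hy'.symm⟩
    rw [hy', hfree] at hy
    simp only [mem_filter, mem_range]
    exact ⟨Nat.mod_lt _ hn0, hy⟩

end Freeness

theorem W_eq_two_pow {R : ℕ} (hR : R ≠ 0) : W R = 2 ^ R.primeFactors.card := by
  have h := Nat.sum_divisors_filter_squarefree hR (f := fun _ => (1 : ℕ))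
  rw [Finset.sum_const, Finset.sum_const, smul_eq_mul, smul_eq_mul, mul_one, mul_one,
    Finset.card_powerset] at h
  rw [W, h, Nat.factors_eq]
  rfl

theorem prod_primeFactors_two_mul {R : ℕ} (hR : R ≠ 0) :
    ∏ p ∈ R.primeFactors, (2 * (1 - (p : ℝ)⁻¹)) = W R * (R.totient / R) := by
  have h : (R.totient : ℝ) = R * ∏ p ∈ R.primeFactors, (1 - (p : ℝ)⁻¹) := by
    have := congrArg (Rat.cast : ℚ → ℝ) (Nat.totient_eq_mul_prod_factors R)
    push_cast at this
    exact this
  have hR' : (R : ℝ) ≠ 0 := by exact_mod_cast hR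
  rw [Finset.prod_mul_distrib, Finset.prod_const, W_eq_two_pow hR, h]
  push_cast
  field_simp

section GaussSums

variable {F : Type*} [Field F]

theorem MulChar.prod_apply_of_ne_zero {ι : Type*} (s : Finset ι) (χ : ι → MulChar F ℂ) {t : F}
    (ht : t ≠ 0) : (∏ i ∈ s, χ i) t = ∏ i ∈ s, χ i t := by
  classical
  induction s using Finset.induction_on with
  | empty => simpa using MulChar.one_apply (isUnit_iff_ne_zero.2 ht)
  | insert i s hi ih => rw [prod_insert hi, prod_insert hi, MulChar.mul_apply, ih]

theorem addChar_map_sum {ι : Type*} (s : Finset ι) (ψ : AddChar F ℂ) (x : ι → F) :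
    ψ (∑ i ∈ s, x i) = ∏ i ∈ s, ψ (x i) := by
  simpa [← ofAdd_sum] using map_prod ψ.toMonoidHom (fun i => Multiplicative.ofAdd (x i)) s

variable [Fintype F]

theorem norm_gaussSum_of_ne_one {χ : MulChar F ℂ} (hχ : χ ≠ 1) {ψ : AddChar F ℂ}
    (hψ : ψ.IsPrimitive) : ‖gaussSum χ ψ‖ = √(Fintype.card F) := by
  have h := gaussSum_mul_gaussSum_eq_card hχ hψ
  rw [← star_gaussSum_eq, ← starRingEnd_apply, Complex.mul_conj'] at h
  rw [← Real.sqrt_sq (norm_nonneg _)]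
  congr 1
  exact_mod_cast h

theorem norm_gaussSum_le (χ : MulChar F ℂ) {ψ : AddChar F ℂ} (hψ : ψ ≠ 1) :
    ‖gaussSum χ ψ‖ ≤ √(Fintype.card F) := by
  by_cases hχ : χ = 1
  · rw [hχ, gaussSum_one_left hψ, norm_neg, norm_one, Real.one_le_sqrt]
    exact_mod_cast Fintype.card_pos
  · exact (norm_gaussSum_of_ne_one hχ (AddChar.IsPrimitive.of_ne_one hψ)).le

theorem MulChar.norm_apply_of_ne_zero (χ : MulChar F ℂ) {a : F} (ha : a ≠ 0) : ‖χ a‖ = 1 := by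
  have hpos : Fintype.card F - 1 ≠ 0 := by
    have := Fintype.one_lt_card (α := F)
    omega
  refine Complex.norm_eq_one_of_pow_eq_one (n := Fintype.card F - 1) ?_ hpos
  rw [← map_pow, FiniteField.pow_card_sub_one_eq_one a ha, map_one]

theorem exists_addChar_isPrimitive : ∃ ψ : AddChar F ℂ, ψ.IsPrimitive := by
  obtain ⟨ψ, hψ⟩ := AddChar.exists_apply_ne_zero.2 (one_ne_zero : (1 : F) ≠ 0)
  exact ⟨ψ, AddChar.IsPrimitive.of_ne_one fun h => hψ (by simp [h])⟩

variable {ι : Type*} [Fintype ι] [DecidableEq ι] [DecidableEq F]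

theorem card_mul_sum_linear_eq {ψ : AddChar F ℂ} (hψ : ψ.IsPrimitive) (a : ι → F) (b : F)
    (f : ι → F → ℂ) :
    (Fintype.card F : ℂ) * ∑ y : ι → F, (if ∑ i, a i * y i = b then ∏ i, f i (y i) else 0) =
      ∑ t, ψ (t * -b) * ∏ i, ∑ y, f i y * ψ (t * a i * y) := by
  simp only [Finset.prod_univ_sum, Fintype.piFinset_univ, Finset.mul_sum]
  rw [Finset.sum_comm]
  refine Finset.sum_congr rfl fun y _ => ?_
  have h (t : F) : ψ (t * -b) * ∏ i, (f i (y i) * ψ (t * a i * y i)) =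
      (∏ i, f i (y i)) * ψ (t * (∑ i, a i * y i - b)) := by
    have : t * (∑ i, a i * y i - b) = ∑ i, t * a i * y i + t * -b := by
      simp only [mul_sub, Finset.mul_sum, mul_assoc]
      ring
    rw [Finset.prod_mul_distrib, this, AddChar.map_add_eq_mul, addChar_map_sum]
    ring
  simp only [h, ← Finset.mul_sum]
  rw [AddChar.sum_mulShift _ hψ]
  simp only [sub_eq_zero]
  split_ifs <;> simp [mul_comm]

theorem norm_card_mul_sum_linear_sub_le [Fintype (MulChar F ℂ)] {ψ : AddChar F ℂ}
    (hψ : ψ.IsPrimitive) {a : ι → F} (ha : ∀ i, a i ≠ 0) {b : F} (hb : b ≠ 0)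
    {f : ι → F → ℂ} {c : ι → MulChar F ℂ → ℂ} (hf : ∀ i y, f i y = ∑ χ, c i χ * χ y) :
    ‖(Fintype.card F : ℂ) * ∑ y : ι → F, (if ∑ i, a i * y i = b then ∏ i, f i (y i) else 0) -
      ∏ i, ∑ y, f i y‖ ≤ √(Fintype.card F) * ∏ i, ∑ χ, ‖c i χ‖ * ‖gaussSum χ ψ‖ := by
  have hshift (t : F) (ht : t ≠ 0) (i : ι) : ∑ y, f i y * ψ (t * a i * y) =
      ∑ χ, c i χ * (χ⁻¹ (a i) * gaussSum χ ψ) * χ⁻¹ t := by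
    simp only [hf, Finset.sum_mul]
    rw [Finset.sum_comm]
    refine Finset.sum_congr rfl fun χ _ => ?_
    have := gaussSum_mulShift_eq χ ψ (Units.mk0 (t * a i) (mul_ne_zero ht (ha i)))
    rw [Units.val_mk0, map_mul] at this
    rw [mul_assoc, mul_comm _ (χ⁻¹ t), ← mul_assoc (χ⁻¹ t), ← this, gaussSum, Finset.mul_sum]
    simp only [AddChar.mulShift_apply, mul_assoc]
  have key : (Fintype.card F : ℂ) *
        ∑ y : ι → F, (if ∑ i, a i * y i = b then ∏ i, f i (y i) else 0) - ∏ i, ∑ y, f i y =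
      ∑ χ : ι → MulChar F ℂ, (∏ i, c i (χ i) * ((χ i)⁻¹ (a i) * gaussSum (χ i) ψ)) *
        gaussSum (∏ i, (χ i)⁻¹) (ψ.mulShift (-b)) := by
    rw [card_mul_sum_linear_eq hψ, ← Finset.add_sum_erase _ _ (mem_univ (0 : F))]
    simp only [zero_mul, AddChar.map_zero_eq_one, mul_one, one_mul, add_sub_cancel_left, gaussSum,
      Finset.mul_sum]
    rw [Finset.sum_comm, ← Finset.add_sum_erase (univ : Finset F) _ (mem_univ (0 : F))]
    simp only [MulChar.map_zero, zero_mul, mul_zero, Finset.sum_const_zero, zero_add]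
    refine Finset.sum_congr rfl fun t ht => ?_
    have ht0 : t ≠ 0 := (Finset.mem_erase.1 ht).1
    simp only [hshift t ht0, Finset.prod_univ_sum, Fintype.piFinset_univ, Finset.mul_sum,
      Finset.prod_mul_distrib, MulChar.prod_apply_of_ne_zero _ _ ht0, AddChar.mulShift_apply,
      gaussSum]
    refine Finset.sum_congr rfl fun χ _ => ?_
    rw [mul_comm t]
    ring
  have hψb : ψ.mulShift (-b) ≠ 1 := hψ (neg_ne_zero.2 hb)
  rw [key, Finset.prod_univ_sum, Fintype.piFinset_univ, Finset.mul_sum]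
  refine (norm_sum_le _ _).trans (Finset.sum_le_sum fun χ _ => ?_)
  rw [norm_mul, norm_prod, mul_comm]
  refine mul_le_mul (norm_gaussSum_le _ hψb) (Finset.prod_le_prod (fun i _ => norm_nonneg _)
    fun i _ => ?_) (by positivity) (by positivity)
  rw [norm_mul, norm_mul, MulChar.norm_apply_of_ne_zero _ (ha i), one_mul]

end GaussSums

section FreeCoefficients

variable {F : Type*} [Field F] [Fintype F]

open Classical in
theorem coeff_one_mul_card_sub_one [Fintype (MulChar F ℂ)] {f : F → ℂ} {c : MulChar F ℂ → ℂ}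
    (hf : ∀ y, f y = ∑ χ, c χ * χ y) : c 1 * ((Fintype.card F : ℂ) - 1) = ∑ y, f y := by
  simp only [hf]
  rw [Finset.sum_comm]
  simp only [← Finset.mul_sum]
  rw [Finset.sum_eq_single 1 (fun χ _ hχ => by rw [MulChar.sum_eq_zero_of_ne_one hχ, mul_zero])
    (by simp), MulChar.sum_one_eq_card_units, Fintype.card_units, Nat.cast_sub Fintype.card_pos,
    Nat.cast_one]

open Classical in
theorem sum_isRdFree_indicator {d R : ℕ} (hd : 0 < d ∧ d ∣ Fintype.card F - 1)
    (hR : 0 < R ∧ R ∣ (Fintype.card F - 1) / d) :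
    ∑ y : F, (if IsRdFree F R d y then (1 : ℂ) else 0) =
      ((R.totient / (R * d) : ℝ) : ℂ) * ((Fintype.card F : ℂ) - 1) := by
  obtain ⟨hd0, hd⟩ := hd
  obtain ⟨hR0, t, ht⟩ := hR
  have hRd : d * (R * t) = Fintype.card F - 1 := by rw [← ht, Nat.mul_div_cancel' hd]
  have hq : (Fintype.card F : ℂ) - 1 = d * (R * t) := by
    rw [← Nat.cast_one, ← Nat.cast_sub Fintype.card_pos, ← hRd]
    push_cast
    ring
  have hdc : (d : ℂ) ≠ 0 := by exact_mod_cast hd0.ne'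
  have hRc : (R : ℂ) ≠ 0 := by exact_mod_cast hR0.ne'
  rw [Finset.sum_boole, card_isRdFree hR0.ne' hRd, hq]
  push_cast
  field_simp

open Classical in
theorem exists_isRdFree_expansion [Fintype (MulChar F ℂ)] {ψ : AddChar F ℂ} (hψ : ψ.IsPrimitive)
    {d R : ℕ} (hd : 0 < d ∧ d ∣ Fintype.card F - 1)
    (hR : 0 < R ∧ R ∣ (Fintype.card F - 1) / d) :
    ∃ c : MulChar F ℂ → ℂ,
      (∀ y : F, (if IsRdFree F R d y then (1 : ℂ) else 0) = ∑ χ, c χ * χ y) ∧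
      ∑ χ, ‖c χ‖ * ‖gaussSum χ ψ‖ ≤
        R.totient / (R * d) * (1 + ((d : ℝ) * W R - 1) * √(Fintype.card F)) := by
  have hd0 : d ≠ 0 := hd.1.ne'
  have hR0 : R ≠ 0 := hR.1.ne'
  have hdR : (d : ℝ) ≠ 0 := by exact_mod_cast hd0
  have hdRq : d * R ∣ Fintype.card F - 1 := by
    rw [← Nat.mul_div_cancel' hd.2]
    exact mul_dvd_mul_left d hR.2
  obtain ⟨c, hc, hcB⟩ := hasCharExpansion_free (F := F) hd.2 hd0 R.primeFactors fun p hp =>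
    ⟨(Nat.prime_of_mem_primeFactors hp).ne_zero,
      (mul_dvd_mul_left d (Nat.dvd_of_mem_primeFactors hp)).trans hdRq⟩
  simp only [← isRdFree_iff hR0] at hc
  rw [prod_primeFactors_two_mul hR0] at hcB
  refine ⟨c, hc, ?_⟩
  have hq1 : (Fintype.card F : ℂ) - 1 ≠ 0 := by
    rw [sub_ne_zero]
    exact_mod_cast (Fintype.one_lt_card (α := F)).ne'
  have hc1 : c 1 = ((R.totient / (R * d) : ℝ) : ℂ) := by
    apply mul_right_cancel₀ hq1
    rw [coeff_one_mul_card_sub_one hc, sum_isRdFree_indicator hd hR]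
  have hnorm : ‖c 1‖ = R.totient / (R * d) := by
    rw [hc1, Complex.norm_real, Real.norm_of_nonneg (by positivity)]
  have hψ1 : ψ ≠ 1 := by simpa using hψ one_ne_zero
  rw [← Finset.add_sum_erase _ _ (mem_univ (1 : MulChar F ℂ))] at hcB ⊢
  have hrest : ∑ χ ∈ univ.erase (1 : MulChar F ℂ), ‖c χ‖ * ‖gaussSum χ ψ‖ =
      (∑ χ ∈ univ.erase (1 : MulChar F ℂ), ‖c χ‖) * √(Fintype.card F) := by
    rw [Finset.sum_mul]
    refine Finset.sum_congr rfl fun χ hχ => ?_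
    rw [norm_gaussSum_of_ne_one (Finset.mem_erase.1 hχ).1 hψ]
  rw [hrest, gaussSum_one_left hψ1, norm_neg, norm_one, hnorm]
  rw [hnorm] at hcB
  calc _ ≤ (R.totient / (R * d) : ℝ) * 1 +
        (W R * (R.totient / R) - R.totient / (R * d)) * √(Fintype.card F) := by
        gcongr
        linarith
    _ = _ := by
        have hRR : (R : ℝ) ≠ 0 := by exact_mod_cast hR0
        field_simp

end FreeCoefficients

theorem stmt_13 (q s : ℕ) (hs : 2 ≤ s) (F : Type*) [Field F] [Fintype F]
    (hcard : Fintype.card F = q)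
    (d : Fin s → ℕ) (hd : ∀ i, 0 < d i ∧ d i ∣ q - 1)
    (a : Fin s → F) (ha : ∀ i, a i ≠ 0) (b : F) (hb : b ≠ 0)
    (R : Fin s → ℕ) (hR : ∀ i, 0 < R i ∧ R i ∣ (q - 1) / d i) :
    (NFree F s a b d R : ℝ) ≥
      (∏ i, (Nat.totient (R i) : ℝ) / (R i * d i)) *
        (((q : ℝ) - 1) ^ s / q - 1 / Real.sqrt q *
          ∏ i, (1 + ((d i : ℝ) * W (R i) - 1) * Real.sqrt q)) := by
  classical
  subst hcard
  have : Fintype (MulChar F ℂ) := Fintype.ofFinite _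
  obtain ⟨ψ, hψ⟩ := exists_addChar_isPrimitive (F := F)
  choose c hc hcB using fun i => exists_isRdFree_expansion hψ (hd i) (hR i)
  have hN : (NFree F s a b d R : ℂ) = ∑ y : Fin s → F, (if ∑ i, a i * y i = b then
      ∏ i, (if IsRdFree F (R i) (d i) (y i) then (1 : ℂ) else 0) else 0) := by
    rw [NFree, Nat.card_eq_fintype_card, Fintype.card_subtype, ← Finset.sum_boole]
    refine Finset.sum_congr rfl fun y _ => ?_
    rw [Finset.prod_ite_zero, Finset.prod_const_one, ← ite_and]
    simp
  have h := norm_card_mul_sum_linear_sub_le hψ ha hb hc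
  rw [← hN] at h
  simp only [sum_isRdFree_indicator (hd _) (hR _), Finset.prod_mul_distrib, Finset.prod_const,
    card_univ, Fintype.card_fin] at h
  have h' : |(Fintype.card F : ℝ) * NFree F s a b d R -
      (∏ i, ((R i).totient / (R i * d i) : ℝ)) * ((Fintype.card F : ℝ) - 1) ^ s| ≤
      √(Fintype.card F) * ∏ i, ∑ χ, ‖c i χ‖ * ‖gaussSum χ ψ‖ := by
    rw [← Real.norm_eq_abs, ← Complex.norm_real]
    exact_mod_cast h
  have hle : ∏ i, ∑ χ, ‖c i χ‖ * ‖gaussSum χ ψ‖ ≤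
      (∏ i, ((R i).totient / (R i * d i) : ℝ)) *
        ∏ i, (1 + ((d i : ℝ) * W (R i) - 1) * √(Fintype.card F)) := by
    rw [← Finset.prod_mul_distrib]
    exact Finset.prod_le_prod (fun i _ => by positivity) fun i _ => hcB i
  have hqpos : (0 : ℝ) < Fintype.card F := by exact_mod_cast Fintype.card_pos
  have hlow := (neg_le_of_abs_le h').trans' (neg_le_neg (mul_le_mul_of_nonneg_left hle
    (Real.sqrt_nonneg _)))
  have hsq : 1 / √(Fintype.card F) = √(Fintype.card F) / (Fintype.card F : ℝ) := by
    rw [Real.sqrt_div_self']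
  rw [hsq, ge_iff_le, ← mul_le_mul_iff_right₀ hqpos]
  calc _ = (∏ i, ((R i).totient / (R i * d i) : ℝ)) * ((Fintype.card F : ℝ) - 1) ^ s -
        √(Fintype.card F) * ((∏ i, ((R i).totient / (R i * d i) : ℝ)) *
          ∏ i, (1 + ((d i : ℝ) * W (R i) - 1) * √(Fintype.card F))) := by
        field_simp
    _ ≤ _ := by linarith
end

section
/- Let q be a prime power, s ≥ 2, let d_1, …, d_s be positive divisors of q−1, and let a_1, …, a_s, b ∈ 𝔽_q^*. For each i, let ℓ_i be a positive divisor of (q−1)/d_i and let p_1^{(i)}, …, p_{t_i}^{(i)} be exactly the primes dividing (q−1)/d_i that do not divide ℓ_i. Then N((q−1)/d_1, …, (q−1)/d_s) ≥ Σ_{j=1}^{t_1} N(ℓ_1·p_j^{(1)}, ℓ_2, …, ℓ_s) + ⋯ + Σ_{j=1}^{t_s} N(ℓ_1, …, ℓ_{s−1}, ℓ_s·p_j^{(s)}) − (t_1 + ⋯ + t_s − 1)·N(ℓ_1, …, ℓ_s). -/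
open Finset

/-- Freeness only needs to be tested on prime exponents. -/
theorem IsRdFree.of_prime {F : Type*} [Field F] {R d : ℕ} {h : F}
    (hC : ∃ z : F, z ≠ 0 ∧ h = z ^ d)
    (hprime : ∀ p : ℕ, p.Prime → p ∣ R → ∃ R', p ∣ R' ∧ IsRdFree F R' d h) :
    IsRdFree F R d h := by
  refine ⟨hC, ?_⟩
  rintro g e ⟨z, hz, rfl⟩ - heR hh
  by_contra he1
  obtain ⟨p, hp, k, rfl⟩ := Nat.exists_prime_and_dvd he1
  obtain ⟨R', hpR', hfree⟩ := hprime p hp ((dvd_mul_right p k).trans heR)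
  refine hp.ne_one (hfree.2 (z ^ (d * k)) p ⟨z ^ k, pow_ne_zero _ hz, ?_⟩ hp.pos hpR' ?_)
  · rw [← pow_mul, mul_comm]
  · rw [hh, ← pow_mul, ← pow_mul]
    congr 1
    ring

theorem IsRdFree.of_dvd {F : Type*} [Field F] {R R' d : ℕ} {h : F}
    (hfree : IsRdFree F R d h) (hdvd : R' ∣ R) : IsRdFree F R' d h :=
  ⟨hfree.1, fun g e hg he heR hh => hfree.2 g e hg he (heR.trans hdvd) hh⟩

/-- A Bonferroni-type sieve inequality: if every point of `A` lying in all the subsets `B j`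
lies in `C`, then `#C` is at least `∑ #(B j) - (#J - 1) * #A`. -/
theorem Finset.sum_card_sub_le_card {α ι : Type*} [DecidableEq α] (J : Finset ι) (A C : Finset α)
    (B : ι → Finset α) (hBA : ∀ j ∈ J, B j ⊆ A)
    (hC : ∀ x ∈ A, (∀ j ∈ J, x ∈ B j) → x ∈ C) :
    (∑ j ∈ J, (#(B j) : ℝ)) - ((#J : ℝ) - 1) * #A ≤ #C := by
  have hsub : A ⊆ C ∪ J.biUnion fun j => A \ B j := by
    intro x hx
    by_cases hxB : ∀ j ∈ J, x ∈ B j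
    · exact mem_union_left _ (hC x hx hxB)
    · push Not at hxB
      obtain ⟨j, hj, hxj⟩ := hxB
      exact mem_union_right _ (mem_biUnion.2 ⟨j, hj, mem_sdiff.2 ⟨hx, hxj⟩⟩)
  have hcard : #A ≤ #C + ∑ j ∈ J, #(A \ B j) :=
    (card_le_card hsub).trans ((card_union_le _ _).trans (by gcongr; exact card_biUnion_le))
  have hsum : ∑ j ∈ J, (#(A \ B j) : ℝ) = #J * #A - ∑ j ∈ J, (#(B j) : ℝ) := by
    rw [sum_congr rfl fun j hj => cast_card_sdiff (hBA j hj), sum_sub_distrib, sum_const,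
      nsmul_eq_mul]
  have hcard' : (#A : ℝ) ≤ #C + ∑ j ∈ J, (#(A \ B j) : ℝ) := by exact_mod_cast hcard
  linarith

theorem stmt_14 (q s : ℕ) (hs : 2 ≤ s) (F : Type*) [Field F] [Fintype F]
    (hcard : Fintype.card F = q)
    (d : Fin s → ℕ) (hd : ∀ i, 0 < d i ∧ d i ∣ q - 1)
    (a : Fin s → F) (ha : ∀ i, a i ≠ 0) (b : F) (hb : b ≠ 0)
    (ℓ : Fin s → ℕ) (hℓ : ∀ i, 0 < ℓ i ∧ ℓ i ∣ (q - 1) / d i)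
    (P : Fin s → Finset ℕ)
    (hP : ∀ i p, p ∈ P i ↔ p.Prime ∧ p ∣ (q - 1) / d i ∧ ¬ p ∣ ℓ i) :
    (NFree F s a b d (fun i => (q - 1) / d i) : ℝ) ≥
      (∑ i, ∑ p ∈ P i, (NFree F s a b d (Function.update ℓ i (ℓ i * p)) : ℝ)) -
        ((∑ i, ((P i).card : ℝ)) - 1) * (NFree F s a b d ℓ : ℝ) := by
  classical
  let S (R : Fin s → ℕ) : Finset (Fin s → F) :=
    {y | (∑ i, a i * y i) = b ∧ ∀ i, IsRdFree F (R i) (d i) (y i)}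
  have hN (R : Fin s → ℕ) : NFree F s a b d R = #(S R) := by
    simp only [NFree, S, Nat.card_eq_fintype_card, Fintype.card_subtype]
  have key := Finset.sum_card_sub_le_card (univ.sigma P) (S ℓ) (S fun i => (q - 1) / d i)
    (fun j => S (Function.update ℓ j.1 (ℓ j.1 * j.2))) ?_ ?_
  · simp only [hN]
    rw [sum_sigma, card_sigma] at key
    push_cast at key
    exact key
  · rintro ⟨i, p⟩ -
    refine monotone_filter_right _ fun y _ hy => ⟨hy.1, fun k => (hy.2 k).of_dvd ?_⟩
    by_cases hk : k = i
    · subst hk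
      simp
    · simp [hk]
  · intro y hy hyB
    simp only [S, mem_filter, mem_univ, true_and] at hy hyB ⊢
    refine ⟨hy.1, fun i => .of_prime (hy.2 i).1 fun p hp hpR => ?_⟩
    by_cases hpℓ : p ∣ ℓ i
    · exact ⟨ℓ i, hpℓ, hy.2 i⟩
    · refine ⟨ℓ i * p, dvd_mul_left p _, ?_⟩
      simpa using (hyB ⟨i, p⟩ (by simp [hP, hp, hpR, hpℓ])).2 i
end
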